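/- Let p < q be odd primes with q ≤ 2p + 1 and let H be a non-semisimple Hopf algebra over ℂ of dimension p·q. Let (P, π) be a projective cover of the trivial H-module. Then dim(P) is odd. -/

import Mathlib

namespace HopfOdd

open scoped TensorProduct

set_option linter.unusedSectionVars false

/-- Linearity over `ℂ` as a property of functions. -/
@[fun_prop]
def Lin {M N : Type*} [AddCommGroup M] [Module ℂ M] [AddCommGroup N] [Module ℂ N]
    (f : M → N) : Prop := IsLinearMap ℂ f

section Lin

variable {M N K A : Type*} [AddCommGroup M] [Module ℂ M] [AddCommGroup N] [Module ℂ N]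
  [AddCommGroup K] [Module ℂ K] [Ring A] [Algebra ℂ A]

@[fun_prop]
lemma lin_id : Lin (fun x : M => x) := ⟨fun _ _ => rfl, fun _ _ => rfl⟩

lemma Lin.map_add {f : M → N} (hf : Lin f) (x y : M) : f (x + y) = f x + f y :=
  IsLinearMap.map_add hf x y

lemma Lin.map_smul {f : M → N} (hf : Lin f) (c : ℂ) (x : M) : f (c • x) = c • f x :=
  IsLinearMap.map_smul hf c x

/-- The bundled linear map of a linear function. -/
def Lin.lm {f : M → N} (hf : Lin f) : M →ₗ[ℂ] N := IsLinearMap.mk' f hf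

@[simp]
lemma Lin.lm_apply {f : M → N} (hf : Lin f) (x : M) : hf.lm x = f x := rfl

@[fun_prop]
lemma Lin.comp {f : N → K} {g : M → N} (hf : Lin f) (hg : Lin g) : Lin (fun x => f (g x)) :=
  ⟨fun x y => by rw [hg.map_add, hf.map_add], fun c x => by rw [hg.map_smul, hf.map_smul]⟩

@[fun_prop]
lemma lin_linearMap (L : M →ₗ[ℂ] N) : Lin (fun x => L x) := ⟨L.map_add, L.map_smul⟩

@[fun_prop]
lemma lin_algHom {B : Type*} [Ring B] [Algebra ℂ B] (L : A →ₐ[ℂ] B) : Lin (fun x => L x) :=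
  lin_linearMap L.toLinearMap

@[fun_prop]
lemma lin_algEquiv {B : Type*} [Ring B] [Algebra ℂ B] (L : A ≃ₐ[ℂ] B) : Lin (fun x => L x) :=
  lin_linearMap L.toLinearMap

@[fun_prop]
lemma lin_mul_left (a : A) : Lin (fun x => a * x) := lin_linearMap (LinearMap.mulLeft ℂ a)

@[fun_prop]
lemma lin_mul_right (a : A) : Lin (fun x => x * a) := lin_linearMap (LinearMap.mulRight ℂ a)

@[fun_prop]
lemma lin_smul_left (a : N) : Lin (fun x : ℂ => x • a) := lin_linearMap (LinearMap.toSpanSingleton ℂ N a)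

@[fun_prop]
lemma lin_smul_right (c : ℂ) : Lin (fun x : N => c • x) := lin_linearMap (LinearMap.lsmul ℂ N c)

@[fun_prop]
lemma lin_tmul_left (a : N) : Lin (fun x : M => x ⊗ₜ[ℂ] a) :=
  lin_linearMap ((TensorProduct.mk ℂ M N).flip a)

@[fun_prop]
lemma lin_tmul_right (a : M) : Lin (fun x : N => a ⊗ₜ[ℂ] x) :=
  lin_linearMap ((TensorProduct.mk ℂ M N) a)

@[fun_prop]
lemma lin_sum {ι : Type*} (s : Finset ι) (f : ι → M → N) (hf : ∀ i, Lin (f i)) :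
    Lin (fun x => ∑ i ∈ s, f i x) :=
  ⟨fun x y => by simp only [(hf _).map_add, Finset.sum_add_distrib],
    fun c x => by simp only [(hf _).map_smul, Finset.smul_sum]⟩

end Lin

section Sw

variable {H : Type*} [Ring H] [HopfAlgebra ℂ H]
variable {M N A : Type*} [AddCommGroup M] [Module ℂ M] [AddCommGroup N] [Module ℂ N]
  [Ring A] [Algebra ℂ A]

open Coalgebra in
/-- The Sweedler sum `∑ f h₍₁₎ h₍₂₎`. -/
noncomputable def sw (f : H → H → M) (h : H) : M :=
  ∑ i ∈ (ℛ ℂ h).index, f ((ℛ ℂ h).left i) ((ℛ ℂ h).right i)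

lemma map_comul (L : H ⊗[ℂ] H →ₗ[ℂ] M) (h : H) :
    L (Coalgebra.comul h) = sw (fun a b => L (a ⊗ₜ b)) h := by
  rw [← (Coalgebra.Repr.arbitrary ℂ h).eq, map_sum]; rfl

lemma comul_eq_sw (h : H) : Coalgebra.comul (R := ℂ) h = sw (fun a b => a ⊗ₜ[ℂ] b) h :=
  map_comul LinearMap.id h

/-- The linear map on the tensor product attached to a bilinear function. -/
noncomputable def bil {K : Type*} [AddCommGroup K] [Module ℂ K] (f : M → N → K)
    (h1 : ∀ b, Lin fun a => f a b) (h2 : ∀ a, Lin fun b => f a b) : M ⊗[ℂ] N →ₗ[ℂ] K :=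
  TensorProduct.lift (LinearMap.mk₂ ℂ f (fun a a' b => (h1 b).map_add a a')
    (fun c a b => (h1 b).map_smul c a) (fun a b b' => (h2 a).map_add b b')
    (fun c a b => (h2 a).map_smul c b))

lemma bil_tmul {K : Type*} [AddCommGroup K] [Module ℂ K] (f : M → N → K)
    (h1 : ∀ b, Lin fun a => f a b) (h2 : ∀ a, Lin fun b => f a b) (a : M) (b : N) :
    bil f h1 h2 (a ⊗ₜ b) = f a b := by
  simp [bil]

lemma sw_eq_bil (f : H → H → M) (h1 : ∀ b, Lin fun a => f a b) (h2 : ∀ a, Lin fun b => f a b)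
    (h : H) : sw f h = bil f h1 h2 (Coalgebra.comul h) := by
  rw [map_comul]; simp only [bil_tmul]

@[fun_prop]
lemma lin_sw (f : H → H → M) (h1 : ∀ b, Lin fun a => f a b) (h2 : ∀ a, Lin fun b => f a b) :
    Lin (fun h => sw f h) := by
  have : (fun h => sw f h) = fun h => bil f h1 h2 (Coalgebra.comul h) := by
    funext h; exact sw_eq_bil f h1 h2 h
  rw [this]; fun_prop

@[fun_prop]
lemma lin_sw_param (f : N → H → H → M) (h : H) (h1 : ∀ a b, Lin fun x => f x a b) :
    Lin (fun x => sw (f x) h) := by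
  unfold sw; fun_prop

/-- Linear functions commute with Sweedler sums. -/
lemma Lin.sw {L : M → N} (hL : Lin L) (f : H → H → M) (h : H) :
    L (sw f h) = sw (fun a b => L (f a b)) h :=
  map_sum (IsLinearMap.mk' L hL) _ _

lemma sw_comm {H' : Type*} [Ring H'] [HopfAlgebra ℂ H'] (f : H → H → H' → H' → M) (h : H) (k : H') :
    sw (fun a b => sw (fun c d => f a b c d) k) h = sw (fun c d => sw (fun a b => f a b c d) h) k :=
  Finset.sum_comm

lemma sw_sum {ι : Type*} (s : Finset ι) (f : ι → H → H → M) (h : H) :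
    sw (fun a b => ∑ i ∈ s, f i a b) h = ∑ i ∈ s, sw (f i) h :=
  Finset.sum_comm

lemma mul_sw (x : A) (f : H → H → A) (h : H) : x * sw f h = sw (fun a b => x * f a b) h :=
  Finset.mul_sum _ _ _

lemma sw_mul (x : A) (f : H → H → A) (h : H) : sw f h * x = sw (fun a b => f a b * x) h :=
  Finset.sum_mul _ _ _

lemma smul_sw (x : ℂ) (f : H → H → M) (h : H) : x • sw f h = sw (fun a b => x • f a b) h :=
  Finset.smul_sum

lemma sw_smul (x : M) (f : H → H → ℂ) (h : H) : sw f h • x = sw (fun a b => f a b • x) h :=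
  Finset.sum_smul

lemma exists_trilinear (T : H → H → H → M) (h1 : ∀ b c, Lin fun a => T a b c)
    (h2 : ∀ a c, Lin fun b => T a b c) (h3 : ∀ a b, Lin fun c => T a b c) :
    ∃ L : H ⊗[ℂ] (H ⊗[ℂ] H) →ₗ[ℂ] M, ∀ a b c, L (a ⊗ₜ (b ⊗ₜ c)) = T a b c := by
  refine ⟨bil (fun a => bil (T a) (h2 a) (h3 a)) (fun x => ?_) (fun a => by fun_prop),
    fun a b c => by simp only [bil_tmul]⟩
  induction x with
  | zero => simpa using lin_linearMap (0 : H →ₗ[ℂ] M)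
  | tmul b c => simp only [bil_tmul]; fun_prop
  | add x y hx hy =>
    simp only [map_add]
    exact ⟨fun a b => by rw [hx.map_add, hy.map_add]; abel,
      fun c a => by rw [hx.map_smul, hy.map_smul, smul_add]⟩

lemma sw_assoc (T : H → H → H → M) (h1 : ∀ b c, Lin fun a => T a b c)
    (h2 : ∀ a c, Lin fun b => T a b c) (h3 : ∀ a b, Lin fun c => T a b c) (h : H) :
    sw (fun a b => sw (fun c d => T c d b) a) h = sw (fun a b => sw (fun c d => T a c d) b) h := by
  obtain ⟨L, hL⟩ := exists_trilinear T h1 h2 h3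
  have key := congrArg L (Coalgebra.coassoc_apply (R := ℂ) h)
  have e1 := map_comul (L ∘ₗ (TensorProduct.assoc ℂ H H H).toLinearMap ∘ₗ
      LinearMap.rTensor H (Coalgebra.comul (R := ℂ) (A := H))) h
  have e2 := map_comul (L ∘ₗ LinearMap.lTensor H (Coalgebra.comul (R := ℂ) (A := H))) h
  simp only [LinearMap.comp_apply, LinearEquiv.coe_coe, LinearMap.rTensor_tmul,
    LinearMap.lTensor_tmul] at e1 e2
  have f1 : ∀ a b : H, L ((TensorProduct.assoc ℂ H H H) (Coalgebra.comul (R := ℂ) a ⊗ₜ[ℂ] b)) =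
      sw (fun c d => T c d b) a := fun a b => by
    simpa [hL] using map_comul (L ∘ₗ (TensorProduct.assoc ℂ H H H).toLinearMap ∘ₗ
      (TensorProduct.mk ℂ (H ⊗[ℂ] H) H).flip b) a
  have f2 : ∀ a b : H, L (a ⊗ₜ[ℂ] Coalgebra.comul (R := ℂ) b) = sw (fun c d => T a c d) b :=
    fun a b => by
    simpa [hL] using map_comul (L ∘ₗ (TensorProduct.mk ℂ H (H ⊗[ℂ] H)) a) b
  simp only [f1] at e1
  simp only [f2] at e2
  exact e1.symm.trans (key.trans e2)

open Coalgebra HopfAlgebra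

lemma sw_mul_arg (f : H → H → M) (h1 : ∀ b, Lin fun a => f a b) (h2 : ∀ a, Lin fun b => f a b)
    (x y : H) : sw f (x * y) = sw (fun a b => sw (fun c d => f (a * c) (b * d)) y) x := by
  rw [sw_eq_bil f h1 h2, Bialgebra.comul_mul, comul_eq_sw x, comul_eq_sw y, sw_mul,
    (lin_linearMap _).sw]
  congr 1; funext a b
  rw [mul_sw, (lin_linearMap _).sw]
  simp only [Algebra.TensorProduct.tmul_mul_tmul, bil_tmul]

lemma sw_one (f : H → H → M) (h1 : ∀ b, Lin fun a => f a b) (h2 : ∀ a, Lin fun b => f a b) :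
    sw f 1 = f 1 1 := by
  rw [sw_eq_bil f h1 h2, Bialgebra.comul_one, Algebra.TensorProduct.one_def, bil_tmul]

lemma sw_counit_left (f : H → M) (hf : Lin f) (h : H) :
    sw (fun a b => counit (R := ℂ) a • f b) h = f h := by
  have := congrArg (bil (fun (c : ℂ) (x : H) => c • f x) (by fun_prop) (by fun_prop))
    (Coalgebra.rTensor_counit_comul (R := ℂ) h)
  rw [bil_tmul, one_smul] at this
  rw [← this]
  refine Eq.trans ?_ (map_comul ((bil (fun (c : ℂ) (x : H) => c • f x) (by fun_prop)
    (by fun_prop)) ∘ₗ LinearMap.rTensor H (counit (R := ℂ) (A := H))) h).symm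
  simp only [LinearMap.comp_apply, LinearMap.rTensor_tmul, bil_tmul]

lemma sw_counit_right (f : H → M) (hf : Lin f) (h : H) :
    sw (fun a b => counit (R := ℂ) b • f a) h = f h := by
  have := congrArg (bil (fun (x : H) (c : ℂ) => c • f x) (by fun_prop) (by fun_prop))
    (Coalgebra.lTensor_counit_comul (R := ℂ) h)
  rw [bil_tmul, one_smul] at this
  rw [← this]
  refine Eq.trans ?_ (map_comul ((bil (fun (x : H) (c : ℂ) => c • f x) (by fun_prop)
    (by fun_prop)) ∘ₗ LinearMap.lTensor H (counit (R := ℂ) (A := H))) h).symm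
  simp only [LinearMap.comp_apply, LinearMap.lTensor_tmul, bil_tmul]

/-- The antipode as a plain function. -/
noncomputable abbrev S (h : H) : H := antipode ℂ h

lemma sw_S_mul (f : H → M) (hf : Lin f) (h : H) :
    sw (fun a b => f (S a * b)) h = counit (R := ℂ) h • f 1 := by
  have h1 := (lin_linearMap (LinearMap.id : H →ₗ[ℂ] H)).sw (fun a b => S a * b) h
  have h2 : sw (fun a b => S a * b) h = counit (R := ℂ) h • (1 : H) :=
    sum_antipode_mul_eq_smul (Coalgebra.Repr.arbitrary ℂ h)
  rw [← hf.sw, h2, hf.map_smul]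

lemma sw_mul_S (f : H → M) (hf : Lin f) (h : H) :
    sw (fun a b => f (a * S b)) h = counit (R := ℂ) h • f 1 := by
  have h2 : sw (fun a b => a * S b) h = counit (R := ℂ) h • (1 : H) :=
    sum_mul_antipode_eq_smul (Coalgebra.Repr.arbitrary ℂ h)
  rw [← hf.sw, h2, hf.map_smul]

lemma comul_S (h : H) : comul (R := ℂ) (S h) = sw (fun a b => S b ⊗ₜ[ℂ] S a) h := by
  let G : H → H ⊗[ℂ] H := fun h => sw (fun a b => S b ⊗ₜ[ℂ] S a) h
  have hG : Lin G := by fun_prop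
  have hc : ∀ x y : H, comul (R := ℂ) x * comul (R := ℂ) y = comul (R := ℂ) (x * y) := fun x y =>
    (Bialgebra.comul_mul x y).symm
  have key : ∀ h : H, sw (fun a b => G a * comul (R := ℂ) b) h = counit (R := ℂ) h • 1 := by
    intro h
    have : ∀ a b : H, G a * comul (R := ℂ) b =
        sw (fun c d => sw (fun e f => (S d * e) ⊗ₜ[ℂ] (S c * f)) b) a := by
      intro a b
      rw [comul_eq_sw, sw_mul]
      simp only [mul_sw, Algebra.TensorProduct.tmul_mul_tmul]
    simp only [this]
    rw [sw_assoc (fun c d b => sw (fun e f => (S d * e) ⊗ₜ[ℂ] (S c * f)) b)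
      (by fun_prop) (by fun_prop) (by fun_prop)]
    have : ∀ a b : H, sw (fun c d => sw (fun e f => (S c * e) ⊗ₜ[ℂ] (S a * f)) d) b
        = (1 : H) ⊗ₜ[ℂ] (S a * b) := by
      intro a b
      rw [← sw_assoc (fun c e f => (S c * e) ⊗ₜ[ℂ] (S a * f)) (by fun_prop) (by fun_prop)
        (by fun_prop)]
      have : ∀ u v : H, sw (fun c d => (S c * d) ⊗ₜ[ℂ] (S a * v)) u
        = counit (R := ℂ) u • (1 : H) ⊗ₜ[ℂ] (S a * v) := fun u v =>
        sw_S_mul (fun x => x ⊗ₜ[ℂ] (S a * v)) (by fun_prop) u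
      simp only [this]
      exact sw_counit_left (fun v => (1 : H) ⊗ₜ[ℂ] (S a * v)) (by fun_prop) b
    simp only [this]
    rw [sw_S_mul (fun x => (1 : H) ⊗ₜ[ℂ] x) (by fun_prop), Algebra.TensorProduct.one_def]
  have e1 : sw (fun a b => sw (fun c d => G c * comul (R := ℂ) d) a * comul (R := ℂ) (S b)) h
      = comul (R := ℂ) (S h) := by
    simp only [key, smul_mul_assoc, one_mul]
    exact sw_counit_left (fun x => comul (R := ℂ) (S x)) (by fun_prop) h
  have e2 : sw (fun a b => sw (fun c d => G a * comul (R := ℂ) (c * S d)) b) h = G h := by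
    have : ∀ a b : H, sw (fun c d => G a * comul (R := ℂ) (c * S d)) b
        = counit (R := ℂ) b • G a := fun a b => by
      rw [sw_mul_S (fun x => G a * comul (R := ℂ) x) (by fun_prop), Bialgebra.comul_one, mul_one]
    simp only [this]
    exact sw_counit_right _ hG h
  rw [← e1]
  refine Eq.trans ?_ e2
  simp only [sw_mul]
  rw [sw_assoc (fun c d b => G c * comul (R := ℂ) d * comul (R := ℂ) (S b))
      (by fun_prop) (by fun_prop) (by fun_prop)]
  simp only [mul_assoc, hc]

lemma sw_S (f : H → H → M) (h1 : ∀ b, Lin fun a => f a b) (h2 : ∀ a, Lin fun b => f a b)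
    (x : H) : sw f (S x) = sw (fun a b => f (S b) (S a)) x := by
  rw [sw_eq_bil f h1 h2, comul_S, (lin_linearMap _).sw]
  simp only [bil_tmul]

lemma S_mul (x y : H) : S (x * y) = S y * S x := antipode_mul_antidistrib x y

lemma counit_S (x : H) : counit (R := ℂ) (S x) = counit (R := ℂ) x := counit_antipode x

lemma S_one : S (1 : H) = 1 := antipode_one

end Sw

section Tr

variable {V W : Type*} [AddCommGroup V] [Module ℂ V] [AddCommGroup W] [Module ℂ W]

open Classical in
/-- The trace of a function, which is meaningful for linear functions. -/
noncomputable def tr (f : V → V) : ℂ :=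
  if h : Lin f then LinearMap.trace ℂ V (IsLinearMap.mk' f h) else 0

lemma tr_eq {f : V → V} (h : Lin f) : tr f = LinearMap.trace ℂ V (IsLinearMap.mk' f h) := by
  rw [tr, dif_pos h]

lemma tr_linearMap (L : V →ₗ[ℂ] V) : tr (fun x => L x) = LinearMap.trace ℂ V L := by
  rw [tr_eq (lin_linearMap L)]; rfl

variable [Module.Finite ℂ V] [Module.Finite ℂ W]

lemma tr_comm {f : V → W} {g : W → V} (hf : Lin f) (hg : Lin g) :
    tr (fun x => g (f x)) = tr (fun x => f (g x)) := by
  rw [tr_eq (by fun_prop), tr_eq (by fun_prop)]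
  exact LinearMap.trace_comp_comm' (IsLinearMap.mk' f hf) (IsLinearMap.mk' g hg)

lemma tr_sum {ι : Type*} (s : Finset ι) (f : ι → V → V) (hf : ∀ i, Lin (f i)) :
    tr (fun x => ∑ i ∈ s, f i x) = ∑ i ∈ s, tr (f i) := by
  rw [tr_eq (by fun_prop)]
  simp only [tr_eq (hf _)]
  rw [← map_sum]
  congr 1; ext x; simp only [LinearMap.sum_apply]; rfl

lemma tr_smul (c : ℂ) (f : V → V) (hf : Lin f) : tr (fun x => c • f x) = c * tr f := by
  rw [tr_eq (by fun_prop), tr_eq hf, ← smul_eq_mul, ← map_smul]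
  rfl

lemma tr_smulRight (f : V →ₗ[ℂ] ℂ) (v : V) : tr (fun x => f x • v) = f v := by
  have := tr_comm (f := fun x => f x) (g := fun c : ℂ => c • v) (by fun_prop) (by fun_prop)
  rw [this]
  have e : (fun x : ℂ => f (x • v)) = fun x => (f v • (LinearMap.id : ℂ →ₗ[ℂ] ℂ)) x := by
    funext x; simp [mul_comm]
  rw [e, tr_linearMap]; simp

lemma tr_add (f g : V → V) (hf : Lin f) (hg : Lin g) :
    tr (fun x => f x + g x) = tr f + tr g := by
  have h : Lin (fun x => f x + g x) :=
    ⟨fun x y => by rw [hf.map_add, hg.map_add]; abel,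
      fun c x => by rw [hf.map_smul, hg.map_smul, smul_add]⟩
  rw [tr_eq h, tr_eq hf, tr_eq hg, ← map_add]; rfl

lemma sum_coord {ι : Type*} [Fintype ι] (e : Module.Basis ι ℂ V) (F : V → W) (hF : Lin F) (u : V) :
    ∑ k, e.coord k u • F (e k) = F u := by
  conv_rhs => rw [← e.sum_repr u]
  exact ((map_sum (IsLinearMap.mk' F hF) _ _).trans
    (Finset.sum_congr rfl fun k _ => hF.map_smul _ _)).symm

end Tr

section Integral

open Coalgebra HopfAlgebra

variable {H : Type*} [Ring H] [HopfAlgebra ℂ H]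

lemma sw_SS {M : Type*} [AddCommGroup M] [Module ℂ M] (f : H → H → M)
    (h1 : ∀ b, Lin fun a => f a b) (h2 : ∀ a, Lin fun b => f a b)
    (x : H) : sw f (S (S x)) = sw (fun a b => f (S (S a)) (S (S b))) x := by
  rw [sw_S f h1 h2, sw_S _ (by fun_prop) (by fun_prop)]

/-- Left invariant functionals. -/
def LeftInv (l : H →ₗ[ℂ] ℂ) : Prop := ∀ h : H, sw (fun a b => l b • a) h = l h • (1 : H)

/-- The Radford trace functional. -/
noncomputable def radTr (f : H →ₗ[ℂ] ℂ) (x : H) : ℂ :=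
  tr (fun y => sw (fun a b => f b • (x * S (S a))) y)

variable [Module.Finite ℂ H]

lemma lin_radTr (f : H →ₗ[ℂ] ℂ) : Lin (radTr f) := by
  refine ⟨fun x y => ?_, fun c x => ?_⟩
  · unfold radTr
    rw [← tr_add _ _ (by fun_prop) (by fun_prop)]
    congr 1; funext z
    simp only [sw, add_mul, smul_add, Finset.sum_add_distrib]
  · unfold radTr
    rw [smul_eq_mul, ← tr_smul _ _ (by fun_prop)]
    congr 1; funext z
    simp only [smul_sw, smul_mul_assoc]
    congr 1; funext a b; rw [smul_comm]

lemma sw_SS_mul_S {M : Type*} [AddCommGroup M] [Module ℂ M] (F : H → M) (hF : Lin F) (h : H) :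
    sw (fun a b => F (S (S b) * S a)) h = counit (R := ℂ) h • F 1 := by
  have := sw_mul_S (fun x => F (S x)) (by fun_prop) h
  simpa [S_mul, S_one] using this

lemma tr_sw {V : Type*} [AddCommGroup V] [Module ℂ V] [Module.Finite ℂ V] (F : H → H → V → V)
    (x : H) (hF : ∀ a b, Lin (F a b)) :
    tr (fun y => sw (fun a b => F a b y) x) = sw (fun a b => tr (F a b)) x :=
  tr_sum _ _ fun _ => hF _ _

lemma radTr_invariant (f : H →ₗ[ℂ] ℂ) (x : H) :
    sw (fun a b => radTr f b • a) x = radTr f x • (1 : H) := by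
  refine (Module.forall_dual_apply_eq_zero_iff ℂ _).1 ?_ |> sub_eq_zero.1
  intro φ
  rw [map_sub, sub_eq_zero, (lin_linearMap φ).sw, map_smul, smul_eq_mul]
  simp only [map_smul, smul_eq_mul]
  let e := Module.finBasis ℂ H
  let K : H → H := fun y => sw (fun a b => f b • (x * S (S a))) y
  have hK : Lin K := by fun_prop
  let C : Fin (Module.finrank ℂ H) → H → H := fun k z => sw (fun a b => φ (a * S (e k)) • b) z
  let Kk : Fin (Module.finrank ℂ H) → H → H := fun k y => sw (fun a b => e.coord k a • K b) y
  have hC : ∀ k, Lin (C k) := fun k => by fun_prop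
  have hKk : ∀ k, Lin (Kk k) := fun k => by fun_prop
  have e1 : sw (fun a b => radTr f b * φ a) x =
      tr (fun y => sw (fun a b => φ a • sw (fun c d => f d • (b * S (S c))) y) x) := by
    rw [tr_sw _ _ (by fun_prop)]
    congr 1; funext a b
    rw [tr_smul _ _ (by fun_prop), mul_comm]; rfl
  have e2 : (fun y => sw (fun a b => φ a • sw (fun c d => f d • (b * S (S c))) y) x)
      = fun y => ∑ k, C k (Kk k y) := by
    funext y
    have : ∀ k, C k (Kk k y) = sw (fun a b => e.coord k a • C k (K b)) y := fun k => by
      rw [(hC k).sw]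
      simp only [(hC k).map_smul]
    simp only [this]
    rw [← sw_sum]
    have : ∀ a b : H, ∑ k, e.coord k a • C k (K b) = sw (fun c d => φ (c * S a) • d) (K b) :=
      fun a b => sum_coord e (fun u => sw (fun c d => φ (c * S u) • d) (K b)) (by fun_prop) a
    simp only [this]
    have e3 : ∀ a b : H, sw (fun c d => φ (c * S a) • d) (K b) =
        sw (fun u w => sw (fun u' v => sw (fun c d =>
          f v • φ (c * (S (S u) * S a)) • (d * S (S u'))) x) w) b := by
      intro a b
      rw [(by fun_prop : Lin fun z => sw (fun c d => φ (c * S a) • d) z).sw]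
      rw [← sw_assoc (fun u u' v => sw (fun c d =>
          f v • φ (c * (S (S u) * S a)) • (d * S (S u'))) x) (by fun_prop) (by fun_prop)
          (by fun_prop)]
      congr 1; funext u v
      rw [(by fun_prop : Lin fun z => sw (fun c d => φ (c * S a) • d) z).map_smul,
        sw_mul_arg _ (by fun_prop) (by fun_prop), sw_comm,
        sw_SS _ (by fun_prop) (by fun_prop), smul_sw]
      congr 1; funext c d
      rw [smul_sw]
      simp only [mul_assoc]
    simp only [e3]
    rw [← sw_assoc (fun a u w => sw (fun u' v => sw (fun c d =>
          f v • φ (c * (S (S u) * S a)) • (d * S (S u'))) x) w) (by fun_prop) (by fun_prop)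
          (by fun_prop)]
    have e4 : ∀ p w : H, sw (fun a u => sw (fun u' v => sw (fun c d =>
          f v • φ (c * (S (S u) * S a)) • (d * S (S u'))) x) w) p
        = counit (R := ℂ) p • sw (fun u' v => sw (fun c d =>
          f v • φ c • (d * S (S u'))) x) w := by
      intro p w
      have := sw_SS_mul_S (fun z => sw (fun u' v => sw (fun c d =>
          f v • φ (c * z) • (d * S (S u'))) x) w) (by fun_prop) p
      simpa using this
    simp only [e4]
    rw [sw_counit_left (fun w => sw (fun u' v => sw (fun c d =>
          f v • φ c • (d * S (S u'))) x) w) (by fun_prop), sw_comm]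
    congr 1; funext a b
    rw [smul_sw]; congr 1; funext c d; rw [smul_comm]
  have e5 : ∀ z, ∑ k, Kk k (C k z) = φ 1 • K z := by
    intro z
    have : ∀ k, Kk k (C k z) = sw (fun a b => φ (a * S (e k)) • sw (fun c d =>
        e.coord k c • K d) b) z := fun k => by
      rw [(hKk k).sw]; simp only [(hKk k).map_smul]; rfl
    simp only [this]
    rw [← sw_sum]
    have : ∀ a b : H, ∑ k, φ (a * S (e k)) • sw (fun c d => e.coord k c • K d) b =
        sw (fun c d => φ (a * S c) • K d) b := by
      intro a b
      simp only [smul_sw]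
      rw [← sw_sum]
      congr 1; funext c d
      rw [← sum_coord e (fun u => φ (a * S u) • K d) (by fun_prop) c]
      exact Finset.sum_congr rfl fun k _ => smul_comm _ _ _
    simp only [this]
    rw [← sw_assoc (fun a c d => φ (a * S c) • K d) (by fun_prop) (by fun_prop) (by fun_prop)]
    have : ∀ u d : H, sw (fun a c => φ (a * S c) • K d) u = counit (R := ℂ) u • φ 1 • K d :=
      fun u d => sw_mul_S (fun z => φ z • K d) (by fun_prop) u
    simp only [this]
    exact sw_counit_left (fun d => φ 1 • K d) (by fun_prop) z
  rw [e1, e2, tr_sum _ _ fun k => (by fun_prop)]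
  simp only [fun k => tr_comm (hKk k) (hC k)]
  rw [← tr_sum _ _ fun k => (by fun_prop)]
  simp only [e5]
  rw [tr_smul _ _ (by fun_prop), mul_comm]
  rfl

lemma exists_leftInv [Nontrivial H] : ∃ l : H →ₗ[ℂ] ℂ, l ≠ 0 ∧ LeftInv l := by
  by_contra! hcon
  let e := Module.finBasis ℂ H
  have hz : ∀ (f : H →ₗ[ℂ] ℂ) x, radTr f x = 0 := by
    intro f x
    by_contra hx
    refine hcon (IsLinearMap.mk' _ (lin_radTr f)) (fun h0 => hx ?_) fun h => radTr_invariant f h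
    exact congrArg (fun L : H →ₗ[ℂ] ℂ => L x) h0
  have h1 : tr (fun y : H => counit (R := ℂ) y • (1 : H)) = 1 := by
    rw [tr_smulRight]; simp
  have h2 : (fun y : H => counit (R := ℂ) y • (1 : H)) =
      fun y => ∑ k, sw (fun a b => e.coord k b • (S (e k) * S (S a))) y := by
    funext y
    rw [← sw_sum]
    have : ∀ a b : H, ∑ k, e.coord k b • (S (e k) * S (S a)) = S b * S (S a) := fun a b =>
      sum_coord e (fun u => S u * S (S a)) (by fun_prop) b
    simp only [this]
    simp only [← S_mul]
    rw [sw_S_mul (fun x => S x) (by fun_prop), S_one]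
  rw [h2, tr_sum _ _ fun k => (by fun_prop)] at h1
  have h3 : ∀ k, tr (fun y : H => sw (fun a b => e.coord k b • (S (e k) * S (S a))) y) = 0 :=
    fun k => hz (e.coord k) (S (e k))
  simp only [h3, Finset.sum_const_zero] at h1
  exact zero_ne_one h1

end Integral

section Radford

open Coalgebra HopfAlgebra

variable {H : Type*} [Ring H] [HopfAlgebra ℂ H] [Module.Finite ℂ H]
variable {l : H →ₗ[ℂ] ℂ}

lemma LeftInv.S_smul (hl : LeftInv l) (a b : H) :
    sw (fun x y => l (y * b) • S x) a = sw (fun x y => l (a * y) • x) b := by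
  have key : ∀ w : H, sw (fun y z => sw (fun c d => l (z * d) • (y * c)) b) w
      = l (w * b) • (1 : H) := by
    intro w
    rw [← hl (w * b), sw_mul_arg _ (by fun_prop) (by fun_prop)]
  have h1 : sw (fun x w => S x * sw (fun y z => sw (fun c d => l (z * d) • (y * c)) b) w) a
      = sw (fun x y => l (y * b) • S x) a := by
    simp only [key, mul_smul_comm, mul_one]
  rw [← h1]
  simp only [mul_sw, mul_smul_comm]
  rw [← sw_assoc (fun x y z => sw (fun c d => l (z * d) • (S x * (y * c))) b) (by fun_prop)
    (by fun_prop) (by fun_prop)]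
  have h2 : ∀ u z : H, sw (fun x y => sw (fun c d => l (z * d) • (S x * (y * c))) b) u
      = counit (R := ℂ) u • sw (fun c d => l (z * d) • c) b := by
    intro u z
    have := sw_S_mul (fun t => sw (fun c d => l (z * d) • (t * c)) b) (by fun_prop) u
    simpa [mul_assoc] using this
  simp only [h2]
  exact sw_counit_left (fun z => sw (fun c d => l (z * d) • c) b) (by fun_prop) a

lemma LeftInv.eq_zero_of_mul (hl : LeftInv l) (hl0 : l ≠ 0) (b : H) (hb : ∀ a, l (a * b) = 0) :
    b = 0 := by
  let e := Module.finBasis ℂ H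
  have hK : ∀ b : H, (∀ a, l (a * b) = 0) → ∀ a, sw (fun x y => l (a * y) • x) b = 0 := by
    intro b hb a
    rw [← hl.S_smul]
    simp [hb, sw]
  have hε : ∀ b : H, (∀ a, l (a * b) = 0) → counit (R := ℂ) b = 0 := by
    intro b hb
    by_contra hne
    apply hl0
    ext a
    have h1 : sw (fun x y => l (a * (S x * y))) b = counit (R := ℂ) b • l (a * 1) :=
      sw_S_mul (fun z => l (a * z)) (by fun_prop) b
    have h2 : sw (fun x y => l (a * (S x * y))) b =
        ∑ k, e.coord k (sw (fun x y => l (a * S (e k) * y) • x) b) := by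
      have : ∀ k, e.coord k (sw (fun x y => l (a * S (e k) * y) • x) b) =
          sw (fun x y => e.coord k x • l (a * (S (e k) * y))) b := fun k => by
        rw [(lin_linearMap _).sw]
        simp only [map_smul, smul_eq_mul, mul_assoc, mul_comm]
      simp only [this]
      rw [← sw_sum]
      congr 1; funext x y
      exact (sum_coord e (fun u => l (a * (S u * y))) (by fun_prop) x).symm
    rw [h2] at h1
    simp only [hK b hb, map_zero, Finset.sum_const_zero, mul_one, smul_eq_mul] at h1
    simpa using (mul_eq_zero.1 h1.symm).resolve_left hne
  obtain ⟨a0, ha0⟩ : ∃ a0, ∀ x, l (a0 * x) = counit (R := ℂ) x := by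
    have hmem : (counit (R := ℂ) (A := H)) ∈ Submodule.span ℂ
        (Set.range fun k => l ∘ₗ LinearMap.mulLeft ℂ (e k)) := by
      apply mem_span_of_iInf_ker_le_ker
      intro x hx
      simp only [Submodule.mem_iInf, LinearMap.mem_ker, LinearMap.comp_apply,
        LinearMap.mulLeft_apply] at hx
      refine hε x fun a => ?_
      rw [← sum_coord e (fun u => l (u * x)) (by fun_prop) a]
      simp [hx]
    obtain ⟨c, hc⟩ := (Submodule.mem_span_range_iff_exists_fun ℂ).1 hmem
    refine ⟨∑ k, c k • e k, fun x => ?_⟩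
    rw [← hc]
    simp [Finset.sum_mul]
  rw [← sw_counit_right (fun x => x) (by fun_prop) b]
  simp only [← ha0]
  exact hK b hb a0

lemma LeftInv.exists_right (hl : LeftInv l) (hl0 : l ≠ 0) (f : H →ₗ[ℂ] ℂ) :
    ∃ b, ∀ a, l (a * b) = f a := by
  let θ : H →ₗ[ℂ] Module.Dual ℂ H :=
    IsLinearMap.mk' (fun b => l ∘ₗ LinearMap.mulRight ℂ b)
      ⟨fun x y => by ext; simp [mul_add], fun c x => by ext; simp⟩
  have hθ : ∀ b a, θ b a = l (a * b) := fun _ _ => rfl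
  have hinj : Function.Injective θ := by
    rw [injective_iff_map_eq_zero]
    intro b hb
    exact hl.eq_zero_of_mul hl0 b fun a => by rw [← hθ, hb]; rfl
  have hsurj := (LinearMap.injective_iff_surjective_of_finrank_eq_finrank
    (Subspace.dual_finrank_eq).symm).1 hinj
  obtain ⟨b, hb⟩ := hsurj f
  exact ⟨b, fun a => by rw [← hθ, hb]⟩

lemma LeftInv.eq_zero_of_mul' (hl : LeftInv l) (hl0 : l ≠ 0) (a : H) (ha : ∀ b, l (a * b) = 0) :
    a = 0 := by
  refine (Module.forall_dual_apply_eq_zero_iff ℂ _).1 fun f => ?_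
  obtain ⟨b, hb⟩ := hl.exists_right hl0 f
  rw [← hb, ha]

lemma LeftInv.exists_left (hl : LeftInv l) (hl0 : l ≠ 0) (f : H →ₗ[ℂ] ℂ) :
    ∃ a, ∀ b, l (a * b) = f b := by
  let θ : H →ₗ[ℂ] Module.Dual ℂ H :=
    IsLinearMap.mk' (fun b => l ∘ₗ LinearMap.mulLeft ℂ b)
      ⟨fun x y => by ext; simp [add_mul], fun c x => by ext; simp⟩
  have hθ : ∀ b a, θ b a = l (b * a) := fun _ _ => rfl
  have hinj : Function.Injective θ := by
    rw [injective_iff_map_eq_zero]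
    intro b hb
    exact hl.eq_zero_of_mul' hl0 b fun a => by rw [← hθ, hb]; rfl
  have hsurj := (LinearMap.injective_iff_surjective_of_finrank_eq_finrank
    (Subspace.dual_finrank_eq).symm).1 hinj
  obtain ⟨b, hb⟩ := hsurj f
  exact ⟨b, fun a => by rw [← hθ, hb]⟩

/-- A left integral normalised against the functional `l`. -/
lemma LeftInv.exists_integral (hl : LeftInv l) (hl0 : l ≠ 0) :
    ∃ t : H, l t = 1 ∧ ∀ b, b * t = counit (R := ℂ) b • t := by
  obtain ⟨t, ht⟩ := hl.exists_right hl0 counit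
  refine ⟨t, by simpa using ht 1, fun b => ?_⟩
  rw [← sub_eq_zero]
  refine hl.eq_zero_of_mul hl0 _ fun a => ?_
  rw [mul_sub, map_sub, ← mul_assoc, ht, mul_smul_comm, map_smul, ht]
  simp [mul_comm]

lemma LeftInv.integral_unique (hl : LeftInv l) (hl0 : l ≠ 0) {t : H} (hlt : l t = 1)
    (ht : ∀ b, b * t = counit (R := ℂ) b • t) {u : H}
    (hu : ∀ b, b * u = counit (R := ℂ) b • u) : u = l u • t := by
  rw [← sub_eq_zero]
  refine hl.eq_zero_of_mul hl0 _ fun a => ?_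
  rw [mul_sub, map_sub, hu, mul_smul_comm, ht]
  simp [hlt, mul_comm]

lemma LeftInv.unique (hl : LeftInv l) (hl0 : l ≠ 0) {t : H} (hlt : l t = 1)
    (ht : ∀ b, b * t = counit (R := ℂ) b • t) {m : H →ₗ[ℂ] ℂ} (hm : LeftInv m) :
    m = m t • l := by
  by_contra hne
  have hm' : LeftInv (m - m t • l) := by
    intro h
    have : sw (fun a b => (m - m t • l) b • a) h =
        sw (fun a b => m b • a) h - m t • sw (fun a b => l b • a) h := by
      rw [smul_sw]
      simp only [sw, ← Finset.sum_sub_distrib, LinearMap.sub_apply, LinearMap.smul_apply, sub_smul,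
        smul_assoc]
    rw [this, hm, hl, LinearMap.sub_apply, LinearMap.smul_apply, sub_smul, smul_assoc]
  obtain ⟨u, hu1, hu⟩ := hm'.exists_integral (sub_ne_zero.2 hne)
  have := hl.integral_unique hl0 hlt ht hu
  rw [this] at hu1
  simp [hlt] at hu1

end Radford

section Radford

open Coalgebra HopfAlgebra

variable {H : Type*} [Ring H] [HopfAlgebra ℂ H] [Module.Finite ℂ H]
variable {l : H →ₗ[ℂ] ℂ}

lemma Lin.ext_dual {V : Type*} [AddCommGroup V] [Module ℂ V] {x y : V}
    (h : ∀ f : V →ₗ[ℂ] ℂ, f x = f y) : x = y := by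
  rw [← sub_eq_zero]
  exact (Module.forall_dual_apply_eq_zero_iff ℂ _).1 fun f => by rw [map_sub, h, sub_self]

lemma LeftInv.exists_char (hl : LeftInv l) (hl0 : l ≠ 0) {t : H} (hlt : l t = 1)
    (ht : ∀ b, b * t = counit (R := ℂ) b • t) :
    ∃ α : H →ₐ[ℂ] ℂ, ∀ h, t * h = α h • t := by
  have key : ∀ h, t * h = l (t * h) • t := fun h =>
    hl.integral_unique hl0 hlt ht fun b => by rw [← mul_assoc, ht, smul_mul_assoc]
  refine ⟨AlgHom.ofLinearMap (l ∘ₗ LinearMap.mulLeft ℂ t) (by simp [hlt]) fun x y => ?_, key⟩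
  simp only [LinearMap.comp_apply, LinearMap.mulLeft_apply]
  rw [← mul_assoc, key x, smul_mul_assoc, map_smul, smul_eq_mul]
  simp [hlt]

lemma LeftInv.exists_grouplike (hl : LeftInv l) (hl0 : l ≠ 0) {t : H} (hlt : l t = 1)
    (ht : ∀ b, b * t = counit (R := ℂ) b • t) :
    ∃ g : H, IsGroupLikeElem ℂ g ∧ ∀ h, sw (fun a b => l a • b) h = l h • g := by
  have key : ∀ h, sw (fun a b => l a • b) h = l h • sw (fun a b => l a • b) t := by
    intro h
    refine Lin.ext_dual fun φ => ?_
    have hm : LeftInv (by fun_prop : Lin fun h => φ (sw (fun a b => l a • b) h)).lm := by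
      intro h
      simp only [Lin.lm_apply]
      have : ∀ b : H, φ (sw (fun a b => l a • b) b) = sw (fun c d => l c * φ d) b := fun b => by
        rw [(lin_linearMap φ).sw]; simp
      simp only [this, sw_smul]
      rw [← sw_assoc (fun a c d => (l c * φ d) • a) (by fun_prop) (by fun_prop) (by fun_prop)]
      congr 1; funext a b
      have := congrArg (fun x => φ b • x) (hl a)
      simp only [smul_sw, smul_smul] at this
      simpa [mul_comm] using this
    have := congrArg (fun L : H →ₗ[ℂ] ℂ => L h) (hl.unique hl0 hlt ht hm)
    simpa [mul_comm] using this
  refine ⟨_, ⟨?_, ?_⟩, key⟩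
  · rw [(lin_linearMap _).sw]
    simp only [map_smul, smul_eq_mul]
    have := sw_counit_right (fun x => l x) (by fun_prop) t
    rw [hlt] at this
    simpa [mul_comm] using this
  · set g := sw (fun a b => l a • b) t with hg
    have h1 : sw (fun a b => sw (fun c d => l c • d) a ⊗ₜ[ℂ] b) t = g ⊗ₜ[ℂ] g := by
      simp only [key, ← TensorProduct.smul_tmul']
      simp only [TensorProduct.smul_tmul', TensorProduct.smul_tmul]
      rw [hg, (by fun_prop : Lin fun x => sw (fun a b => l a • b) t ⊗ₜ[ℂ] x).sw]
    rw [← h1]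
    have h2 : ∀ a b : H, sw (fun c d => l c • d) a ⊗ₜ[ℂ] b = sw (fun c d => (l c • d) ⊗ₜ[ℂ] b) a :=
      fun a b => (by fun_prop : Lin fun x : H => x ⊗ₜ[ℂ] b).sw _ _
    simp only [h2]
    rw [sw_assoc (fun c d b => (l c • d) ⊗ₜ[ℂ] b) (by fun_prop) (by fun_prop) (by fun_prop),
      hg, (lin_linearMap _).sw]
    congr 1; funext a b
    rw [map_smul, comul_eq_sw, smul_sw]
    simp only [TensorProduct.smul_tmul']

/-- Translation of an element by a functional applied to the first tensor factor. -/
noncomputable def lt (χ : H →ₐ[ℂ] ℂ) (h : H) : H := sw (fun a b => χ a • b) h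

/-- Translation of an element by a functional applied to the second tensor factor. -/
noncomputable def rt (χ : H →ₐ[ℂ] ℂ) (h : H) : H := sw (fun a b => χ b • a) h

/-- The second formula. -/
lemma mul_S_of_grouplike {g : H} (hg : ∀ h, sw (fun a b => l a • b) h = l h • g)
    (a b : H) : sw (fun x y => l (x * b) • y) a = sw (fun x y => l (a * x) • (g * S y)) b := by
  have h1 : ∀ x y : H, l (a * x) • (g * S y) =
      sw (fun c d => sw (fun e f => l (e * c) • (f * d * S y)) a) x := by
    intro x y
    rw [← smul_mul_assoc, ← hg, sw_mul_arg _ (by fun_prop) (by fun_prop), sw_comm, sw_mul]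
    simp only [sw_mul, smul_mul_assoc]
  simp only [h1]
  rw [sw_assoc (fun c d y => sw (fun e f => l (e * c) • (f * d * S y)) a) (by fun_prop)
    (by fun_prop) (by fun_prop)]
  have h2 : ∀ c z : H, sw (fun d y => sw (fun e f => l (e * c) • (f * d * S y)) a) z =
      counit (R := ℂ) z • sw (fun e f => l (e * c) • f) a := by
    intro c z
    have := sw_mul_S (fun t => sw (fun e f => l (e * c) • (f * t)) a) (by fun_prop) z
    simpa [mul_assoc] using this
  simp only [h2]
  exact (sw_counit_right (fun c => sw (fun e f => l (e * c) • f) a) (by fun_prop) b).symm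

omit [Module.Finite ℂ H] in
lemma rt_S_rt (χ : H →ₐ[ℂ] ℂ) (h : H) :
    sw (fun a b => χ (S b) • a) (rt χ h) = h := by
  rw [rt, (by fun_prop : Lin fun x => sw (fun a b => χ (S b) • a) x).sw]
  simp only [(by fun_prop : Lin fun x => sw (fun a b => χ (S b) • a) x).map_smul, smul_sw]
  rw [sw_assoc (fun c d b => χ b • χ (S d) • c) (by fun_prop) (by fun_prop) (by fun_prop)]
  have : ∀ c z : H, sw (fun d b => χ b • χ (S d) • c) z = counit (R := ℂ) z • c := by
    intro c z
    have := sw_S_mul (fun t => χ t • c) (by fun_prop) z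
    simpa [mul_comm, smul_smul] using this
  simp only [this]
  exact sw_counit_right (fun c => c) (by fun_prop) h

variable (H) in
/-- Radford's formula for the fourth power of the antipode, together with the data of the
distinguished characters. -/
theorem exists_radford [Nontrivial H] : ∃ (l : H →ₗ[ℂ] ℂ) (t g : H) (α : H →ₐ[ℂ] ℂ),
    LeftInv l ∧ l ≠ 0 ∧ l t = 1 ∧ (∀ b, b * t = counit (R := ℂ) b • t) ∧ (∀ h, t * h = α h • t) ∧
    IsGroupLikeElem ℂ g ∧ (∀ b, g * S (S (S (S (lt α b)))) * S g = rt α b) ∧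
    Function.Bijective (S : H → H) := by
  obtain ⟨l, hl0, hl⟩ := exists_leftInv (H := H)
  obtain ⟨t, hlt, ht⟩ := hl.exists_integral hl0
  obtain ⟨α, hα⟩ := hl.exists_char hl0 hlt ht
  obtain ⟨g, hgl, hg⟩ := hl.exists_grouplike hl0 hlt ht
  have f1 : ∀ a, sw (fun x y => l (a * y) • x) t = S a := fun a => by
    rw [← hl.S_smul]
    simp only [ht, map_smul, hlt, smul_eq_mul, mul_one]
    exact sw_counit_right (fun x => S x) (by fun_prop) a
  have f2 : ∀ b, sw (fun x y => l (x * b) • y) t = g * S (lt α b) := fun b => by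
    rw [mul_S_of_grouplike hg]
    simp only [hα, map_smul, hlt, smul_eq_mul, mul_one]
    rw [lt, (by fun_prop : Lin fun x => g * S x).sw]
    simp
  have f3 : ∀ a, sw (fun x y => l (a * x) • (g * S y)) t = a := fun a => by
    rw [← mul_S_of_grouplike hg]
    simp only [ht, map_smul, hlt, smul_eq_mul, mul_one]
    exact sw_counit_left (fun x => x) (by fun_prop) a
  have f4 : ∀ b, sw (fun x y => l (y * b) • S x) t = rt α b := fun b => by
    rw [hl.S_smul]
    simp only [hα, map_smul, hlt, smul_eq_mul, mul_one]
    rfl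
  have hSS : ∀ b c, (∀ x, l (x * b) = l (c * x)) →
      c = g * S (S (lt α b)) * S g ∧ S (S c) = rt α b := by
    intro b c hbc
    constructor
    · have h1 := f3 c
      simp only [← hbc] at h1
      rw [← h1]
      have h2 : sw (fun x y => l (x * b) • (g * S y)) t = g * S (sw (fun x y => l (x * b) • y) t) := by
        rw [(by fun_prop : Lin fun x => g * S x).sw]; simp
      rw [h2, f2, S_mul, mul_assoc]
    · have h1 := f1 c
      simp only [← hbc] at h1
      rw [← h1, ← f4, (by fun_prop : Lin fun x => S x).sw]; simp
  have hinj2 : ∀ c : H, S (S c) = 0 → c = 0 := by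
    intro c hc
    obtain ⟨b, hb⟩ := hl.exists_right hl0 (l ∘ₗ LinearMap.mulLeft ℂ c)
    have h1 := (hSS b c hb).2
    rw [hc] at h1
    have h2 := rt_S_rt α b
    rw [← h1] at h2
    have h3 : b = 0 := by
      rw [← h2]
      exact map_zero (by fun_prop : Lin fun x : H => sw (fun a b => α (S b) • a) x).lm
    refine hl.eq_zero_of_mul' hl0 c fun x => ?_
    have := hb x
    simp only [h3, mul_zero, map_zero] at this
    exact this.symm
  have hinj : Function.Injective (antipode ℂ : H →ₗ[ℂ] H) := by
    rw [injective_iff_map_eq_zero]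
    intro a ha
    exact hinj2 a (by simp [ha])
  refine ⟨l, t, g, α, hl, hl0, hlt, ht, hα, hgl, fun b => ?_, hinj,
    LinearMap.injective_iff_surjective.1 hinj⟩
  obtain ⟨c, hc⟩ := hl.exists_left hl0 (l ∘ₗ LinearMap.mulRight ℂ b)
  obtain ⟨h1, h2⟩ := hSS b c fun x => (hc x).symm
  rw [← h2, h1, S_mul, S_mul, S_mul, S_mul, S, S, S, S, S, S, S, hgl.antipode_antipode]

end Radford

section Translate

open Coalgebra HopfAlgebra

variable {H : Type*} [Ring H] [HopfAlgebra ℂ H]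

lemma tr_conj {V W : Type*} [AddCommGroup V] [Module ℂ V] [AddCommGroup W] [Module ℂ W]
    [Module.Finite ℂ V] [Module.Finite ℂ W] (e : V ≃ₗ[ℂ] W) {f : W → W} {g : V → V}
    (hg : Lin g) (h : ∀ x, e (g x) = f (e x)) : tr f = tr g := by
  have h1 : f = fun x => e (g (e.symm x)) := by funext x; rw [h, e.apply_symm_apply]
  have he : Lin (fun x => e x) := lin_linearMap e.toLinearMap
  have he' : Lin (fun x => e.symm x) := lin_linearMap e.symm.toLinearMap
  rw [h1, tr_comm (f := fun x => g (e.symm x)) (g := fun x => e x) (hg.comp he') he]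
  simp

/-- Composition of a character with the antipode. -/
noncomputable def charS (χ : H →ₐ[ℂ] ℂ) : H →ₐ[ℂ] ℂ :=
  AlgHom.ofLinearMap (χ.toLinearMap ∘ₗ antipode ℂ) (by simp) fun x y => by
    simp [antipode_mul_antidistrib, mul_comm]

@[simp] lemma charS_apply (χ : H →ₐ[ℂ] ℂ) (x : H) : charS χ x = χ (S x) := rfl

@[fun_prop]
lemma lin_lt (χ : H →ₐ[ℂ] ℂ) : Lin (fun x => lt χ x) := by unfold lt; fun_prop

@[fun_prop]
lemma lin_rt (χ : H →ₐ[ℂ] ℂ) : Lin (fun x => rt χ x) := by unfold rt; fun_prop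

lemma lt_mul (χ : H →ₐ[ℂ] ℂ) (x y : H) : lt χ (x * y) = lt χ x * lt χ y := by
  unfold lt
  rw [sw_mul_arg _ (by fun_prop) (by fun_prop), sw_mul]
  congr 1; funext a b
  rw [mul_sw]
  simp [smul_smul, mul_comm]

lemma rt_mul (χ : H →ₐ[ℂ] ℂ) (x y : H) : rt χ (x * y) = rt χ x * rt χ y := by
  unfold rt
  rw [sw_mul_arg _ (by fun_prop) (by fun_prop), sw_mul]
  congr 1; funext a b
  rw [mul_sw]
  simp [smul_smul, mul_comm]

lemma lt_one (χ : H →ₐ[ℂ] ℂ) : lt χ 1 = 1 := by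
  rw [lt, sw_one _ (by fun_prop) (by fun_prop)]; simp

lemma rt_one (χ : H →ₐ[ℂ] ℂ) : rt χ 1 = 1 := by
  rw [rt, sw_one _ (by fun_prop) (by fun_prop)]; simp

lemma sw_lt {M : Type*} [AddCommGroup M] [Module ℂ M] (f : H → H → M)
    (h1 : ∀ b, Lin fun a => f a b) (h2 : ∀ a, Lin fun b => f a b) (χ : H →ₐ[ℂ] ℂ) (x : H) :
    sw f (lt χ x) = sw (fun a b => f (lt χ a) b) x := by
  unfold lt
  rw [(by fun_prop : Lin fun x => sw f x).sw]
  simp only [(by fun_prop : Lin fun x => sw f x).map_smul, smul_sw]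
  rw [← sw_assoc (fun a c d => χ a • f c d) (by fun_prop) (by fun_prop) (by fun_prop)]
  congr 1; funext a b
  rw [(h1 b).sw]
  simp only [(h1 b).map_smul]

lemma sw_rt {M : Type*} [AddCommGroup M] [Module ℂ M] (f : H → H → M)
    (h1 : ∀ b, Lin fun a => f a b) (h2 : ∀ a, Lin fun b => f a b) (χ : H →ₐ[ℂ] ℂ) (x : H) :
    sw f (rt χ x) = sw (fun a b => f a (rt χ b)) x := by
  unfold rt
  rw [(by fun_prop : Lin fun x => sw f x).sw]
  simp only [(by fun_prop : Lin fun x => sw f x).map_smul, smul_sw]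
  rw [sw_assoc (fun c d b => χ b • f c d) (by fun_prop) (by fun_prop) (by fun_prop)]
  congr 1; funext a b
  rw [(h2 a).sw]
  simp only [(h2 a).map_smul]

/-- The middle translation identity. -/
lemma sw_lt_right {M : Type*} [AddCommGroup M] [Module ℂ M] (f : H → H → M)
    (h1 : ∀ b, Lin fun a => f a b) (h2 : ∀ a, Lin fun b => f a b) (χ : H →ₐ[ℂ] ℂ) (x : H) :
    sw (fun a b => f a (lt χ b)) x = sw (fun a b => f (rt χ a) b) x := by
  unfold lt rt
  have e1 : ∀ a b, f a (sw (fun c d => χ c • d) b) = sw (fun c d => χ c • f a d) b := fun a b => by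
    rw [(h2 a).sw]; simp only [(h2 a).map_smul]
  have e2 : ∀ a b, f (sw (fun c d => χ d • c) a) b = sw (fun c d => χ d • f c b) a := fun a b => by
    rw [(h1 b).sw]; simp only [(h1 b).map_smul]
  simp only [e1, e2]
  rw [sw_assoc (fun c d b => χ d • f c b) (by fun_prop) (by fun_prop) (by fun_prop)]

lemma lt_charS (χ : H →ₐ[ℂ] ℂ) (x : H) : lt χ (lt (charS χ) x) = x := by
  have : lt χ (lt (charS χ) x) = sw (fun a b => χ (S a) • lt χ b) x := by
    conv_lhs => rw [lt.eq_def (charS χ), (lin_lt χ).sw]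
    simp only [(lin_lt χ).map_smul, charS_apply]
  rw [this]
  simp only [lt, smul_sw]
  rw [← sw_assoc (fun a b c => χ (S a) • χ b • c) (by fun_prop) (by fun_prop) (by fun_prop)]
  have : ∀ u c : H, sw (fun a b => χ (S a) • χ b • c) u = counit (R := ℂ) u • c := fun u c => by
    simpa [smul_smul] using sw_S_mul (fun t => χ t • c) (by fun_prop) u
  simp only [this]
  exact sw_counit_left (fun x => x) (by fun_prop) x

lemma charS_lt (χ : H →ₐ[ℂ] ℂ) (x : H) : lt (charS χ) (lt χ x) = x := by
  have : lt (charS χ) (lt χ x) = sw (fun a b => χ a • lt (charS χ) b) x := by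
    conv_lhs => rw [lt.eq_def χ, (lin_lt _).sw]
    simp only [(lin_lt _).map_smul]
  rw [this]
  simp only [lt, smul_sw, charS_apply]
  rw [← sw_assoc (fun a b c => χ a • χ (S b) • c) (by fun_prop) (by fun_prop) (by fun_prop)]
  have : ∀ u c : H, sw (fun a b => χ a • χ (S b) • c) u = counit (R := ℂ) u • c := fun u c => by
    simpa [smul_smul] using sw_mul_S (fun t => χ t • c) (by fun_prop) u
  simp only [this]
  exact sw_counit_left (fun x => x) (by fun_prop) x

lemma rt_charS (χ : H →ₐ[ℂ] ℂ) (x : H) : rt χ (rt (charS χ) x) = x := by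
  have : rt χ (rt (charS χ) x) = sw (fun a b => χ (S b) • rt χ a) x := by
    conv_lhs => rw [rt.eq_def (charS χ), (lin_rt χ).sw]
    simp only [(lin_rt χ).map_smul, charS_apply]
  rw [this]
  simp only [rt, smul_sw]
  rw [sw_assoc (fun a b c => χ (S c) • χ b • a) (by fun_prop) (by fun_prop) (by fun_prop)]
  have : ∀ u c : H, sw (fun a b => χ (S b) • χ a • c) u = counit (R := ℂ) u • c := fun u c => by
    simpa [smul_smul, mul_comm] using sw_mul_S (fun t => χ t • c) (by fun_prop) u
  simp only [this]
  exact sw_counit_right (fun x => x) (by fun_prop) x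

/-- Left translation as an algebra automorphism. -/
noncomputable def ltE (χ : H →ₐ[ℂ] ℂ) : H ≃ₐ[ℂ] H :=
  AlgEquiv.ofAlgHom (AlgHom.ofLinearMap (lin_lt χ).lm (lt_one χ) (lt_mul χ))
    (AlgHom.ofLinearMap (lin_lt (charS χ)).lm (lt_one _) (lt_mul _))
    (AlgHom.ext fun x => lt_charS χ x) (AlgHom.ext fun x => charS_lt χ x)

@[simp] lemma ltE_apply (χ : H →ₐ[ℂ] ℂ) (x : H) : ltE χ x = lt χ x := rfl

/-- Right translation as an algebra automorphism. -/
noncomputable def rtE (χ : H →ₐ[ℂ] ℂ) : H ≃ₐ[ℂ] H :=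
  AlgEquiv.ofAlgHom (AlgHom.ofLinearMap (lin_rt χ).lm (rt_one χ) (rt_mul χ))
    (AlgHom.ofLinearMap (lin_rt (charS χ)).lm (rt_one _) (rt_mul _))
    (AlgHom.ext fun x => rt_charS χ x) (AlgHom.ext fun x => rt_S_rt χ x)

@[simp] lemma rtE_apply (χ : H →ₐ[ℂ] ℂ) (x : H) : rtE χ x = rt χ x := rfl

variable (H) in
/-- The square of the antipode as an algebra homomorphism. -/
noncomputable def ssHom : H →ₐ[ℂ] H :=
  AlgHom.ofLinearMap (antipode ℂ ∘ₗ antipode ℂ) (by simp) fun x y => by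
    simp [antipode_mul_antidistrib]

/-- The square of a bijective antipode as an algebra automorphism. -/
noncomputable def ssE (hS : Function.Bijective (S : H → H)) : H ≃ₐ[ℂ] H :=
  AlgEquiv.ofBijective (ssHom H) (hS.comp hS)

@[simp] lemma ssE_apply (hS : Function.Bijective (S : H → H)) (x : H) : ssE hS x = S (S x) := rfl

/-- Conjugation by a grouplike element. -/
noncomputable def adE {g : H} (hg : IsGroupLikeElem ℂ g) : H ≃ₐ[ℂ] H :=
  AlgEquiv.ofAlgHom
    (AlgHom.ofLinearMap (by fun_prop : Lin fun x => g * x * S g).lm (by simp [hg]) fun x y => by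
      simp only [Lin.lm_apply]
      rw [show g * x * S g * (g * y * S g) = g * x * (S g * g) * y * S g by noncomm_ring,
        hg.antipode_mul_cancel]; noncomm_ring)
    (AlgHom.ofLinearMap (by fun_prop : Lin fun x => S g * x * g).lm (by simp [hg]) fun x y => by
      simp only [Lin.lm_apply]
      rw [show S g * x * g * (S g * y * g) = S g * x * (g * S g) * y * g by noncomm_ring,
        hg.mul_antipode_cancel]; noncomm_ring)
    (AlgHom.ext fun x => by
      change g * (S g * x * g) * S g = x
      rw [show g * (S g * x * g) * S g = (g * S g) * x * (g * S g) by noncomm_ring,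
        hg.mul_antipode_cancel]; simp)
    (AlgHom.ext fun x => by
      change S g * (g * x * S g) * g = x
      rw [show S g * (g * x * S g) * g = (S g * g) * x * (S g * g) by noncomm_ring,
        hg.antipode_mul_cancel]; simp)

lemma adE_apply {g : H} (hg : IsGroupLikeElem ℂ g) (x : H) : adE hg x = g * x * S g := rfl

variable [Module.Finite ℂ H]

/-- Maschke's theorem for Hopf algebras. -/
theorem isSemisimpleRing_of_integral {t : H} (ht : ∀ b, b * t = counit (R := ℂ) b • t)
    (h0 : counit (R := ℂ) t ≠ 0) : IsSemisimpleRing H := by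
  have key : ∀ (P : H →ₗ[ℂ] H) (h x : H), sw (fun a b => a * P (S b * (h * x))) t =
      h * sw (fun a b => a * P (S b * x)) t := by
    intro P h x
    have e1 : sw (fun y z => sw (fun a b => a * P (S b * (z * x))) (y * t)) h =
        sw (fun a b => a * P (S b * (h * x))) t := by
      simp only [ht]
      have : ∀ y z : H, sw (fun a b => a * P (S b * (z * x))) (counit (R := ℂ) y • t) =
          counit (R := ℂ) y • sw (fun a b => a * P (S b * (z * x))) t := fun y z =>
        (by fun_prop : Lin fun u => sw (fun a b => a * P (S b * (z * x))) u).map_smul _ _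
      simp only [this]
      exact sw_counit_left (fun z => sw (fun a b => a * P (S b * (z * x))) t) (by fun_prop) h
    rw [← e1]
    have e2 : ∀ y z : H, sw (fun a b => a * P (S b * (z * x))) (y * t) =
        sw (fun c d => sw (fun a b => c * a * P (S b * (S d * z * x))) t) y := by
      intro y z
      rw [sw_mul_arg _ (by fun_prop) (by fun_prop)]
      simp only [S_mul, mul_assoc]
    simp only [e2]
    rw [sw_assoc (fun c d z => sw (fun a b => c * a * P (S b * (S d * z * x))) t) (by fun_prop)
      (by fun_prop) (by fun_prop)]
    have e3 : ∀ c u : H, sw (fun d z => sw (fun a b => c * a * P (S b * (S d * z * x))) t) u =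
        counit (R := ℂ) u • sw (fun a b => c * a * P (S b * x)) t := by
      intro c u
      have := sw_S_mul (fun v => sw (fun a b => c * a * P (S b * (v * x))) t) (by fun_prop) u
      simpa [mul_assoc] using this
    simp only [e3]
    rw [sw_counit_right (fun c => sw (fun a b => c * a * P (S b * x)) t) (by fun_prop), mul_sw]
    simp only [mul_assoc]
  suffices ComplementedLattice (Submodule H H) from { toComplementedLattice := this }
  refine ⟨fun N => ?_⟩
  obtain ⟨P, hP⟩ := LinearMap.exists_leftInverse_of_injective
    (N.restrictScalars ℂ).subtype (LinearMap.ker_eq_bot.2 Subtype.val_injective)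
  have hP' : ∀ x (hx : x ∈ N), (P x : H) = x := fun x hx =>
    congrArg Subtype.val (LinearMap.congr_fun hP (⟨x, hx⟩ : N.restrictScalars ℂ))
  let Q : H →ₗ[ℂ] H := (N.restrictScalars ℂ).subtype ∘ₗ P
  have hQ : ∀ x, Q x = P x := fun _ => rfl
  let A : H → H := fun x => (counit (R := ℂ) t)⁻¹ • sw (fun a b => a * Q (S b * x)) t
  have hA : Lin A := by fun_prop
  have hAN : ∀ x, A x ∈ N := fun x => by
    refine (N.restrictScalars ℂ).smul_mem _ (sum_mem fun i _ => ?_)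
    exact N.smul_mem _ (P _).2
  let f : H →ₗ[H] N :=
    { toFun := fun x => ⟨A x, hAN x⟩
      map_add' := fun x y => Subtype.ext (hA.map_add x y)
      map_smul' := fun c x => Subtype.ext (by
        change A (c * x) = c * A x
        simp only [A]
        rw [key Q c x, mul_smul_comm]) }
  refine ⟨LinearMap.ker f, LinearMap.isCompl_of_proj (f := f) fun x => Subtype.ext ?_⟩
  change A x = x
  have : ∀ b : H, Q (S b * x) = S b * x := fun b => hP' _ (N.smul_mem (S b) x.2)
  simp only [A, this, ← mul_assoc]
  rw [sw_mul_S (fun u => u * (x : H)) (by fun_prop), smul_smul, inv_mul_cancel₀ h0, one_smul,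
    one_mul]

/-- Vanishing of twisted traces of the square of the antipode. -/
theorem tr_ss_lt_eq_zero (hns : ¬ IsSemisimpleRing H) (hS : Function.Bijective (S : H → H))
    {l : H →ₗ[ℂ] ℂ} {t : H} {α : H →ₐ[ℂ] ℂ} (hl : LeftInv l) (hl0 : l ≠ 0) (hlt : l t = 1)
    (ht : ∀ b, b * t = counit (R := ℂ) b • t) (hα : ∀ h, t * h = α h • t)
    (χ : H →ₐ[ℂ] ℂ) (x : H) : tr (fun y => S (S (lt χ y)) * x) = 0 := by
  have hψ : ∀ ψ : H →ₐ[ℂ] ℂ, ψ t = 0 := by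
    intro ψ
    by_contra hne
    have h1 : ∀ h, ψ h = counit (R := ℂ) h := fun h => by
      have := congrArg ψ (ht h)
      rw [map_mul, map_smul, smul_eq_mul] at this
      exact mul_right_cancel₀ hne this
    exact hns (isSemisimpleRing_of_integral ht (by rwa [h1] at hne))
  have h1 : ∀ (χ : H →ₐ[ℂ] ℂ) x, tr (fun y => x * S (S (rt χ y))) = 0 := by
    intro χ x
    have e1 : ∀ x, (fun y => x * S (S (rt χ y))) =
        fun y => sw (fun a b => χ.toLinearMap b • (x * S (S a))) y := by
      intro x
      funext y
      rw [rt, (by fun_prop : Lin fun z => x * S (S z)).sw]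
      simp
    have e2 : radTr χ.toLinearMap t = 0 := by
      rw [radTr, ← e1]
      simp only [hα]
      exact (tr_smulRight ((α.comp (ssHom H)).toLinearMap ∘ₗ (rtE χ).toLinearMap) t).trans
        (hψ ((α.comp (ssHom H)).comp (rtE χ : H →ₐ[ℂ] H)))
    rw [e1]
    have := congrArg (fun L : H →ₗ[ℂ] ℂ => L x) (hl.unique hl0 hlt ht
      (m := (lin_radTr χ.toLinearMap).lm) (radTr_invariant χ.toLinearMap))
    simp only [Lin.lm_apply, e2, zero_smul, LinearMap.zero_apply] at this
    exact this
  obtain ⟨z, rfl⟩ := hS.2 x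
  rw [← h1 (charS χ) z]
  refine tr_conj (LinearEquiv.ofBijective (antipode ℂ) hS) (by fun_prop) fun y => ?_
  change S (z * S (S (rt (charS χ) y))) = S (S (lt χ (S y))) * S z
  rw [S_mul, lt, sw_S _ (by fun_prop) (by fun_prop), rt, (by fun_prop : Lin fun x => S (S (S x))).sw,
    (by fun_prop : Lin fun x => S (S x)).sw]
  simp

end Translate

section Weights

variable {A : Type*} [Ring A] [Algebra ℂ A] {ζ : ℂ} {N : ℕ} {φ : A}

/-- The projection onto the `ζ ^ j`-eigenspace of an element of order `N`. -/
noncomputable def eproj (ζ : ℂ) (N : ℕ) (φ : A) (j : ℕ) : A :=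
  (N : ℂ)⁻¹ • ∑ i ∈ Finset.range N, (ζ⁻¹) ^ (j * i) • φ ^ i

lemma mul_eproj (hN : 0 < N) (hζ : IsPrimitiveRoot ζ N) (hφ : φ ^ N = 1) (j : ℕ) :
    φ * eproj ζ N φ j = ζ ^ j • eproj ζ N φ j := by
  have hζ0 : ζ ≠ 0 := hζ.ne_zero hN.ne'
  have key : φ * ∑ i ∈ Finset.range N, (ζ⁻¹) ^ (j * i) • φ ^ i =
      ζ ^ j • ∑ i ∈ Finset.range N, (ζ⁻¹) ^ (j * i) • φ ^ i := by
    have h1 : φ * ∑ i ∈ Finset.range N, (ζ⁻¹) ^ (j * i) • φ ^ i =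
        ζ ^ j • ∑ i ∈ Finset.range N, (ζ⁻¹) ^ (j * (i + 1)) • φ ^ (i + 1) := by
      rw [Finset.mul_sum, Finset.smul_sum]
      refine Finset.sum_congr rfl fun i _ => ?_
      rw [mul_smul_comm, smul_smul, pow_succ' φ i, mul_add, mul_one, pow_add]
      congr 1
      rw [mul_comm (ζ⁻¹ ^ (j * i)), ← mul_assoc, ← mul_pow, mul_inv_cancel₀ hζ0, one_pow, one_mul]
    rw [h1]
    congr 1
    have h2 := Finset.sum_range_succ' (fun i => (ζ⁻¹) ^ (j * i) • φ ^ i) N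
    rw [Finset.sum_range_succ] at h2
    have h3 : (ζ⁻¹) ^ (j * N) • φ ^ N = (ζ⁻¹) ^ (j * 0) • φ ^ 0 := by
      rw [hφ, mul_comm j N, pow_mul, inv_pow, hζ.pow_eq_one]; simp
    rw [h3] at h2
    exact (add_right_cancel h2).symm
  rw [eproj, mul_smul_comm, key, smul_comm]

lemma commute_eproj {x : A} (h : Commute φ x) (j : ℕ) : Commute (eproj ζ N φ j) x := by
  refine Commute.smul_left (Commute.sum_left _ _ _ fun i _ => ?_) _
  exact (h.pow_left i).smul_left _

lemma pow_mul_eproj (hN : 0 < N) (hζ : IsPrimitiveRoot ζ N) (hφ : φ ^ N = 1) (j k : ℕ) :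
    φ ^ k * eproj ζ N φ j = ζ ^ (j * k) • eproj ζ N φ j := by
  induction k with
  | zero => simp
  | succ k ih =>
    rw [pow_succ', mul_assoc, ih, mul_smul_comm, mul_eproj hN hζ hφ, smul_smul, mul_add, pow_add,
      mul_one]

lemma eproj_idem (hN : 0 < N) (hζ : IsPrimitiveRoot ζ N) (hφ : φ ^ N = 1) (j : ℕ) :
    IsIdempotentElem (eproj ζ N φ j) := by
  have hζ0 : ζ ≠ 0 := hζ.ne_zero hN.ne'
  have hN0 : (N : ℂ) ≠ 0 := by exact_mod_cast hN.ne'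
  unfold IsIdempotentElem
  nth_rewrite 1 [eproj]
  rw [smul_mul_assoc, Finset.sum_mul]
  have : ∀ i ∈ Finset.range N, (ζ⁻¹) ^ (j * i) • φ ^ i * eproj ζ N φ j = eproj ζ N φ j := by
    intro i _
    rw [smul_mul_assoc, pow_mul_eproj hN hζ hφ, smul_smul, ← mul_pow, inv_mul_cancel₀ hζ0, one_pow,
      one_smul]
  rw [Finset.sum_congr rfl this, Finset.sum_const, Finset.card_range, ← Nat.cast_smul_eq_nsmul ℂ,
    smul_smul, inv_mul_cancel₀ hN0, one_smul]

lemma sum_inv_pow (hζ : IsPrimitiveRoot ζ N) {i : ℕ} (h0 : i ≠ 0) (hi : i < N) :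
    ∑ j ∈ Finset.range N, (ζ⁻¹) ^ (j * i) = 0 := by
  have hne : (ζ⁻¹) ^ i ≠ 1 := (hζ.inv).pow_ne_one_of_pos_of_lt h0 hi
  have h := mul_neg_geom_sum ((ζ⁻¹) ^ i) N
  have h1 : ((ζ⁻¹) ^ i) ^ N = 1 := by rw [← pow_mul, mul_comm, pow_mul, hζ.inv.pow_eq_one, one_pow]
  rw [h1, sub_self, mul_eq_zero] at h
  have h2 := h.resolve_left (sub_ne_zero.2 hne.symm)
  rw [← h2]
  exact Finset.sum_congr rfl fun j _ => by rw [← pow_mul, mul_comm]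

lemma sum_eproj (hN : 0 < N) (hζ : IsPrimitiveRoot ζ N) :
    ∑ j ∈ Finset.range N, eproj ζ N φ j = 1 := by
  have hN0 : (N : ℂ) ≠ 0 := by exact_mod_cast hN.ne'
  unfold eproj
  rw [← Finset.smul_sum, Finset.sum_comm]
  simp only [← Finset.sum_smul]
  rw [Finset.sum_eq_single 0]
  · simp [hN0]
  · intro i hi h0
    rw [sum_inv_pow hζ h0 (Finset.mem_range.1 hi), zero_smul]
  · intro h; simp [hN.ne'] at h

lemma map_eproj {B F : Type*} [Ring B] [Algebra ℂ B] [FunLike F A B] [AlgHomClass F ℂ A B] (f : F)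
    (j : ℕ) : f (eproj ζ N φ j) = eproj ζ N (f φ) j := by
  simp [eproj, map_sum]

end Weights

section Traces

variable {V : Type*} [AddCommGroup V] [Module ℂ V] [Module.Finite ℂ V] {ζ : ℂ} {N : ℕ}
  {φ R : Module.End ℂ V}

open LinearMap

lemma trace_idem (hR : IsIdempotentElem R) : trace ℂ V R = Module.finrank ℂ (LinearMap.range R) :=
  (LinearMap.IsProj.mk (fun x => LinearMap.mem_range_self R x) (by
    rintro _ ⟨y, rfl⟩
    exact LinearMap.congr_fun hR y) : LinearMap.IsProj (LinearMap.range R) R).trace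

lemma eq_zero_of_trace_idem (hR : IsIdempotentElem R) (h : trace ℂ V R = 0) : R = 0 := by
  rw [trace_idem hR, Nat.cast_eq_zero, Submodule.finrank_eq_zero] at h
  exact LinearMap.range_eq_bot.1 h

/-- The traces of the powers of an operator of finite order are given by multiplicities. -/
lemma exists_weights (hN : 0 < N) (hζ : IsPrimitiveRoot ζ N) (hφ : φ ^ N = 1)
    (hR : IsIdempotentElem R) (hc : Commute φ R) :
    ∃ m : ℕ → ℕ, (∀ j, (m j : ℂ) = trace ℂ V (eproj ζ N φ j * R)) ∧
      ∀ k, trace ℂ V (φ ^ k * R) = ∑ j ∈ Finset.range N, (m j : ℂ) * ζ ^ (j * k) := by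
  have hi : ∀ j, IsIdempotentElem (eproj ζ N φ j * R) := fun j =>
    (eproj_idem hN hζ hφ j).mul_of_commute (commute_eproj hc j) hR
  refine ⟨fun j => Module.finrank ℂ (LinearMap.range (eproj ζ N φ j * R)), fun j =>
    (trace_idem (hi j)).symm, fun k => ?_⟩
  have h1 : φ ^ k * R = ∑ j ∈ Finset.range N, ζ ^ (j * k) • (eproj ζ N φ j * R) := by
    calc φ ^ k * R = φ ^ k * (∑ j ∈ Finset.range N, eproj ζ N φ j) * R := by
          rw [sum_eproj hN hζ, mul_one]
      _ = _ := by
          rw [Finset.mul_sum, Finset.sum_mul]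
          exact Finset.sum_congr rfl fun j _ => by rw [pow_mul_eproj hN hζ hφ, smul_mul_assoc]
  rw [h1, map_sum]
  exact Finset.sum_congr rfl fun j _ => by rw [map_smul, trace_idem (hi j), smul_eq_mul, mul_comm]

/-- An operator of finite order whose trace is the dimension is the identity. -/
lemma eq_one_of_trace (hN : 0 < N) (hφ : φ ^ N = 1) (h : trace ℂ V φ = Module.finrank ℂ V) :
    φ = 1 := by
  have hζ := Complex.isPrimitiveRoot_exp N hN.ne'
  set ζ := Complex.exp (2 * Real.pi * Complex.I / N)
  obtain ⟨m, hm, hk⟩ := exists_weights hN hζ hφ IsIdempotentElem.one (Commute.one_right φ)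
  have h0 := hk 0
  have h1 := hk 1
  simp only [pow_zero, mul_zero, mul_one, pow_one, trace_one] at h0 h1
  have h2 : ∑ j ∈ Finset.range N, (m j : ℝ) * (1 - (ζ ^ j).re) = 0 := by
    have := congrArg Complex.re (h0.symm.trans (h.symm.trans h1))
    simp only [Complex.re_sum, ← Complex.ofReal_natCast, Complex.re_ofReal_mul,
      Complex.ofReal_re] at this
    simp only [mul_sub, mul_one, Finset.sum_sub_distrib]
    linarith
  have hnorm : ‖ζ‖ = 1 := hζ.norm'_eq_one hN.ne'
  have hle : ∀ j, (ζ ^ j).re ≤ 1 := fun j =>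
    (Complex.re_le_norm _).trans (by rw [norm_pow, hnorm, one_pow])
  have h3 := (Finset.sum_eq_zero_iff_of_nonneg fun j _ =>
    mul_nonneg (Nat.cast_nonneg (m j)) (sub_nonneg.2 (hle j))).1 h2
  have h4 : ∀ j ∈ Finset.range N, φ * eproj ζ N φ j = eproj ζ N φ j := by
    intro j hj
    rcases mul_eq_zero.1 (h3 j hj) with h | h
    · have h5 := hm j
      rw [Nat.cast_eq_zero.1 h, mul_one, Nat.cast_zero] at h5
      rw [eq_zero_of_trace_idem (eproj_idem hN hζ hφ j) h5.symm, mul_zero]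
    · have h6 : ζ ^ j = 1 := by
        have hre : (ζ ^ j).re = 1 := by linarith
        have hn : ‖ζ ^ j‖ = 1 := by rw [norm_pow, hnorm, one_pow]
        have him : (ζ ^ j).im = 0 := by
          have := Complex.sq_norm (ζ ^ j)
          rw [hn, Complex.normSq_apply, hre] at this
          nlinarith
        exact Complex.ext hre him
      rw [mul_eproj hN hζ hφ, h6, one_smul]
  calc φ = φ * ∑ j ∈ Finset.range N, eproj ζ N φ j := by rw [sum_eproj hN hζ, mul_one]
    _ = ∑ j ∈ Finset.range N, eproj ζ N φ j := by
        rw [Finset.mul_sum]; exact Finset.sum_congr rfl h4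
    _ = 1 := sum_eproj hN hζ

/-- If the nontrivial powers are traceless, all eigenprojections have the same rank. -/
lemma trace_eproj_mul (hN : 0 < N) (X : Module.End ℂ V)
    (h : ∀ i, i ≠ 0 → i < N → trace ℂ V (φ ^ i * X) = 0) (j : ℕ) :
    trace ℂ V (eproj ζ N φ j * X) = trace ℂ V X / N := by
  rw [eproj, smul_mul_assoc, map_smul, Finset.sum_mul, map_sum, Finset.sum_eq_single 0]
  · simp [div_eq_inv_mul]
  · intro i hi h0
    rw [smul_mul_assoc, map_smul, h i h0 (Finset.mem_range.1 hi), smul_zero]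
  · intro h; simp [hN.ne'] at h

lemma dvd_finrank (hN : 0 < N) (hφ : φ ^ N = 1)
    (h : ∀ i, i ≠ 0 → i < N → trace ℂ V (φ ^ i) = 0) : N ∣ Module.finrank ℂ V := by
  have hζ := Complex.isPrimitiveRoot_exp N hN.ne'
  obtain ⟨m, hm, -⟩ := exists_weights hN hζ hφ IsIdempotentElem.one (Commute.one_right φ)
  have h1 := hm 0
  rw [trace_eproj_mul hN 1 (by simpa using h) 0, trace_one, eq_div_iff (by exact_mod_cast hN.ne')]
    at h1
  exact ⟨m 0, by rw [mul_comm]; exact_mod_cast h1.symm⟩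

/-- The key congruence for operators of order dividing `2 n`. -/
lemma exists_int_trace {n : ℕ} (hn : n.Prime) (ho : Odd n) (hφ : φ ^ (2 * n) = 1)
    (hR : IsIdempotentElem R) (hc : Commute φ R) (h : trace ℂ V (φ * R) = 0) {r : ℕ}
    (hr : trace ℂ V R = r) :
    ∃ d : ℤ, trace ℂ V (φ ^ n * R) = n * d ∧ |n * d| ≤ r ∧ Even ((r : ℤ) - n * d) := by
  have h2n : 0 < 2 * n := by have := hn.pos; omega
  have hζ := Complex.isPrimitiveRoot_exp (2 * n) h2n.ne'
  set ζ := Complex.exp (2 * Real.pi * Complex.I / (2 * n : ℕ))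
  obtain ⟨m, -, hk⟩ := exists_weights h2n hζ hφ hR hc
  have hζn : ζ ^ n = -1 := by
    have h1 : (ζ ^ n) ^ 2 = 1 := by rw [← pow_mul, mul_comm n 2, hζ.pow_eq_one]
    rcases (by simpa using h1 : ζ ^ n = 1 ∨ ζ ^ n = -1) with h | h
    · exact absurd h (hζ.pow_ne_one_of_pos_of_lt hn.ne_zero (by have := hn.pos; omega))
    · exact h
  have hη : IsPrimitiveRoot (-ζ) n := by
    have h1 : -ζ = ζ ^ (n + 1) := by rw [pow_succ, hζn]; ring
    obtain ⟨k, hk⟩ := ho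
    have h2 : n + 1 = 2 * (k + 1) := by omega
    have h3 : IsPrimitiveRoot (ζ ^ 2) n := hζ.pow h2n rfl
    rw [h1, h2, pow_mul]
    refine h3.pow_of_coprime _ ?_
    have : n = 2 * (k + 1) - 1 := by omega
    rw [Nat.coprime_iff_gcd_eq_one]
    have hd1 := Nat.gcd_dvd_left (k + 1) n
    have hd2 := Nat.gcd_dvd_right (k + 1) n
    have : (k + 1).gcd n ∣ 1 := by
      have h5 : (k + 1).gcd n ∣ n + 1 := h2 ▸ hd1.mul_left 2
      exact (Nat.dvd_add_right hd2).1 h5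
    exact Nat.dvd_one.1 this
  let f : Polynomial ℤ := ∑ j ∈ Finset.range (2 * n), Polynomial.monomial j ((-1) ^ j * (m j : ℤ))
  have hf : Polynomial.aeval (-ζ) f = 0 := by
    have h1 := hk 1
    rw [pow_one, h] at h1
    rw [map_sum, h1]
    refine Finset.sum_congr rfl fun j _ => ?_
    rw [Polynomial.aeval_monomial, neg_pow ζ, mul_one]
    have h9 : ((-1 : ℂ) ^ j) * (-1) ^ j = 1 := by rw [← mul_pow]; simp
    simp only [eq_intCast, Int.cast_mul, Int.cast_pow, Int.cast_neg, Int.cast_one, Int.cast_natCast]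
    linear_combination (m j * ζ ^ j : ℂ) * h9
  have hdvd : Polynomial.cyclotomic n ℤ ∣ f := by
    rw [Polynomial.cyclotomic_eq_minpoly hη hn.pos]
    exact minpoly.isIntegrallyClosed_dvd (hη.isIntegral hn.pos) hf
  obtain ⟨g, hg⟩ := hdvd
  have he : f.eval 1 = ∑ j ∈ Finset.range (2 * n), (-1) ^ j * (m j : ℤ) := by
    simp [f, Polynomial.eval_finsetSum]
  have he2 : f.eval 1 = n * g.eval 1 := by
    have := Fact.mk hn
    rw [hg, Polynomial.eval_mul, Polynomial.eval_one_cyclotomic_prime]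
  have h0 := hk 0
  simp only [pow_zero, one_mul, mul_zero, mul_one, hr] at h0
  have h0' : (r : ℤ) = ∑ j ∈ Finset.range (2 * n), (m j : ℤ) := by exact_mod_cast h0
  refine ⟨g.eval 1, ?_, ?_, ?_⟩
  · rw [hk n]
    have : ((n : ℤ) * g.eval 1 : ℤ) = ((∑ j ∈ Finset.range (2 * n), (-1) ^ j * (m j : ℤ) : ℤ)) := by
      rw [← he2, he]
    have h7 := congrArg (Int.cast : ℤ → ℂ) this
    push_cast at h7
    rw [h7]
    refine Finset.sum_congr rfl fun j _ => ?_
    rw [mul_comm j n, pow_mul, hζn, mul_comm]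
  · rw [← he2, he, h0']
    refine (Finset.abs_sum_le_sum_abs _ _).trans (Finset.sum_le_sum fun j _ => ?_)
    rw [abs_mul, abs_pow]; simp
  · rw [← he2, he, h0', ← Finset.sum_sub_distrib]
    refine Finset.even_sum _ fun j _ => ?_
    rcases Nat.even_or_odd j with h | h
    · simp [h.neg_one_pow]
    · simp [h.neg_one_pow, ← two_mul]

lemma trace_ne_zero_of_sq (hφ : φ ^ 2 = 1) (ho : Odd (Module.finrank ℂ V)) : trace ℂ V φ ≠ 0 := by
  have hζ : IsPrimitiveRoot (-1 : ℂ) 2 := IsPrimitiveRoot.neg_one 0 (by norm_num)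
  obtain ⟨m, -, hk⟩ := exists_weights (N := 2) Nat.zero_lt_two hζ hφ IsIdempotentElem.one (Commute.one_right φ)
  have h0 := hk 0
  have h1 := hk 1
  simp only [pow_zero, mul_zero, mul_one, pow_one, trace_one] at h0 h1
  rw [Finset.sum_range_succ, Finset.sum_range_one] at h0 h1
  intro hz
  rw [hz, pow_zero, pow_one] at h1
  have h3 : (m 0 : ℂ) = m 1 := by linear_combination h1.symm
  have h4 : m 0 = m 1 := by exact_mod_cast h3
  have h5 : Module.finrank ℂ V = m 0 + m 1 := by exact_mod_cast h0
  rw [h5, h4, ← two_mul] at ho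
  exact (Nat.not_odd_iff_even.2 (even_two_mul _)) ho

end Traces

section Untwist

open Coalgebra HopfAlgebra

variable {H : Type*} [Ring H] [HopfAlgebra ℂ H]
variable {V : Type*} [AddCommGroup V] [Module ℂ V] (ρ : H →ₐ[ℂ] Module.End ℂ V)

@[fun_prop]
lemma lin_rep (v : V) : Lin (fun x => ρ x v) :=
  lin_linearMap ((LinearMap.applyₗ v) ∘ₗ ρ.toLinearMap)

/-- The isomorphism of `H ⊗ V` with the induced module. -/
noncomputable def untwist : H ⊗[ℂ] V ≃ₗ[ℂ] H ⊗[ℂ] V :=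
  LinearEquiv.ofLinearMap
    (bil (fun h v => sw (fun a b => a ⊗ₜ[ℂ] ρ b v) h) (by fun_prop) (by fun_prop))
    (bil (fun h v => sw (fun a b => a ⊗ₜ[ℂ] ρ (S b) v) h) (by fun_prop) (by fun_prop))
    (TensorProduct.ext' fun h v => by
      simp only [LinearMap.comp_apply, bil_tmul, LinearMap.id_apply]
      rw [(lin_linearMap _).sw]
      simp only [bil_tmul]
      rw [sw_assoc (fun c d b => c ⊗ₜ[ℂ] ρ d (ρ (S b) v)) (by fun_prop) (by fun_prop) (by fun_prop)]
      have : ∀ a b : H, sw (fun c d => a ⊗ₜ[ℂ] ρ c (ρ (S d) v)) b = counit (R := ℂ) b • a ⊗ₜ[ℂ] v := by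
        intro a b
        have := sw_mul_S (fun u => a ⊗ₜ[ℂ] ρ u v) (by fun_prop) b
        simpa using this
      simp only [this]
      exact sw_counit_right (fun a => a ⊗ₜ[ℂ] v) (by fun_prop) h)
    (TensorProduct.ext' fun h v => by
      simp only [LinearMap.comp_apply, bil_tmul, LinearMap.id_apply]
      rw [(lin_linearMap _).sw]
      simp only [bil_tmul]
      rw [sw_assoc (fun c d b => c ⊗ₜ[ℂ] ρ (S d) (ρ b v)) (by fun_prop) (by fun_prop) (by fun_prop)]
      have : ∀ a b : H, sw (fun c d => a ⊗ₜ[ℂ] ρ (S c) (ρ d v)) b = counit (R := ℂ) b • a ⊗ₜ[ℂ] v := by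
        intro a b
        have := sw_S_mul (fun u => a ⊗ₜ[ℂ] ρ u v) (by fun_prop) b
        simpa using this
      simp only [this]
      exact sw_counit_right (fun a => a ⊗ₜ[ℂ] v) (by fun_prop) h)

lemma untwist_tmul (h : H) (v : V) :
    untwist ρ (h ⊗ₜ v) = sw (fun a b => a ⊗ₜ[ℂ] ρ b v) h := by
  simp [untwist, bil_tmul]

variable [Module.Finite ℂ H] [Module.Finite ℂ V]

/-- Trace identities obtained by untwisting `H ⊗ V`. -/
lemma sum_tr_mul_tr {κ : Type*} (s : Finset κ) (F : κ → H → H) (G : κ → V → V) (F' : H → H)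
    (G' : V → V) (hF : ∀ k, Lin (F k)) (hG : ∀ k, Lin (G k)) (hF' : Lin F') (hG' : Lin G')
    (h : ∀ x v, ∑ k ∈ s, sw (fun a b => a ⊗ₜ[ℂ] ρ b (G k v)) (F k x) =
      sw (fun a b => F' a ⊗ₜ[ℂ] G' (ρ b v)) x) :
    ∑ k ∈ s, tr (F k) * tr (G k) = tr F' * tr G' := by
  have e : ∀ (f : H → H) (g : V → V) (hf : Lin f) (hg : Lin g), tr f * tr g =
      LinearMap.trace ℂ _ (TensorProduct.map hf.lm hg.lm) := fun f g hf hg => by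
    rw [LinearMap.trace_tensorProduct', tr_eq hf, tr_eq hg]; rfl
  rw [e F' G' hF' hG', Finset.sum_congr rfl fun k _ => e (F k) (G k) (hF k) (hG k), ← map_sum,
    ← tr_linearMap, ← tr_linearMap]
  refine (tr_conj (untwist ρ) (by fun_prop) fun x => ?_).symm
  refine LinearMap.congr_fun (f := (untwist ρ).toLinearMap ∘ₗ
    ∑ k ∈ s, TensorProduct.map (hF k).lm (hG k).lm)
    (g := TensorProduct.map hF'.lm hG'.lm ∘ₗ (untwist ρ).toLinearMap)
    (TensorProduct.ext' fun a v => ?_) x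
  simp only [LinearMap.comp_apply, LinearMap.sum_apply, TensorProduct.map_tmul, map_sum,
    LinearEquiv.coe_coe, untwist_tmul, Lin.lm_apply]
  rw [h, (lin_linearMap _).sw]
  simp

lemma tr_id_eq : tr (fun x : V => x) = Module.finrank ℂ V := by
  rw [← LinearMap.trace_one, ← tr_linearMap]; rfl

lemma tr_mul_finrank {χ : H →ₐ[ℂ] ℂ} {φ : V → V} (hφ : Lin φ)
    (h : ∀ x v, φ (ρ x v) = ρ (lt χ x) (φ v)) :
    (Module.finrank ℂ H : ℂ) * tr φ = tr (fun x => rt (charS χ) x) * tr φ := by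
  have := sum_tr_mul_tr ρ {()} (fun _ x => x) (fun _ => φ) (rt (charS χ)) φ (by fun_prop)
    (fun _ => hφ) (by fun_prop) hφ fun x v => by
      simp only [Finset.sum_singleton, h]
      rw [sw_lt_right (fun a b => rt (charS χ) a ⊗ₜ[ℂ] ρ b (φ v)) (by fun_prop) (by fun_prop)]
      congr 1; funext a b
      congr 1
      exact (rt_S_rt χ a).symm
  rw [Finset.sum_singleton, tr_id_eq] at this
  exact this

end Untwist

lemma toLinearMap_pow {A : Type*} [Ring A] [Algebra ℂ A] (κ : A ≃ₐ[ℂ] A) (k : ℕ) :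
    (κ ^ k).toLinearMap = (κ.toLinearMap ^ k : Module.End ℂ A) := by
  induction k with
  | zero => rfl
  | succ k ih => rw [pow_succ, pow_succ, ← ih]; rfl

section Orders

open Coalgebra HopfAlgebra

variable {H : Type*} [Ring H] [HopfAlgebra ℂ H]

lemma counit_lt (χ : H →ₐ[ℂ] ℂ) (x : H) : counit (R := ℂ) (lt χ x) = χ x := by
  rw [lt, (by fun_prop : Lin fun x : H => counit (R := ℂ) x).sw]
  simpa [mul_comm] using sw_counit_right (fun a => χ a) (by fun_prop) x

lemma counit_rt (χ : H →ₐ[ℂ] ℂ) (x : H) : counit (R := ℂ) (rt χ x) = χ x := by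
  rw [rt, (by fun_prop : Lin fun x : H => counit (R := ℂ) x).sw]
  simpa [mul_comm] using sw_counit_left (fun a => χ a) (by fun_prop) x

/-- The powers of a character for the convolution product. -/
noncomputable def cpow (χ : H →ₐ[ℂ] ℂ) (k : ℕ) : H →ₐ[ℂ] ℂ :=
  (Bialgebra.counitAlgHom ℂ H).comp ((ltE χ ^ k : H ≃ₐ[ℂ] H) : H →ₐ[ℂ] H)

lemma lt_lt (χ ψ : H →ₐ[ℂ] ℂ) (x : H) :
    lt χ (lt ψ x) = lt (χ.comp (ltE ψ : H →ₐ[ℂ] H)) x := by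
  conv_rhs => unfold lt
  have : ∀ a b : H, (χ.comp (ltE ψ : H →ₐ[ℂ] H)) a • b = χ (lt ψ a) • b := fun _ _ => rfl
  simp only [this]
  rw [← sw_lt (fun a b => χ a • b) (by fun_prop) (by fun_prop)]
  rfl

lemma rt_rt (χ ψ : H →ₐ[ℂ] ℂ) (x : H) :
    rt χ (rt ψ x) = rt (ψ.comp (ltE χ : H →ₐ[ℂ] H)) x := by
  conv_rhs => unfold rt
  have h1 : ∀ a b : H, (ψ.comp (ltE χ : H →ₐ[ℂ] H)) b • a = ψ (lt χ b) • a := fun _ _ => rfl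
  simp only [h1]
  rw [sw_lt_right (fun a b => ψ b • a) (by fun_prop) (by fun_prop), rt.eq_def ψ, (lin_rt χ).sw]
  simp only [(lin_rt χ).map_smul]

lemma lt_counit (x : H) : lt (Bialgebra.counitAlgHom ℂ H) x = x :=
  sw_counit_left (fun x => x) (by fun_prop) x

lemma rt_counit (x : H) : rt (Bialgebra.counitAlgHom ℂ H) x = x :=
  sw_counit_right (fun x => x) (by fun_prop) x

lemma ltE_pow (χ : H →ₐ[ℂ] ℂ) (k : ℕ) : ltE χ ^ k = ltE (cpow χ k) := by
  induction k with
  | zero => ext x; exact (lt_counit x).symm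
  | succ k ih =>
    ext x
    rw [pow_succ, AlgEquiv.mul_apply, ih, ltE_apply, ltE_apply, lt_lt]
    congr 1

lemma rtE_pow (χ : H →ₐ[ℂ] ℂ) (k : ℕ) : rtE χ ^ k = rtE (cpow χ k) := by
  induction k with
  | zero => ext x; exact (rt_counit x).symm
  | succ k ih =>
    ext x
    rw [pow_succ', AlgEquiv.mul_apply, ih, rtE_apply, rtE_apply, rt_rt]
    congr 1

lemma ltE_eq_one_iff {χ : H →ₐ[ℂ] ℂ} : ltE χ = 1 ↔ χ = Bialgebra.counitAlgHom ℂ H := by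
  constructor
  · intro h
    ext x
    rw [← counit_lt, ← ltE_apply, h]; rfl
  · rintro rfl
    ext x
    exact lt_counit x

lemma rtE_eq_one_iff {χ : H →ₐ[ℂ] ℂ} : rtE χ = 1 ↔ χ = Bialgebra.counitAlgHom ℂ H := by
  constructor
  · intro h
    ext x
    rw [← counit_rt, ← rtE_apply, h]; rfl
  · rintro rfl
    ext x
    exact rt_counit x

lemma charS_eq_counit {χ : H →ₐ[ℂ] ℂ} (h : charS χ = Bialgebra.counitAlgHom ℂ H) :
    χ = Bialgebra.counitAlgHom ℂ H := by
  rw [← ltE_eq_one_iff]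
  ext x
  have := lt_charS χ x
  rwa [h, lt_counit] at this

variable [Module.Finite ℂ H]

lemma isOfFinOrder_ltE (χ : H →ₐ[ℂ] ℂ) : IsOfFinOrder (ltE χ) := by
  rw [← finite_powers]
  refine (Set.finite_range (ltE (H := H))).subset ?_
  rintro _ ⟨k, rfl⟩
  exact ⟨_, (ltE_pow χ k).symm⟩

lemma isOfFinOrder_rtE (χ : H →ₐ[ℂ] ℂ) : IsOfFinOrder (rtE χ) := by
  rw [← finite_powers]
  refine (Set.finite_range (rtE (H := H))).subset ?_
  rintro _ ⟨k, rfl⟩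
  exact ⟨_, (rtE_pow χ k).symm⟩

/-- A map intertwining a nontrivial translation has trace zero. -/
lemma eq_counit_of_tr_ne_zero {V : Type*} [AddCommGroup V] [Module ℂ V] [Module.Finite ℂ V]
    (ρ : H →ₐ[ℂ] Module.End ℂ V) {χ : H →ₐ[ℂ] ℂ} {φ : V → V} (hφ : Lin φ)
    (h : ∀ x v, φ (ρ x v) = ρ (lt χ x) (φ v)) (h0 : tr φ ≠ 0) :
    χ = Bialgebra.counitAlgHom ℂ H := by
  have h1 := mul_right_cancel₀ h0 (tr_mul_finrank ρ hφ h)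
  obtain ⟨N, hN, hN1⟩ := (isOfFinOrder_rtE (charS χ)).exists_pow_eq_one
  have h2 : (rtE (charS χ)).toLinearMap = (1 : Module.End ℂ H) :=
    eq_one_of_trace hN (by rw [← toLinearMap_pow, hN1]; rfl) (by
      rw [h1, ← tr_linearMap]; rfl)
  refine charS_eq_counit (rtE_eq_one_iff.1 ?_)
  ext x
  exact LinearMap.congr_fun h2 x

lemma tr_lt {χ : H →ₐ[ℂ] ℂ} (hχ : χ ≠ Bialgebra.counitAlgHom ℂ H) : tr (fun x => lt χ x) = 0 := by
  by_contra h0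
  exact hχ (eq_counit_of_tr_ne_zero (Algebra.lmul ℂ H) (lin_lt χ) (fun x v => lt_mul χ x v) h0)

lemma cpow_ne {χ : H →ₐ[ℂ] ℂ} {i : ℕ} (h0 : i ≠ 0) (hi : i < orderOf (ltE χ)) :
    cpow χ i ≠ Bialgebra.counitAlgHom ℂ H := fun h =>
  pow_ne_one_of_lt_orderOf h0 hi (by rw [ltE_pow, ltE_eq_one_iff.2 h])

lemma orderOf_ltE_dvd (χ : H →ₐ[ℂ] ℂ) : orderOf (ltE χ) ∣ Module.finrank ℂ H := by
  refine dvd_finrank (φ := (ltE χ).toLinearMap) (isOfFinOrder_ltE χ).orderOf_pos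
    (by rw [← toLinearMap_pow, pow_orderOf_eq_one]; rfl) fun i h0 hi => ?_
  rw [← toLinearMap_pow, ltE_pow, ← tr_linearMap]
  exact tr_lt (cpow_ne h0 hi)

lemma isOfFinOrder_grouplike {g : H} (hg : IsGroupLikeElem ℂ g) : IsOfFinOrder g := by
  let u : Hˣ := ⟨g, S g, hg.mul_antipode_cancel, hg.antipode_mul_cancel⟩
  rw [show g = (u : H) from rfl, Units.isOfFinOrder_val, ← finite_powers]
  refine Set.Finite.of_finite_image (f := Units.val) ((LinearIndependent.setFinite
    (linearIndepOn_isGroupLikeElem (R := ℂ) (A := H))).subset ?_) Units.val_injective.injOn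
  rintro _ ⟨_, ⟨k, rfl⟩, rfl⟩
  rw [Units.val_pow_eq_pow_val]
  exact hg.pow

lemma tr_mul_left {g : H} (hg : IsGroupLikeElem ℂ g) (h1 : g ≠ 1) : tr (fun x => g * x) = 0 := by
  by_contra h0
  have := sum_tr_mul_tr (Algebra.lmul ℂ H) {()} (fun _ x => g * x) (fun _ x => x) (fun x => g * x)
    (fun x => g * x) (by fun_prop) (by fun_prop) (by fun_prop) (by fun_prop) fun x v => by
      simp only [Finset.sum_singleton]
      rw [sw_mul_arg _ (by fun_prop) (by fun_prop), sw_eq_bil _ (by fun_prop) (by fun_prop),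
        hg.comul_eq_tmul_self, bil_tmul]
      simp [mul_assoc]
  rw [Finset.sum_singleton, tr_id_eq] at this
  have h2 := mul_left_cancel₀ h0 this
  obtain ⟨N, hN, hN1⟩ := (isOfFinOrder_grouplike hg).exists_pow_eq_one
  have h3 : LinearMap.mulLeft ℂ g = (1 : Module.End ℂ H) :=
    eq_one_of_trace hN (by rw [LinearMap.pow_mulLeft, hN1, LinearMap.mulLeft_one]; rfl) (by
      rw [h2, ← tr_linearMap]; rfl)
  exact h1 (by simpa using LinearMap.congr_fun h3 1)

lemma tr_mul_right (hS : Function.Bijective (S : H → H)) {g : H} (hg : IsGroupLikeElem ℂ g)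
    (h1 : g ≠ 1) : tr (fun x => x * g) = 0 := by
  rw [← tr_mul_left (g := S g) hg.antipode fun h => h1 (by
    have := hg.antipode_antipode (R := ℂ); rw [← this]; change S (S g) = 1; rw [h, S_one])]
  refine tr_conj (LinearEquiv.ofBijective (antipode ℂ) hS) (by fun_prop) fun y => ?_
  change S (S g * y) = S y * g
  rw [S_mul, S, S, S, hg.antipode_antipode]

lemma orderOf_grouplike_dvd {g : H} (hg : IsGroupLikeElem ℂ g) :
    orderOf g ∣ Module.finrank ℂ H := by
  refine dvd_finrank (φ := LinearMap.mulLeft ℂ g) (isOfFinOrder_grouplike hg).orderOf_pos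
    (by rw [LinearMap.pow_mulLeft, pow_orderOf_eq_one, LinearMap.mulLeft_one]; rfl) fun i h0 hi => ?_
  rw [LinearMap.pow_mulLeft, ← tr_linearMap]
  exact tr_mul_left hg.pow (pow_ne_one_of_lt_orderOf h0 hi)

lemma tr_mul_eproj (hS : Function.Bijective (S : H → H)) {g : H} (hg : IsGroupLikeElem ℂ g)
    (ζ : ℂ) (j : ℕ) :
    tr (fun x => x * eproj ζ (orderOf g) g j) = Module.finrank ℂ H / orderOf g := by
  have hb := (isOfFinOrder_grouplike hg).orderOf_pos
  have := tr_smul (V := H) ((orderOf g : ℂ)⁻¹)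
    (fun x => ∑ i ∈ Finset.range (orderOf g), (ζ⁻¹) ^ (j * i) • (x * g ^ i)) (by fun_prop)
  rw [tr_sum _ _ (by fun_prop), Finset.sum_eq_single 0] at this
  · rw [div_eq_inv_mul, ← tr_id_eq]
    simpa [eproj, Finset.mul_sum] using this
  · intro i hi h0
    rw [tr_smul _ _ (by fun_prop), tr_mul_right hS hg.pow
      (pow_ne_one_of_lt_orderOf h0 (Finset.mem_range.1 hi)), mul_zero]
  · intro h; exact absurd (Finset.mem_range.2 hb) h

end Orders

section Simples

open Module

variable {V : Type*} [AddCommGroup V] [Module ℂ V]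

lemma exists_smul_of_forall_commute (X : End ℂ V) (h : ∀ A : End ℂ V, A * X = X * A) :
    ∃ c : ℂ, X = c • (1 : End ℂ V) := by
  have : X ∈ Set.center (End ℂ V) := by
    rw [Semigroup.mem_center_iff]; exact h
  obtain ⟨c, hc, rfl⟩ := Module.End.mem_center_iff.1 this
  exact ⟨c, by ext; simp⟩

lemma exists_mul_mul_ne_zero {X Y : End ℂ V} (hX : X ≠ 0) (hY : Y ≠ 0) : ∃ C, X * C * Y ≠ 0 := by
  obtain ⟨v, hv⟩ : ∃ v, X v ≠ 0 := by
    by_contra! h; exact hX (LinearMap.ext h)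
  obtain ⟨w, hw⟩ : ∃ v, Y v ≠ 0 := by
    by_contra! h; exact hY (LinearMap.ext h)
  obtain ⟨φ, hφ⟩ := Module.Projective.exists_dual_ne_zero ℂ hw
  refine ⟨φ.smulRight v, fun h => ?_⟩
  have := LinearMap.congr_fun h w
  simp [hφ, hv] at this

end Simples

/-- A complete list of the simple modules of a finite-dimensional algebra, together with the
nilpotency of the common kernel. -/
structure SimpleList (H : Type*) [Ring H] [Algebra ℂ H] where
  n : ℕ
  d : Fin n → ℕ
  pos : ∀ i, 0 < d i
  ρ : ∀ i, H →ₐ[ℂ] Module.End ℂ (Fin (d i) → ℂ)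
  surj : ∀ A : (∀ i, Module.End ℂ (Fin (d i) → ℂ)), ∃ x, ∀ i, ρ i x = A i
  nil : ∃ N, (⨅ i, LinearMap.ker (ρ i).toLinearMap : Submodule ℂ H) ^ N = ⊥

section Existence

variable (H : Type*) [Ring H] [Algebra ℂ H] [Module.Finite ℂ H]

theorem SimpleList.nonempty : Nonempty (SimpleList H) := by
  have : IsArtinianRing H := IsArtinianRing.of_finite ℂ H
  have : Module.Finite ℂ (H ⧸ Ring.jacobson H) :=
    Module.Finite.of_surjective (Ideal.Quotient.mkₐ ℂ (Ring.jacobson H)).toLinearMap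
      Ideal.Quotient.mk_surjective
  obtain ⟨n, d, hd, ⟨e⟩⟩ :=
    IsSemisimpleRing.exists_algEquiv_pi_matrix_of_isAlgClosed ℂ (H ⧸ Ring.jacobson H)
  let ρ : ∀ i, H →ₐ[ℂ] Module.End ℂ (Fin (d i) → ℂ) := fun i =>
    (Matrix.toLinAlgEquiv' : Matrix (Fin (d i)) (Fin (d i)) ℂ ≃ₐ[ℂ] _).toAlgHom.comp
      ((Pi.evalAlgHom ℂ _ i).comp (e.toAlgHom.comp (Ideal.Quotient.mkₐ ℂ (Ring.jacobson H))))
  have hρ : ∀ i x, ρ i x = Matrix.toLinAlgEquiv' (e (Ideal.Quotient.mk _ x) i) := fun _ _ => rfl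
  refine ⟨⟨n, d, fun i => Nat.pos_of_ne_zero (hd i).out, ρ, fun A => ?_, ?_⟩⟩
  · obtain ⟨x, hx⟩ := Ideal.Quotient.mk_surjective
      (e.symm fun i => (Matrix.toLinAlgEquiv'.symm (A i)))
    exact ⟨x, fun i => by rw [hρ, hx]; simp⟩
  · obtain ⟨N, hN⟩ := IsSemiprimaryRing.isNilpotent (R := H)
    refine ⟨N, ?_⟩
    have key : ∀ k, ∀ x ∈ (⨅ i, LinearMap.ker (ρ i).toLinearMap : Submodule ℂ H) ^ (k + 1),
        x ∈ Ring.jacobson H ^ (k + 1) := by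
      have h1 : ∀ x ∈ (⨅ i, LinearMap.ker (ρ i).toLinearMap : Submodule ℂ H),
          x ∈ Ring.jacobson H := by
        intro x hx
        rw [← Ideal.Quotient.eq_zero_iff_mem]
        apply e.injective
        rw [map_zero]
        funext i
        have := (Submodule.mem_iInf _).1 hx i
        rw [LinearMap.mem_ker] at this
        change ρ i x = 0 at this
        rw [hρ] at this
        exact (map_eq_zero_iff _ (AlgEquiv.injective _)).1 this
      intro k
      induction k with
      | zero => intro x hx; rw [zero_add, Submodule.pow_one] at hx ⊢; exact h1 x hx
      | succ k ih =>
        intro x hx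
        rw [Submodule.pow_succ] at hx ⊢
        refine Submodule.mul_induction_on hx (fun a ha b hb => ?_) fun a b ha hb => add_mem ha hb
        exact Ideal.mul_mem_mul (ih a ha) (h1 b hb)
    cases N with
    | zero =>
      rw [Submodule.pow_zero] at hN
      have : (1 : H) ∈ (1 : Ideal H) := by rw [Ideal.one_eq_top]; trivial
      rw [hN] at this
      have h01 : (1 : H) = 0 := this
      exact (Submodule.eq_bot_iff _).2 fun x _ => by rw [← mul_one x, h01, mul_zero]
    | succ k =>
      refine (Submodule.eq_bot_iff _).2 fun x hx => ?_
      have := key k x hx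
      rw [hN] at this
      exact this

end Existence

namespace SimpleList

variable {H : Type*} [Ring H] [Algebra ℂ H] (W : SimpleList H)

/-- The common kernel of the simple modules. -/
noncomputable def J : Submodule ℂ H := ⨅ i, LinearMap.ker (W.ρ i).toLinearMap

lemma mem_J {x : H} : x ∈ W.J ↔ ∀ i, W.ρ i x = 0 := by
  simp [J, Submodule.mem_iInf]

lemma mul_mem_J {x y : H} (h : y ∈ W.J) : x * y ∈ W.J := by
  rw [mem_J] at h ⊢; intro i; rw [map_mul, h, mul_zero]

lemma isNilpotent_of_mem {x : H} (h : x ∈ W.J) : IsNilpotent x := by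
  obtain ⟨N, hN⟩ := W.nil
  refine ⟨N, ?_⟩
  have := Submodule.pow_mem_pow _ h N
  rw [J, hN] at this
  exact this

lemma surj_ρ (i : Fin W.n) : Function.Surjective (W.ρ i) := by
  classical
  intro A
  obtain ⟨x, hx⟩ := W.surj (Pi.single i A)
  exact ⟨x, by rw [hx]; simp⟩

lemma exists_lift_single (i : Fin W.n) (A : Module.End ℂ (Fin (W.d i) → ℂ)) :
    ∃ x, W.ρ i x = A ∧ ∀ j, j ≠ i → W.ρ j x = 0 := by
  classical
  obtain ⟨x, hx⟩ := W.surj (Pi.single i A)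
  exact ⟨x, by rw [hx]; simp, fun j hj => by rw [hx]; simp [hj]⟩

instance (i : Fin W.n) : NeZero (W.d i) := ⟨(W.pos i).ne'⟩

/-- Every representation onto an endomorphism algebra occurs in the list. -/
theorem exists_equiv {V : Type*} [AddCommGroup V] [Module ℂ V] [Nontrivial V]
    (σ : H →ₐ[ℂ] Module.End ℂ V) (hσ : Function.Surjective σ) :
    ∃ i, ∃ T : (Fin (W.d i) → ℂ) ≃ₗ[ℂ] V, ∀ x v, T (W.ρ i x v) = σ x (T v) := by
  classical
  obtain ⟨i, hi⟩ : ∃ i, ∀ x, W.ρ i x = 0 → σ x = 0 := by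
    by_contra! hcon
    have h1 : ∀ s : Finset (Fin W.n), ∃ x, (∀ i ∈ s, W.ρ i x = 0) ∧ σ x ≠ 0 := by
      intro s
      induction s using Finset.induction_on with
      | empty => exact ⟨1, by simp, by simp⟩
      | insert a s _ ih =>
        obtain ⟨x, hx, hx0⟩ := ih
        obtain ⟨y, hy, hy0⟩ := hcon a
        obtain ⟨C, hC⟩ := exists_mul_mul_ne_zero hx0 hy0
        obtain ⟨c, rfl⟩ := hσ C
        refine ⟨x * c * y, fun i hi => ?_, by rw [map_mul, map_mul]; exact hC⟩
        rcases Finset.mem_insert.1 hi with rfl | hi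
        · rw [map_mul, hy, mul_zero]
        · rw [map_mul, map_mul, hx i hi, zero_mul, zero_mul]
    obtain ⟨x, hx, hx0⟩ := h1 Finset.univ
    have hxJ : x ∈ W.J := W.mem_J.2 fun i => hx i (Finset.mem_univ i)
    have h2 : ∀ k, ∃ y ∈ W.J ^ k, σ y ≠ 0 := by
      intro k
      induction k with
      | zero => exact ⟨1, by simp [Submodule.one_le.1 le_rfl], by simp⟩
      | succ k ih =>
        obtain ⟨y, hy, hy0⟩ := ih
        obtain ⟨C, hC⟩ := exists_mul_mul_ne_zero hy0 hx0
        obtain ⟨c, rfl⟩ := hσ C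
        refine ⟨y * (c * x), ?_, by rwa [map_mul, map_mul, ← mul_assoc]⟩
        rw [pow_succ]
        exact Submodule.mul_mem_mul hy (W.mul_mem_J hxJ)
    obtain ⟨N, hN⟩ := W.nil
    obtain ⟨y, hy, hy0⟩ := h2 N
    rw [J, hN] at hy
    rw [(Submodule.mem_bot ℂ).1 hy, map_zero] at hy0
    exact hy0 rfl
  refine ⟨i, ?_⟩
  obtain ⟨s, hs⟩ := LinearMap.exists_rightInverse_of_surjective (W.ρ i).toLinearMap
    (LinearMap.range_eq_top.2 (W.surj_ρ i))
  have hs' : ∀ A, W.ρ i (s A) = A := fun A => LinearMap.congr_fun hs A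
  have hs2 : ∀ x, σ (s (W.ρ i x)) = σ x := fun x => by
    rw [← sub_eq_zero, ← map_sub]; apply hi; rw [map_sub, hs', sub_self]
  let f : Module.End ℂ (Fin (W.d i) → ℂ) →ₐ[ℂ] Module.End ℂ V :=
    AlgHom.ofLinearMap (σ.toLinearMap ∘ₗ s)
      (by simpa using hs2 1)
      (fun A B => by
        have := hs2 (s A * s B)
        rw [map_mul, hs', hs'] at this
        simpa using this)
  have hf : ∀ x, f (W.ρ i x) = σ x := hs2
  have hsimple : IsSimpleRing (Module.End ℂ (Fin (W.d i) → ℂ)) :=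
    IsSimpleRing.of_ringEquiv
      (Matrix.toLinAlgEquiv' : Matrix (Fin (W.d i)) (Fin (W.d i)) ℂ ≃ₐ[ℂ] _).toRingEquiv
      inferInstance
  have hbij : Function.Bijective f := ⟨f.toRingHom.injective, fun A => by
    obtain ⟨x, rfl⟩ := hσ A
    exact ⟨_, hf x⟩⟩
  obtain ⟨T, hT⟩ := (AlgEquiv.ofBijective f hbij).eq_linearEquivConjAlgEquiv
  refine ⟨T, fun x v => ?_⟩
  have := hf x
  rw [← AlgEquiv.ofBijective_apply f hbij (W.ρ i x), hT] at this
  rw [← this]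
  simp [LinearEquiv.conjAlgEquiv_apply]

/-- `V_j` is the twist of `V_i` by `κ`. -/
def Iso (κ : H ≃ₐ[ℂ] H) (i j : Fin W.n) : Prop :=
  ∃ T : (Fin (W.d i) → ℂ) ≃ₗ[ℂ] (Fin (W.d j) → ℂ), ∀ x v, T (W.ρ i x v) = W.ρ j (κ x) (T v)

lemma Iso.one (i : Fin W.n) : W.Iso 1 i i := ⟨LinearEquiv.refl _ _, fun _ _ => rfl⟩

variable {W}

lemma Iso.mul {κ μ : H ≃ₐ[ℂ] H} {i j k : Fin W.n} (h1 : W.Iso κ i j) (h2 : W.Iso μ j k) :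
    W.Iso (μ * κ) i k := by
  obtain ⟨T, hT⟩ := h1
  obtain ⟨U, hU⟩ := h2
  exact ⟨T.trans U, fun x v => by simp [hT, hU]⟩

lemma Iso.inv {κ : H ≃ₐ[ℂ] H} {i j : Fin W.n} (h1 : W.Iso κ i j) : W.Iso κ⁻¹ j i := by
  obtain ⟨T, hT⟩ := h1
  refine ⟨T.symm, fun x v => ?_⟩
  rw [LinearEquiv.symm_apply_eq, hT]
  have : κ (κ⁻¹ x) = x := by rw [← AlgEquiv.mul_apply, mul_inv_cancel]; rfl
  rw [this]; simp

lemma Iso.ρ_eq_zero {κ : H ≃ₐ[ℂ] H} {i j : Fin W.n} (h : W.Iso κ i j) {x : H} :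
    W.ρ j (κ x) = 0 ↔ W.ρ i x = 0 := by
  obtain ⟨T, hT⟩ := h
  constructor
  · intro h; refine LinearMap.ext fun v => ?_
    apply T.injective; rw [hT, h]; simp
  · intro h; refine LinearMap.ext fun v => ?_
    obtain ⟨v, rfl⟩ := T.surjective v
    rw [← hT, h]; simp

lemma Iso.d_eq {κ : H ≃ₐ[ℂ] H} {i j : Fin W.n} (h : W.Iso κ i j) : W.d i = W.d j := by
  obtain ⟨T, hT⟩ := h
  simpa using T.finrank_eq

lemma Iso.eq {i j : Fin W.n} (h : W.Iso 1 i j) : i = j := by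
  by_contra hne
  obtain ⟨x, hx, hx'⟩ := W.exists_lift_single i 1
  have h1 := (h.ρ_eq_zero (x := x)).1 (hx' j (Ne.symm hne))
  rw [hx] at h1
  exact one_ne_zero h1

lemma Iso.unique {κ : H ≃ₐ[ℂ] H} {i j k : Fin W.n} (h1 : W.Iso κ i j) (h2 : W.Iso κ i k) :
    j = k := by
  have := h1.inv.mul h2
  rw [mul_inv_cancel] at this
  exact this.eq

variable (W)

lemma exists_iso (κ : H ≃ₐ[ℂ] H) (i : Fin W.n) : ∃ j, W.Iso κ i j := by
  obtain ⟨j, T, hT⟩ := W.exists_equiv ((W.ρ i).comp (κ⁻¹ : H ≃ₐ[ℂ] H).toAlgHom)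
    ((W.surj_ρ i).comp (κ⁻¹).surjective)
  have : W.Iso κ⁻¹ j i := ⟨T, hT⟩
  exact ⟨j, by simpa using this.inv⟩

/-- The permutation of the simple modules induced by an automorphism. -/
noncomputable def act (κ : H ≃ₐ[ℂ] H) (i : Fin W.n) : Fin W.n := (W.exists_iso κ i).choose

lemma iso_act (κ : H ≃ₐ[ℂ] H) (i : Fin W.n) : W.Iso κ i (W.act κ i) := (W.exists_iso κ i).choose_spec

variable {W} in
lemma Iso.act_eq {κ : H ≃ₐ[ℂ] H} {i j : Fin W.n} (h : W.Iso κ i j) : W.act κ i = j :=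
  (W.iso_act κ i).unique h

lemma act_one (i : Fin W.n) : W.act 1 i = i := (Iso.one W i).act_eq

lemma act_mul (κ μ : H ≃ₐ[ℂ] H) (i : Fin W.n) : W.act (κ * μ) i = W.act κ (W.act μ i) :=
  ((W.iso_act μ i).mul (W.iso_act κ _)).act_eq

lemma act_eq_iff {κ : H ≃ₐ[ℂ] H} {i j : Fin W.n} : W.act κ i = j ↔ W.Iso κ i j :=
  ⟨fun h => h ▸ W.iso_act κ i, Iso.act_eq⟩

lemma act_pow_eq {κ : H ≃ₐ[ℂ] H} {i : Fin W.n} (h : W.act κ i = i) (k : ℕ) : W.act (κ ^ k) i = i := by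
  induction k with
  | zero => exact W.act_one i
  | succ k ih => rw [pow_succ, act_mul, h, ih]

lemma act_inv_eq_iff {κ : H ≃ₐ[ℂ] H} {i j : Fin W.n} : W.act κ⁻¹ i = j ↔ W.act κ j = i := by
  rw [act_eq_iff, act_eq_iff]
  exact ⟨fun h => by simpa using h.inv, fun h => h.inv⟩

lemma ρ_act_eq_zero (κ : H ≃ₐ[ℂ] H) {i : Fin W.n} {x : H} :
    W.ρ (W.act κ i) (κ x) = 0 ↔ W.ρ i x = 0 := (W.iso_act κ i).ρ_eq_zero

lemma map_mem_J (κ : H ≃ₐ[ℂ] H) {x : H} (h : x ∈ W.J) : κ x ∈ W.J := by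
  rw [mem_J] at h ⊢
  intro i
  have := (W.iso_act κ⁻¹ i).inv
  rw [inv_inv] at this
  exact this.ρ_eq_zero.2 (h _)

/-- An intertwiner of a fixed simple module, normalised to have the order of the automorphism. -/
lemma exists_intertwiner {κ : H ≃ₐ[ℂ] H} {i : Fin W.n} {N : ℕ} (hN : 0 < N) (hκ : κ ^ N = 1)
    (h : W.act κ i = i) : ∃ T : Module.End ℂ (Fin (W.d i) → ℂ), T ^ N = 1 ∧
      ∀ x, T * W.ρ i x = W.ρ i (κ x) * T := by
  obtain ⟨U, hU⟩ := (W.act_eq_iff).1 h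
  set X : Module.End ℂ (Fin (W.d i) → ℂ) := U.toLinearMap with hXdef
  have hX : ∀ x, X * W.ρ i x = W.ρ i (κ x) * X := fun x => LinearMap.ext fun v => hU x v
  have hXk : ∀ k x, X ^ k * W.ρ i x = W.ρ i ((κ ^ k) x) * X ^ k := by
    intro k
    induction k with
    | zero => intro x; simp
    | succ k ih => intro x; rw [pow_succ, mul_assoc, hX, ← mul_assoc, ih, mul_assoc]; rfl
  obtain ⟨c, hc⟩ := exists_smul_of_forall_commute (X ^ N) fun A => by
    obtain ⟨x, rfl⟩ := W.surj_ρ i A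
    rw [hXk, hκ]; rfl
  have hXinj : Function.Injective X := U.injective
  have hc0 : c ≠ 0 := by
    rintro rfl
    have hinj : Function.Injective (X ^ N : Module.End ℂ (Fin (W.d i) → ℂ)) := by
      rw [Module.End.coe_pow]; exact hXinj.iterate N
    have h1 : (1 : Module.End ℂ (Fin (W.d i) → ℂ)) = 0 := by
      refine LinearMap.ext fun v => hinj ?_
      rw [hc]; simp
    exact one_ne_zero h1
  obtain ⟨z, hz⟩ := IsAlgClosed.exists_pow_nat_eq c hN
  have hz0 : z ≠ 0 := by rintro rfl; rw [zero_pow hN.ne'] at hz; exact hc0 hz.symm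
  refine ⟨z⁻¹ • X, ?_, fun x => ?_⟩
  · rw [smul_pow, hc, smul_smul, inv_pow, hz, inv_mul_cancel₀ hc0, one_smul]
  · rw [smul_mul_assoc, hX, mul_smul_comm]

end SimpleList

open Module

section TraceForm

variable {V : Type*} [AddCommGroup V] [Module ℂ V] [Module.Finite ℂ V]

lemma eq_sum_smulRight (A : End ℂ V) :
    A = ∑ k, ((Module.finBasis ℂ V).coord k).smulRight (A (Module.finBasis ℂ V k)) := by
  refine LinearMap.ext fun v => ?_
  conv_lhs => rw [← (Module.finBasis ℂ V).sum_repr v, map_sum]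
  simp

lemma exists_eq_mul_trace (h : End ℂ V →ₗ[ℂ] ℂ) (hh : ∀ A B, h (A * B) = h (B * A)) :
    ∃ c : ℂ, ∀ A, h A = c * LinearMap.trace ℂ V A := by
  by_cases hV : Nontrivial V
  · obtain ⟨w, hw⟩ := exists_ne (0 : V)
    obtain ⟨ψ, hψ⟩ := Module.Projective.exists_dual_ne_zero ℂ hw
    refine ⟨h (((ψ w)⁻¹ • ψ).smulRight w), fun A => ?_⟩
    have key : ∀ (φ : Module.Dual ℂ V) (v : V), h (φ.smulRight v) =
        h (((ψ w)⁻¹ • ψ).smulRight w) * LinearMap.trace ℂ V (φ.smulRight v) := by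
      intro φ v
      have h1 : φ.smulRight v = (((ψ w)⁻¹ • ψ).smulRight v) * (φ.smulRight w) := by
        refine LinearMap.ext fun u => ?_
        simp [hψ]
      have h2 : (φ.smulRight w) * (((ψ w)⁻¹ • ψ).smulRight v) =
          φ v • ((ψ w)⁻¹ • ψ).smulRight w := by
        refine LinearMap.ext fun u => ?_
        simp only [Module.End.mul_apply, LinearMap.smulRight_apply, map_smul, LinearMap.smul_apply,
          smul_smul, smul_eq_mul]
        ring_nf
      rw [h1, hh, h2, map_smul, ← h1, LinearMap.trace_smulRight, smul_eq_mul, mul_comm]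
    rw [eq_sum_smulRight A, map_sum, map_sum, Finset.mul_sum]
    exact Finset.sum_congr rfl fun k _ => key _ _
  · rw [not_nontrivial_iff_subsingleton] at hV
    exact ⟨0, fun A => by rw [Subsingleton.elim A 0]; simp⟩

end TraceForm

namespace SimpleList

variable {H : Type*} [Ring H] [Algebra ℂ H] (W : SimpleList H)

lemma act_pow_zsmul_ne {κ : H ≃ₐ[ℂ] H} {i j : Fin W.n} (h : W.act κ i = i) (hj : j ≠ i) (k : ℕ)
    {x : H} (hx : ∀ j, j ≠ i → W.ρ j x = 0) : W.ρ j ((κ ^ k) x) = 0 := by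
  obtain ⟨l, hl⟩ : ∃ l, W.act (κ ^ k) l = j := ⟨W.act (κ ^ k)⁻¹ j, by rw [← act_inv_eq_iff]⟩
  have hli : l ≠ i := by
    rintro rfl
    rw [W.act_pow_eq h] at hl
    exact hj hl.symm
  rw [← hl, ρ_act_eq_zero]
  exact hx l hli

/-- A primitive idempotent for a fixed simple module can be chosen to be fixed. -/
theorem exists_fixed_lift {κ : H ≃ₐ[ℂ] H} {i : Fin W.n} {N : ℕ} (hN : 0 < N) (hκ : κ ^ N = 1)
    (h : W.act κ i = i) : ∃ e, κ e = e ∧ IsIdempotentElem e ∧ (∀ j, j ≠ i → W.ρ j e = 0) ∧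
      ∃ (φ : Module.Dual ℂ (Fin (W.d i) → ℂ)) (w : _), φ w = 1 ∧ W.ρ i e = φ.smulRight w := by
  obtain ⟨T, hTN, hT⟩ := W.exists_intertwiner hN hκ h
  have hζ : IsPrimitiveRoot (Complex.exp (2 * Real.pi * Complex.I / N)) N :=
    Complex.isPrimitiveRoot_exp N hN.ne'
  set ζ := Complex.exp (2 * Real.pi * Complex.I / N)
  obtain ⟨j, hj⟩ : ∃ j, eproj ζ N T j ≠ 0 := by
    by_contra! hc
    have := sum_eproj hN hζ (φ := T)
    simp [hc] at this
  set P := eproj ζ N T j with hP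
  have hPi : P * P = P := eproj_idem hN hζ hTN j
  have hTP : T * P = ζ ^ j • P := mul_eproj hN hζ hTN j
  have hPT : P * T = ζ ^ j • P := by
    rw [← hTP]; exact (commute_eproj (Commute.refl T) j).eq
  obtain ⟨v, hv⟩ : ∃ v, P v ≠ 0 := by
    by_contra! hc
    exact hj (LinearMap.ext hc)
  obtain ⟨ψ, hψ⟩ := Module.Projective.exists_dual_ne_zero ℂ hv
  set w := (ψ (P v))⁻¹ • P v with hw
  set φ : Module.Dual ℂ (Fin (W.d i) → ℂ) := ψ ∘ₗ P with hφ
  have hPP : ∀ u, P (P u) = P u := fun u => LinearMap.congr_fun hPi u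
  have hφw : φ w = 1 := by simp [hw, hφ, hPP, hψ]
  have hTw : T w = ζ ^ j • w := by
    have := LinearMap.congr_fun hTP v
    simp only [Module.End.mul_apply, LinearMap.smul_apply] at this
    rw [hw, map_smul, this, smul_comm]
  have hφT : ∀ u, φ (T u) = ζ ^ j * φ u := fun u => by
    have := LinearMap.congr_fun hPT u
    simp only [Module.End.mul_apply, LinearMap.smul_apply] at this
    simp [hφ, this]
  have hζ0 : ζ ^ j ≠ 0 := pow_ne_zero _ (hζ.ne_zero hN.ne')
  set B : Module.End ℂ (Fin (W.d i) → ℂ) := φ.smulRight w with hB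
  have hTB : T * B = B * T := by
    refine LinearMap.ext fun u => ?_
    simp only [hB, Module.End.mul_apply, LinearMap.smulRight_apply, map_smul, hTw, hφT, smul_smul]
    ring_nf
  obtain ⟨x, hx, hx'⟩ := W.exists_lift_single i B
  have hTinv : ∀ A A' : Module.End ℂ (Fin (W.d i) → ℂ), A * T = A' * T → A = A' := by
    intro A A' hAA
    have h1 : T * T ^ (N - 1) = 1 := by rw [← pow_succ', Nat.sub_add_cancel hN, hTN]
    rw [← mul_one A, ← h1, ← mul_assoc, hAA, mul_assoc, h1, mul_one]
  have hκx : ∀ k, W.ρ i ((κ ^ k) x) = B := by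
    intro k
    induction k with
    | zero => exact hx
    | succ k ih =>
      apply hTinv
      rw [pow_succ', AlgEquiv.mul_apply, ← hT, ih, hTB]
  set y := (N : ℂ)⁻¹ • ∑ k ∈ Finset.range N, (κ ^ k) x with hy
  have hNC : (N : ℂ) ≠ 0 := Nat.cast_ne_zero.2 hN.ne'
  have hyi : W.ρ i y = B := by
    rw [hy, map_smul, map_sum, Finset.sum_congr rfl fun k _ => hκx k]
    rw [Finset.sum_const, Finset.card_range, ← Nat.cast_smul_eq_nsmul ℂ, smul_smul,
      inv_mul_cancel₀ hNC, one_smul]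
  have hyj : ∀ l, l ≠ i → W.ρ l y = 0 := by
    intro l hl
    rw [hy, map_smul, map_sum, Finset.sum_eq_zero fun k _ => W.act_pow_zsmul_ne h hl k hx', smul_zero]
  have hκy : κ y = y := by
    rw [hy, map_smul, map_sum]
    congr 1
    have h1 : ∀ k, κ ((κ ^ k) x) = (κ ^ (k + 1)) x := fun k => by
      rw [pow_succ', AlgEquiv.mul_apply]
    simp only [h1]
    have h2 := Finset.sum_range_succ (fun k => (κ ^ k) x) N
    rw [Finset.sum_range_succ' (fun k => (κ ^ k) x), hκ, pow_zero] at h2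
    exact add_right_cancel h2
  let F : Subalgebra ℂ H := AlgHom.equalizer κ.toAlgHom (AlgHom.id ℂ H)
  let f : F →ₐ[ℂ] (∀ i, Module.End ℂ (Fin (W.d i) → ℂ)) := (AlgHom.pi W.ρ).comp F.val
  have hf : ∀ (z : F) l, f z l = W.ρ l z := fun _ _ => rfl
  have hyF : y ∈ F := hκy
  have hBB : B * B = B := by
    refine LinearMap.ext fun u => ?_
    simp [hB, hφw]
  obtain ⟨e, he, hfe⟩ := exists_isIdempotentElem_eq_of_ker_isNilpotent f.toRingHom
    (fun z hz => by
      have hzJ : (z : H) ∈ W.J := W.mem_J.2 fun l => by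
        rw [← hf]; exact congrFun ((RingHom.mem_ker).1 hz) l
      obtain ⟨m, hm⟩ := W.isNilpotent_of_mem hzJ
      exact ⟨m, Subtype.ext (by simpa using hm)⟩)
    (f ⟨y, hyF⟩) ⟨_, rfl⟩ (by
      have h1 : ∀ l, W.ρ l y * W.ρ l y = W.ρ l y := fun l => by
        by_cases hl : l = i
        · subst hl; rw [hyi, hBB]
        · rw [hyj l hl, mul_zero]
      exact funext h1)
  have hfe' : ∀ l, W.ρ l e = W.ρ l y := fun l => congrFun hfe l
  exact ⟨e, e.2, congrArg Subtype.val he, fun l hl => by rw [hfe', hyj l hl], φ, w, hφw,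
    by rw [hfe', hyi]⟩

variable [Module.Finite ℂ H]

lemma tr_eq_zero_of_mem (κ : H ≃ₐ[ℂ] H) {x : H} (hx : x ∈ W.J) : tr (fun y => κ y * x) = 0 := by
  have hl : Lin (fun y => κ y * x) := by fun_prop
  rw [tr_eq hl]
  refine IsNilpotent.eq_zero (LinearMap.isNilpotent_trace_of_isNilpotent ?_)
  obtain ⟨N, hN⟩ := W.nil
  have key : ∀ k y, (hl.lm ^ (k + 1)) y ∈ W.J ^ (k + 1) := by
    intro k
    have hmap : ∀ k, ∀ z ∈ W.J ^ k, κ z ∈ W.J ^ k := by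
      intro k z hz
      have h1 : (W.J ^ k).map κ.toAlgHom.toLinearMap ≤ W.J ^ k := by
        rw [Submodule.map_pow]
        refine pow_le_pow_left' ?_ k
        rw [Submodule.map_le_iff_le_comap]
        exact fun z hz => W.map_mem_J κ hz
      exact h1 ⟨z, hz, rfl⟩
    induction k with
    | zero =>
      intro y
      simp only [zero_add, pow_one]
      exact W.mul_mem_J hx
    | succ k ih =>
      intro y
      rw [pow_succ' hl.lm, Module.End.mul_apply, pow_succ W.J]
      exact Submodule.mul_mem_mul (hmap _ _ (ih y)) hx
  refine ⟨N + 1, LinearMap.ext fun y => ?_⟩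
  have h1 := key N y
  rw [pow_succ, J, hN, Submodule.bot_mul] at h1
  exact h1

lemma tr_twist_mul (κ : H ≃ₐ[ℂ] H) (x y : H) :
    tr (fun h => κ h * (x * y)) = tr (fun h => κ h * (κ y * x)) := by
  have := tr_comm (f := fun h => κ h * x) (g := fun h => h * y) (by fun_prop) (by fun_prop)
  simpa [mul_assoc] using this

/-- The twisted regular character is a combination of twisted simple characters. -/
theorem exists_coeff {κ : H ≃ₐ[ℂ] H} (Ω : ∀ i, Module.End ℂ (Fin (W.d i) → ℂ))
    (hΩ : ∀ i, W.act κ i = i → Ω i ^ 2 = 1 ∧ ∀ x, Ω i * W.ρ i x = W.ρ i (κ x) * Ω i) :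
    ∃ c : Fin W.n → ℂ, (∀ i, W.act κ i ≠ i → c i = 0) ∧
      ∀ x, tr (fun y => κ y * x) = ∑ i, c i * LinearMap.trace ℂ _ (Ω i * W.ρ i x) := by
  classical
  let τ : H →ₗ[ℂ] ℂ := LinearMap.trace ℂ H ∘ₗ LinearMap.lcomp ℂ H κ.toLinearMap ∘ₗ
    (LinearMap.mul ℂ H).flip
  have hτ : ∀ x, τ x = tr (fun y => κ y * x) := fun x => by
    rw [tr_eq (show Lin fun y => κ y * x by fun_prop)]; rfl
  have hτJ : ∀ x y, x - y ∈ W.J → τ x = τ y := fun x y hxy => by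
    rw [← sub_eq_zero, ← map_sub, hτ]; exact W.tr_eq_zero_of_mem κ hxy
  have hττ : ∀ x y, τ (x * y) = τ (κ y * x) := fun x y => by rw [hτ, hτ]; exact tr_twist_mul κ x y
  let ρ' : H →ₗ[ℂ] (∀ i, Module.End ℂ (Fin (W.d i) → ℂ)) := LinearMap.pi fun i => (W.ρ i).toLinearMap
  obtain ⟨s, hs⟩ := LinearMap.exists_rightInverse_of_surjective ρ' (LinearMap.range_eq_top.2
    fun A => (W.surj A).imp fun x hx => funext hx)
  have hs' : ∀ A i, W.ρ i (s A) = A i := fun A i => congrFun (LinearMap.congr_fun hs A) i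
  let f : ∀ i, Module.End ℂ (Fin (W.d i) → ℂ) →ₗ[ℂ] ℂ := fun i => τ ∘ₗ s ∘ₗ LinearMap.single ℂ
    (fun i => Module.End ℂ (Fin (W.d i) → ℂ)) i
  have hf : ∀ i A, f i A = τ (s (Pi.single i A)) := fun _ _ => rfl
  have hfτ : ∀ i x, (∀ j, j ≠ i → W.ρ j x = 0) → τ x = f i (W.ρ i x) := by
    intro i x hx
    rw [hf]
    apply hτJ
    rw [mem_J]
    intro j
    rw [map_sub, hs']
    by_cases hj : j = i
    · subst hj; simp
    · simp [hj, hx j hj]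
  have hsum : ∀ x, τ x = ∑ i, f i (W.ρ i x) := by
    intro x
    simp only [hf, ← map_sum]
    apply hτJ
    rw [mem_J]
    intro j
    rw [map_sub, hs', Finset.sum_apply, Finset.sum_eq_single j]
    · simp
    · intro i _ hij; simp [hij.symm]
    · simp
  have hmul : ∀ i A x, f i (A * W.ρ i x) = f i (W.ρ i (κ x) * A) := by
    intro i A x
    have e1 : f i (A * W.ρ i x) = τ (s (Pi.single i A) * x) := by
      rw [hfτ i]
      · rw [map_mul (W.ρ i), hs']; simp
      · intro j hj; rw [map_mul, hs']; simp [hj]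
    have e2 : f i (W.ρ i (κ x) * A) = τ (κ x * s (Pi.single i A)) := by
      rw [hfτ i]
      · rw [map_mul (W.ρ i), hs']; simp
      · intro j hj; rw [map_mul, hs']; simp [hj]
    rw [e1, e2, hττ]
  have hc : ∀ i, ∃ c : ℂ, (W.act κ i ≠ i → c = 0) ∧ ∀ A, f i A = c * LinearMap.trace ℂ _ (Ω i * A) := by
    intro i
    by_cases hi : W.act κ i = i
    · obtain ⟨h1, h2⟩ := hΩ i hi
      rw [pow_two] at h1
      obtain ⟨c, hc⟩ := exists_eq_mul_trace (f i ∘ₗ LinearMap.mulLeft ℂ (Ω i)) (fun A B => by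
        obtain ⟨x, rfl⟩ := W.surj_ρ i B
        simp only [LinearMap.comp_apply, LinearMap.mulLeft_apply]
        rw [← mul_assoc, hmul, ← mul_assoc, ← h2, mul_assoc])
      refine ⟨c, fun h => absurd hi h, fun A => ?_⟩
      have := hc (Ω i * A)
      simp only [LinearMap.comp_apply, LinearMap.mulLeft_apply] at this
      rw [← mul_assoc, h1, one_mul] at this
      exact this
    · refine ⟨0, fun _ => rfl, fun A => ?_⟩
      obtain ⟨x, hx, hx'⟩ := W.exists_lift_single i 1
      have := hmul i A x
      rw [hx, mul_one] at this
      rw [this]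
      obtain ⟨l, hl⟩ : ∃ l, W.act κ l = i := ⟨W.act κ⁻¹ i, by rw [← act_inv_eq_iff]⟩
      have hli : l ≠ i := by rintro rfl; exact hi hl
      have h0 : W.ρ i (κ x) = 0 := by
        exact ((W.act_eq_iff.1 hl).ρ_eq_zero (x := x)).2 (hx' l hli)
      rw [h0]; simp
  choose c hc0 hc using hc
  exact ⟨c, hc0, fun x => by rw [← hτ, hsum]; exact Finset.sum_congr rfl fun i _ => hc i _⟩

lemma tr_mul_eq_finrank {e : H} (he : IsIdempotentElem e) :
    tr (fun y => y * e) = Module.finrank ℂ (LinearMap.range (LinearMap.mulRight ℂ e)) := by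
  rw [← trace_idem, ← tr_linearMap]
  · rfl
  · refine LinearMap.ext fun y => ?_
    simp [mul_assoc, he.eq]

/-- The regular character is a natural combination of simple characters. -/
lemma exists_dims : ∃ p : Fin W.n → ℕ, ∀ x, tr (fun y => y * x) =
    ∑ i, p i * LinearMap.trace ℂ _ (W.ρ i x) := by
  obtain ⟨c, -, hc⟩ := W.exists_coeff (κ := 1) (fun _ => 1) (fun i _ => ⟨one_pow 2, fun x => by simp⟩)
  simp only [one_mul, AlgEquiv.one_apply] at hc
  have : ∀ i, ∃ p : ℕ, c i = p := by
    intro i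
    obtain ⟨e, -, he, hj, φ, w, hφ, hw⟩ := W.exists_fixed_lift (κ := 1) one_pos (one_pow 1) (W.act_one i)
    refine ⟨Module.finrank ℂ (LinearMap.range (LinearMap.mulRight ℂ e)), ?_⟩
    · rw [← tr_mul_eq_finrank he, hc, Finset.sum_eq_single i]
      · rw [hw, LinearMap.trace_smulRight, hφ, mul_one]
      · intro j _ hij; rw [hj j hij]; simp
      · simp
  choose p hp using this
  exact ⟨p, fun x => by rw [hc]; simp only [hp]⟩

/-- The dimension of the projective cover of the `i`-th simple module. -/
noncomputable def p (i : Fin W.n) : ℕ := W.exists_dims.choose i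

lemma tr_mul_eq (x : H) : tr (fun y => y * x) = ∑ i, W.p i * LinearMap.trace ℂ _ (W.ρ i x) :=
  W.exists_dims.choose_spec x

lemma tr_mul_eq_p {e : H} {i : Fin W.n} (hj : ∀ j, j ≠ i → W.ρ j e = 0)
    (hi : LinearMap.trace ℂ _ (W.ρ i e) = 1) : tr (fun y => y * e) = W.p i := by
  rw [tr_mul_eq, Finset.sum_eq_single i]
  · rw [hi, mul_one]
  · intro j _ hij; rw [hj j hij]; simp
  · simp

lemma sum_d_mul_p : ∑ i, W.d i * W.p i = Module.finrank ℂ H := by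
  have := W.tr_mul_eq 1
  simp only [mul_one, map_one, LinearMap.trace_one] at this
  rw [tr_id_eq] at this
  simp only [Module.finrank_fin_fun] at this
  rw [← Nat.cast_inj (R := ℂ), this]
  push_cast
  exact Finset.sum_congr rfl fun i _ => mul_comm _ _

lemma d_le_p (i : Fin W.n) : W.d i ≤ W.p i := by
  obtain ⟨e, -, he, hj, φ, w, hφ, hw⟩ := W.exists_fixed_lift (κ := 1) one_pos (one_pow 1) (W.act_one i)
  have h1 := tr_mul_eq_finrank he
  rw [W.tr_mul_eq_p hj (by rw [hw, LinearMap.trace_smulRight, hφ]), Nat.cast_inj] at h1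
  rw [h1]
  let F : LinearMap.range (LinearMap.mulRight ℂ e) →ₗ[ℂ] (Fin (W.d i) → ℂ) :=
    (LinearMap.applyₗ w ∘ₗ (W.ρ i).toLinearMap) ∘ₗ Submodule.subtype _
  have hF : Function.Surjective F := fun v => by
    obtain ⟨x, hx⟩ := W.surj_ρ i (φ.smulRight v)
    refine ⟨⟨x * e, x, rfl⟩, ?_⟩
    change W.ρ i (x * e) w = v
    rw [map_mul, hx, hw]
    simp [hφ]
  simpa using LinearMap.finrank_le_finrank_of_surjective hF

lemma p_pos (i : Fin W.n) : 0 < W.p i := (W.pos i).trans_le (W.d_le_p i)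

lemma tr_map (κ : H ≃ₐ[ℂ] H) (e : H) : tr (fun y => y * κ e) = tr (fun y => y * e) :=
  tr_conj κ.toLinearEquiv (by fun_prop) fun x => by simp

variable {W} in
lemma Iso.p_eq {κ : H ≃ₐ[ℂ] H} {i j : Fin W.n} (h : W.Iso κ i j) : W.p i = W.p j := by
  obtain ⟨e, -, he, hj, φ, w, hφ, hw⟩ := W.exists_fixed_lift (κ := 1) one_pos (one_pow 1) (W.act_one i)
  have h1 := W.tr_mul_eq_p hj (by rw [hw, LinearMap.trace_smulRight, hφ])
  have h2 : tr (fun y => y * κ e) = W.p j := by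
    refine W.tr_mul_eq_p (fun k hk => ?_) ?_
    · have h3 := W.iso_act κ⁻¹ k
      rw [(by simpa using h3.inv : W.Iso κ _ k).ρ_eq_zero]
      refine hj _ fun h4 => hk ?_
      rw [act_inv_eq_iff] at h4
      rw [← h4, h.act_eq]
    · obtain ⟨T, hT⟩ := h
      have : W.ρ j (κ e) = T.conj (W.ρ i e) := LinearMap.ext fun v => by
        rw [LinearEquiv.conj_apply_apply, hT]; simp
      rw [this, LinearMap.trace_conj', hw, LinearMap.trace_smulRight, hφ]
  rw [tr_map, h1] at h2
  exact_mod_cast h2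

lemma d_act (κ : H ≃ₐ[ℂ] H) (i : Fin W.n) : W.d (W.act κ i) = W.d i := (W.iso_act κ i).d_eq.symm

lemma p_act (κ : H ≃ₐ[ℂ] H) (i : Fin W.n) : W.p (W.act κ i) = W.p i := (W.iso_act κ i).p_eq.symm

section Characters

open Coalgebra HopfAlgebra

variable {H : Type*} [Ring H] [HopfAlgebra ℂ H] (W : SimpleList H)

lemma exists_char (χ : H →ₐ[ℂ] ℂ) : ∃ i, W.d i = 1 ∧ ∀ x v, W.ρ i x v = χ x • v := by
  have hsurj : Function.Surjective ((Algebra.ofId ℂ (Module.End ℂ ℂ)).comp χ) := fun A =>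
    ⟨algebraMap ℂ H (A 1), LinearMap.ext_ring (by simp)⟩
  obtain ⟨i, T, hT⟩ := W.exists_equiv ((Algebra.ofId ℂ (Module.End ℂ ℂ)).comp χ) hsurj
  refine ⟨i, by simpa using T.finrank_eq, fun x v => T.injective ?_⟩
  rw [hT, map_smul]
  simp [Algebra.ofId_apply, Module.algebraMap_end_apply]

/-- The index of the trivial module. -/
noncomputable def triv : Fin W.n := (W.exists_char (Bialgebra.counitAlgHom ℂ H)).choose

lemma d_triv : W.d W.triv = 1 := (W.exists_char (Bialgebra.counitAlgHom ℂ H)).choose_spec.1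

lemma ρ_triv (x : H) (v : Fin (W.d W.triv) → ℂ) : W.ρ W.triv x v = counit (R := ℂ) x • v :=
  (W.exists_char (Bialgebra.counitAlgHom ℂ H)).choose_spec.2 x v

lemma trace_ρ_triv (x : H) : LinearMap.trace ℂ _ (W.ρ W.triv x) = counit (R := ℂ) x := by
  have : W.ρ W.triv x = counit (R := ℂ) x • 1 := LinearMap.ext fun v => W.ρ_triv x v
  rw [this, map_smul, LinearMap.trace_one, Module.finrank_fin_fun, d_triv]; simp

lemma exists_char_of_d_eq_one {i : Fin W.n} (h : W.d i = 1) :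
    ∃ χ : H →ₐ[ℂ] ℂ, ∀ x v, W.ρ i x v = χ x • v := by
  have h1 : Module.finrank ℂ (Fin (W.d i) → ℂ) = 1 := by simpa using h
  obtain ⟨w, hw, hs⟩ := finrank_eq_one_iff'.1 h1
  have key : ∀ A : Module.End ℂ (Fin (W.d i) → ℂ), A = LinearMap.trace ℂ _ A • 1 := by
    intro A
    obtain ⟨c, hc⟩ := hs (A w)
    have hA : A = c • 1 := LinearMap.ext fun v => by
      obtain ⟨b, rfl⟩ := hs v
      rw [map_smul, ← hc]
      simp [smul_smul, mul_comm]
    conv_rhs => rw [hA, map_smul, LinearMap.trace_one, h1]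
    rw [hA]; simp
  have h2 : LinearMap.trace ℂ _ (1 : Module.End ℂ (Fin (W.d i) → ℂ)) = 1 := by
    rw [LinearMap.trace_one, h1]; simp
  refine ⟨AlgHom.ofLinearMap (LinearMap.trace ℂ _ ∘ₗ (W.ρ i).toLinearMap) ?_ fun x y => ?_,
    fun x v => ?_⟩
  · simp [h]
  · change LinearMap.trace ℂ _ (W.ρ i (x * y)) =
      LinearMap.trace ℂ _ (W.ρ i x) * LinearMap.trace ℂ _ (W.ρ i y)
    rw [map_mul]
    conv_lhs => rw [key (W.ρ i x)]
    rw [smul_mul_assoc, one_mul, map_smul, smul_eq_mul]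
  · exact LinearMap.congr_fun (key (W.ρ i x)) v

lemma iso_triv {i : Fin W.n} {χ : H →ₐ[ℂ] ℂ} (h : W.d i = 1) (hχ : ∀ x v, W.ρ i x v = χ x • v)
    {κ : H ≃ₐ[ℂ] H} (hκ : ∀ x, χ (κ x) = counit (R := ℂ) x) : W.Iso κ W.triv i := by
  refine ⟨LinearEquiv.ofFinrankEq _ _ (by simp [h, d_triv]), fun x v => ?_⟩
  rw [ρ_triv, hχ, hκ, map_smul]

lemma act_triv {κ : H ≃ₐ[ℂ] H} (hκ : ∀ x, counit (R := ℂ) (κ x) = counit (R := ℂ) x) :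
    W.act κ W.triv = W.triv :=
  (W.iso_triv (χ := Bialgebra.counitAlgHom ℂ H) W.d_triv W.ρ_triv hκ).act_eq

lemma act_adE {g : H} (hg : IsGroupLikeElem ℂ g) (i : Fin W.n) : W.act (adE hg) i = i := by
  have hSg : S g * g = 1 := by
    have := sw_S_mul (fun x => x) (by fun_prop) g
    have h2 := hg.counit_eq_one
    rw [sw_eq_bil _ (by fun_prop) (by fun_prop), hg.comul_eq_tmul_self, bil_tmul, h2, one_smul] at this
    exact this
  have hgS : g * S g = 1 := by
    have := sw_mul_S (fun x => x) (by fun_prop) g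
    have h2 := hg.counit_eq_one
    rw [sw_eq_bil _ (by fun_prop) (by fun_prop), hg.comul_eq_tmul_self, bil_tmul, h2, one_smul] at this
    exact this
  refine Iso.act_eq ⟨LinearEquiv.ofLinearMap (W.ρ i g) (W.ρ i (S g)) ?_ ?_, fun x v => ?_⟩
  · change W.ρ i g * W.ρ i (S g) = 1
    rw [← map_mul, hgS, map_one]
  · change W.ρ i (S g) * W.ρ i g = 1
    rw [← map_mul, hSg, map_one]
  · change (W.ρ i g * W.ρ i x) v = (W.ρ i (g * x * S g) * W.ρ i g) v
    rw [← map_mul, ← map_mul, mul_assoc, hSg, mul_one]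

variable [Module.Finite ℂ H]

lemma p_eq_of_d_eq_one {i : Fin W.n} (h : W.d i = 1) : W.p i = W.p W.triv := by
  obtain ⟨χ, hχ⟩ := W.exists_char_of_d_eq_one h
  refine ((W.iso_triv h hχ (κ := (ltE χ)⁻¹) fun x => ?_).p_eq).symm
  rw [← counit_lt χ, ← ltE_apply, ← AlgEquiv.mul_apply, mul_inv_cancel]; rfl

/-- The dimension of the projective cover of the trivial module. -/
theorem finrank_projective_cover [Module H ℂ]
    (hTriv : ∀ (x : H) (c : ℂ), x • c = counit (R := ℂ) x * c) {P : Type*} [AddCommGroup P]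
    [Module ℂ P] [Module H P] [IsScalarTower ℂ H P] (hP : Module.Projective H P) (π : P →ₗ[H] ℂ)
    (hπ : Function.Surjective π)
    (hsup : ∀ N : Submodule H P, N ⊔ LinearMap.ker π = ⊤ → N = ⊤) :
    Module.finrank ℂ P = W.p W.triv := by
  obtain ⟨e, -, he, hj, φ, w, hφ, hw⟩ :=
    W.exists_fixed_lift (κ := 1) one_pos (one_pow 1) (W.act_one W.triv)
  have htre : LinearMap.trace ℂ _ (W.ρ W.triv e) = 1 := by rw [hw, LinearMap.trace_smulRight, hφ]
  have hεe : counit (R := ℂ) e = 1 := by rw [← trace_ρ_triv, htre]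
  have hp := W.tr_mul_eq_p hj htre
  obtain ⟨m, hm⟩ := hπ 1
  set m' := e • m with hm'
  have hπm : π m' = 1 := by rw [hm', map_smul, hm, hTriv, hεe, one_mul]
  have hem : e • m' = m' := by rw [hm', smul_smul, he.eq]
  let f : H →ₗ[H] P := LinearMap.toSpanSingleton H P m'
  have hf : ∀ x, f x = x • m' := fun _ => rfl
  have hfs : Function.Surjective f := by
    rw [← LinearMap.range_eq_top]
    apply hsup
    rw [eq_top_iff]
    intro x _
    have h1 : x = f (algebraMap ℂ H (π x)) + (x - f (algebraMap ℂ H (π x))) := by abel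
    rw [h1]
    refine Submodule.add_mem_sup ⟨_, rfl⟩ ?_
    rw [LinearMap.mem_ker, map_sub, hf, map_smul, hπm, hTriv]
    simp
  obtain ⟨s, hs⟩ := Module.projective_lifting_property f LinearMap.id hfs
  have hs' : ∀ x, f (s x) = x := fun x => LinearMap.congr_fun hs x
  set u₀ := s m' with hu₀
  have heu : e * u₀ = u₀ := by rw [hu₀, ← smul_eq_mul, ← map_smul, hem]
  have hum : u₀ • m' = m' := by rw [← hf, hs']
  have huu : u₀ * u₀ = u₀ := by
    conv_lhs => rw [hu₀, ← smul_eq_mul, ← map_smul, ← hu₀, hum]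
  have hεu : counit (R := ℂ) u₀ = 1 := by
    have := congrArg π hum
    rwa [map_smul, hπm, hTriv, mul_one] at this
  have heq : e = u₀ * e := by
    have hJ : e - u₀ * e ∈ W.J := by
      rw [mem_J]
      intro j
      by_cases hjt : j = W.triv
      · subst hjt
        refine LinearMap.ext fun v => ?_
        rw [map_sub, LinearMap.sub_apply, ρ_triv, ρ_triv, Bialgebra.counit_mul, hεu, hεe]; simp
      · rw [map_sub, map_mul, hj j hjt]; simp
    obtain ⟨N, hN⟩ := W.isNilpotent_of_mem hJ
    have hid : IsIdempotentElem (e - u₀ * e) := by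
      have e1 : u₀ * e * e = u₀ * e := by rw [mul_assoc, he.eq]
      have e2 : e * (u₀ * e) = u₀ * e := by rw [← mul_assoc, heu]
      have e3 : u₀ * e * (u₀ * e) = u₀ * e := by
        rw [mul_assoc, e2, ← mul_assoc, huu]
      rw [IsIdempotentElem, sub_mul, mul_sub, mul_sub, e1, e2, e3, he.eq]; abel
    have : e - u₀ * e = 0 := by
      rw [← hid.pow_succ_eq N, pow_succ, hN, zero_mul]
    exact sub_eq_zero.1 this
  have hsinj : Function.Injective (s.restrictScalars ℂ) := fun x y hxy => by
    rw [← hs' x, ← hs' y]; exact congrArg f hxy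
  have hrange : LinearMap.range (s.restrictScalars ℂ) =
      LinearMap.range (LinearMap.mulRight ℂ u₀) := by
    ext x
    constructor
    · rintro ⟨y, rfl⟩
      obtain ⟨h, rfl⟩ := hfs y
      refine ⟨h, ?_⟩
      change h * u₀ = s (f h)
      rw [hf, map_smul, smul_eq_mul]
    · rintro ⟨h, rfl⟩
      refine ⟨h • m', ?_⟩
      change s (h • m') = h * u₀
      rw [map_smul, smul_eq_mul]
  have h1 := tr_mul_eq_finrank huu
  rw [← hrange, LinearMap.finrank_range_of_inj hsinj] at h1
  rw [← Nat.cast_inj (R := ℂ), ← h1, ← hp]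
  have h2 := tr_twist_mul 1 u₀ e
  simp only [AlgEquiv.one_apply] at h2
  rw [heu, ← heq] at h2
  exact h2.symm

end Characters

section Coefficients

variable {H : Type*} [Ring H] [Algebra ℂ H] [Module.Finite ℂ H] (W : SimpleList H)

/-- Intertwiners for the simple modules fixed by `ω`, together with the coefficients of the twisted
regular character. -/
structure Twist (ω : H ≃ₐ[ℂ] H) where
  Ω : ∀ i, Module.End ℂ (Fin (W.d i) → ℂ)
  c : Fin W.n → ℂ
  sq : ∀ i, W.act ω i = i → Ω i ^ 2 = 1
  comm : ∀ i, W.act ω i = i → ∀ x, Ω i * W.ρ i x = W.ρ i (ω x) * Ω i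
  c_eq : ∀ i, W.act ω i ≠ i → c i = 0
  tr_eq : ∀ x, tr (fun y => ω y * x) = ∑ i, c i * LinearMap.trace ℂ _ (Ω i * W.ρ i x)

lemma nonempty_twist {ω : H ≃ₐ[ℂ] H} (hω : ω ^ 2 = 1) : Nonempty (W.Twist ω) := by
  have : ∀ i, ∃ T : Module.End ℂ (Fin (W.d i) → ℂ), W.act ω i = i → T ^ 2 = 1 ∧
      ∀ x, T * W.ρ i x = W.ρ i (ω x) * T := by
    intro i
    by_cases hi : W.act ω i = i
    · obtain ⟨T, h1, h2⟩ := W.exists_intertwiner two_pos hω hi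
      exact ⟨T, fun _ => ⟨h1, h2⟩⟩
    · exact ⟨0, fun h => absurd h hi⟩
  choose Ω hΩ using this
  obtain ⟨c, hc, hc'⟩ := W.exists_coeff Ω hΩ
  exact ⟨⟨Ω, c, fun i hi => (hΩ i hi).1, fun i hi => (hΩ i hi).2, hc, hc'⟩⟩

variable {W}

lemma Twist.tr_eq_zero_iff {ω : H ≃ₐ[ℂ] H} (t : W.Twist ω) {i : Fin W.n} (hi : W.act ω i = i) {e : H}
    (he : ω e = e) (hj : ∀ j, j ≠ i → W.ρ j e = 0) {φ : Module.Dual ℂ (Fin (W.d i) → ℂ)}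
    {w : Fin (W.d i) → ℂ} (hφ : φ w = 1) (hw : W.ρ i e = φ.smulRight w) :
    tr (fun y => ω y * e) = 0 ↔ t.c i = 0 := by
  have h1 := t.tr_eq e
  rw [Finset.sum_eq_single i] at h1
  · rw [h1, mul_eq_zero, or_iff_left]
    intro h0
    have h2 : t.Ω i * φ.smulRight w = φ.smulRight (t.Ω i w) := LinearMap.ext fun v => by simp
    have h3 := t.comm i hi e
    rw [he, hw, h2] at h3
    rw [hw, h2, LinearMap.trace_smulRight] at h0
    have h4 := LinearMap.congr_fun h3 w
    simp only [LinearMap.smulRight_apply, hφ, Module.End.mul_apply, h0, one_smul, zero_smul] at h4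
    have h5 := LinearMap.congr_fun (t.sq i hi) w
    rw [pow_two, Module.End.mul_apply, h4, map_zero] at h5
    have h6 : w = 0 := h5.symm
    rw [h6, map_zero] at hφ
    exact zero_ne_one hφ
  · intro j _ hij; rw [hj j hij]; simp
  · simp

lemma exists_int_tr {κ : H ≃ₐ[ℂ] H} {n : ℕ} (hn : n.Prime) (ho : Odd n) (hκ : κ ^ (2 * n) = 1)
    (hz : ∀ x, tr (fun y => κ y * x) = 0) {e : H} (he : κ e = e) (hei : IsIdempotentElem e) {r : ℕ}
    (hr : tr (fun y => y * e) = r) :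
    ∃ d : ℤ, tr (fun y => (κ ^ n) y * e) = ((n * d : ℤ) : ℂ) ∧ |(n : ℤ) * d| ≤ r ∧
      Even ((r : ℤ) - n * d) := by
  have hφ : (κ.toLinearMap : Module.End ℂ H) ^ (2 * n) = 1 := by
    rw [← toLinearMap_pow, hκ]; rfl
  have hR : IsIdempotentElem (LinearMap.mulRight ℂ e : Module.End ℂ H) :=
    LinearMap.ext fun y => by simp [mul_assoc, hei.eq]
  have hc : Commute (κ.toLinearMap : Module.End ℂ H) (LinearMap.mulRight ℂ e) :=
    LinearMap.ext fun y => by simp [he]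
  have key : ∀ μ : H ≃ₐ[ℂ] H, μ e = e → tr (fun y => μ y * e) =
      LinearMap.trace ℂ H ((μ.toLinearMap : Module.End ℂ H) * LinearMap.mulRight ℂ e) := by
    intro μ hμ
    rw [← tr_linearMap]
    congr 1
    funext y
    simp [hμ]
  obtain ⟨d, h1, h2, h3⟩ := exists_int_trace hn ho hφ hR hc (by rw [← key κ he, hz])
    (r := r) (by rw [← hr, ← tr_linearMap]; rfl)
  have hen : ∀ k, (κ ^ k) e = e := fun k => by
    induction k with
    | zero => rfl
    | succ k ih => rw [pow_succ, AlgEquiv.mul_apply, he, ih]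
  refine ⟨d, ?_, h2, h3⟩
  rw [key _ (hen n), toLinearMap_pow, h1]
  push_cast; ring

lemma tr_eq_zero_of_small {κ : H ≃ₐ[ℂ] H} {n : ℕ} (hn : n.Prime) (ho : Odd n) (hκ : κ ^ (2 * n) = 1)
    (hz : ∀ x, tr (fun y => κ y * x) = 0) {e : H} (he : κ e = e) (hei : IsIdempotentElem e) {r : ℕ}
    (hr : tr (fun y => y * e) = r) (hs : r < n ∨ Even r ∧ r < 2 * n) :
    tr (fun y => (κ ^ n) y * e) = 0 := by
  obtain ⟨d, h1, h2, h3⟩ := exists_int_tr hn ho hκ hz he hei hr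
  have hn0 : (0 : ℤ) < n := by exact_mod_cast hn.pos
  have hd : d = 0 := by
    rw [abs_mul, abs_of_pos hn0] at h2
    rcases hs with hs | ⟨hev, hs⟩
    · have : |d| < 1 := by
        by_contra! hc
        have : (r : ℤ) < n := by exact_mod_cast hs
        nlinarith
      exact Int.abs_lt_one_iff.1 this
    · have h4 : Even d := by
        have h5 : Even ((n : ℤ) * d) := by
          have : Even ((r : ℤ) - ((r : ℤ) - n * d)) := ((Int.even_coe_nat r).2 hev).sub h3
          simpa using this
        rcases Int.even_mul.1 h5 with h6 | h6
        · exact absurd ((Int.even_coe_nat n).1 h6) (Nat.not_even_iff_odd.2 ho)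
        · exact h6
      have : |d| < 2 := by
        by_contra! hc
        have : (r : ℤ) < 2 * n := by exact_mod_cast hs
        nlinarith
      obtain ⟨m, hm⟩ := h4
      rw [abs_lt] at this
      omega
  rw [h1, hd]; simp

lemma Twist.c_eq_zero {ω : H ≃ₐ[ℂ] H} (t : W.Twist ω) {κ : H ≃ₐ[ℂ] H} {n : ℕ} (hω : κ ^ n = ω)
    (hn : n.Prime) (ho : Odd n)
    (hκ : κ ^ (2 * n) = 1) (hz : ∀ x, tr (fun y => κ y * x) = 0) {i : Fin W.n}
    (hi : W.act κ i = i) (hs : W.p i < n ∨ Even (W.p i) ∧ W.p i < 2 * n) : t.c i = 0 := by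
  obtain ⟨e, he, hei, hj, φ, w, hφ, hw⟩ :=
    W.exists_fixed_lift (Nat.mul_pos two_pos hn.pos) hκ hi
  subst hω
  have hen : ∀ k, (κ ^ k) e = e := fun k => by
    induction k with
    | zero => rfl
    | succ k ih => rw [pow_succ, AlgEquiv.mul_apply, he, ih]
  rw [← t.tr_eq_zero_iff (W.act_pow_eq hi n) (hen n) hj hφ hw]
  exact tr_eq_zero_of_small hn ho hκ hz he hei
    (W.tr_mul_eq_p hj (by rw [hw, LinearMap.trace_smulRight, hφ])) hs

lemma Twist.c_ne_zero {ω : H ≃ₐ[ℂ] H} (t : W.Twist ω) {κ : H ≃ₐ[ℂ] H} {n : ℕ} (hω : κ ^ n = ω)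
    (hn : n.Prime) (ho : Odd n)
    (hκ : κ ^ (2 * n) = 1) (hz : ∀ x, tr (fun y => κ y * x) = 0) {i : Fin W.n}
    (hi : W.act κ i = i) (hs : Odd (W.p i)) : t.c i ≠ 0 := by
  obtain ⟨e, he, hei, hj, φ, w, hφ, hw⟩ :=
    W.exists_fixed_lift (Nat.mul_pos two_pos hn.pos) hκ hi
  subst hω
  have hen : ∀ k, (κ ^ k) e = e := fun k => by
    induction k with
    | zero => rfl
    | succ k ih => rw [pow_succ, AlgEquiv.mul_apply, he, ih]
  rw [Ne, ← t.tr_eq_zero_iff (W.act_pow_eq hi n) (hen n) hj hφ hw]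
  intro h0
  obtain ⟨d, h1, h2, h3⟩ := exists_int_tr hn ho hκ hz he hei
    (W.tr_mul_eq_p hj (by rw [hw, LinearMap.trace_smulRight, hφ]))
  rw [h0] at h1
  have h4 : (n * d : ℤ) = 0 := by exact_mod_cast h1.symm
  rw [h4, sub_zero, Int.even_coe_nat] at h3
  exact (Nat.not_even_iff_odd.2 hs) h3

lemma le_p_of_odd {κ : H ≃ₐ[ℂ] H} {n : ℕ} (hn : n.Prime) (ho : Odd n)
    (hκ : κ ^ (2 * n) = 1) (hz : ∀ x, tr (fun y => κ y * x) = 0) {i : Fin W.n}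
    (hi : W.act κ i = i) (hs : Odd (W.p i)) : n ≤ W.p i := by
  by_contra! hlt
  have hω : (κ ^ n) ^ 2 = 1 := by rw [← pow_mul, mul_comm, hκ]
  obtain ⟨t⟩ := W.nonempty_twist hω
  exact t.c_ne_zero rfl hn ho hκ hz hi hs (t.c_eq_zero rfl hn ho hκ hz hi (Or.inl hlt))

end Coefficients

end SimpleList

section Averaging

open Coalgebra HopfAlgebra

variable {V V' : Type*} [AddCommGroup V] [Module ℂ V] [AddCommGroup V'] [Module ℂ V']

@[fun_prop]
lemma lin_lcomp {M : Type*} [AddCommGroup M] [Module ℂ M] {f : M → V →ₗ[ℂ] V'} (hf : Lin f)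
    (X : V' →ₗ[ℂ] V') (Y : V →ₗ[ℂ] V) : Lin (fun A => X ∘ₗ f A ∘ₗ Y) := by
  refine ⟨fun A B => ?_, fun c A => ?_⟩
  · rw [hf.map_add, LinearMap.add_comp, LinearMap.comp_add]
  · rw [hf.map_smul, LinearMap.smul_comp, LinearMap.comp_smul]

@[fun_prop]
lemma lin_lcomp_left {M : Type*} [AddCommGroup M] [Module ℂ M] {f : M → V' →ₗ[ℂ] V'} (hf : Lin f)
    (A : V →ₗ[ℂ] V') : Lin (fun X => f X ∘ₗ A) := by
  refine ⟨fun A B => ?_, fun c A => ?_⟩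
  · rw [hf.map_add, LinearMap.add_comp]
  · rw [hf.map_smul, LinearMap.smul_comp]

lemma tr_lcomp [Module.Finite ℂ V] [Module.Finite ℂ V'] (X : V' →ₗ[ℂ] V') (Y : V →ₗ[ℂ] V) :
    tr (fun A : V →ₗ[ℂ] V' => X ∘ₗ A ∘ₗ Y) = LinearMap.trace ℂ _ X * LinearMap.trace ℂ _ Y := by
  rw [← LinearMap.trace_transpose' Y, mul_comm, ← LinearMap.trace_tensorProduct', ← tr_linearMap]
  refine tr_conj (dualTensorHomEquiv ℂ V V') (by fun_prop) fun x => ?_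
  refine LinearMap.congr_fun (f := (dualTensorHomEquiv ℂ V V').toLinearMap ∘ₗ
    TensorProduct.map (Module.Dual.transpose Y) X)
    (g := (lin_lcomp (lin_id (M := V →ₗ[ℂ] V')) X Y).lm ∘ₗ (dualTensorHomEquiv ℂ V V').toLinearMap)
    (TensorProduct.ext' fun f w => ?_) x
  ext v
  simp [Module.Dual.transpose_apply]

variable {H : Type*} [Ring H] [HopfAlgebra ℂ H]

/-- The action of `e` on the space of linear maps between two representations. -/
noncomputable def homAct (ρ : H →ₐ[ℂ] Module.End ℂ V) (ρ' : H →ₐ[ℂ] Module.End ℂ V') (e : H)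
    (A : V →ₗ[ℂ] V') : V →ₗ[ℂ] V' := sw (fun a b => ρ' a ∘ₗ A ∘ₗ ρ (S b)) e

@[fun_prop]
lemma lin_homAct (ρ : H →ₐ[ℂ] Module.End ℂ V) (ρ' : H →ₐ[ℂ] Module.End ℂ V') (e : H) :
    Lin (homAct ρ ρ' e) := by
  unfold homAct; fun_prop

variable (ρ : H →ₐ[ℂ] Module.End ℂ V) (ρ' : H →ₐ[ℂ] Module.End ℂ V')

lemma lin_conj_left (A : V →ₗ[ℂ] V') (b : H) : Lin (fun a => ρ' a ∘ₗ A ∘ₗ ρ (S b)) :=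
  lin_lcomp_left (f := fun a => ρ' a) (lin_algHom ρ') _

lemma lin_conj_right (A : V →ₗ[ℂ] V') (a : H) : Lin (fun b => ρ' a ∘ₗ A ∘ₗ ρ (S b)) := by
  refine ⟨fun b c => ?_, fun c b => ?_⟩
  · rw [show S (b + c) = S b + S c from map_add _ _ _, map_add, LinearMap.comp_add,
      LinearMap.comp_add]
  · rw [show S (c • b) = c • S b from map_smul _ _ _, map_smul, LinearMap.comp_smul,
      LinearMap.comp_smul]

lemma homAct_mul (x y : H) (A : V →ₗ[ℂ] V') :
    homAct ρ ρ' (x * y) A = homAct ρ ρ' x (homAct ρ ρ' y A) := by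
  unfold homAct
  rw [sw_mul_arg _ (lin_conj_left ρ ρ' A) (lin_conj_right ρ ρ' A)]
  congr 1; funext a b
  rw [(lin_lcomp (lin_id (M := V →ₗ[ℂ] V')) (ρ' a) (ρ (S b))).sw]
  congr 1; funext c d
  rw [S_mul, map_mul, map_mul]
  rfl

lemma homAct_one (e : H) : homAct ρ ρ e 1 = counit (R := ℂ) e • 1 := by
  unfold homAct
  have := sw_mul_S (fun x => ρ x) (by fun_prop) e
  rw [map_one] at this
  rw [← this]
  congr 1; funext a b
  rw [map_mul]; rfl

lemma homAct_grouplike {g : H} (hg : IsGroupLikeElem ℂ g) (A : V →ₗ[ℂ] V') :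
    homAct ρ ρ' g A = ρ' g ∘ₗ A ∘ₗ ρ (S g) := by
  unfold homAct
  rw [sw_eq_bil _ (lin_conj_left ρ ρ' A) (lin_conj_right ρ ρ' A), hg.comul_eq_tmul_self, bil_tmul]

lemma comp_homAct_eq {g e : H} (hg : IsGroupLikeElem ℂ g) (he : g * e = e) (A : V →ₗ[ℂ] V') :
    ρ' g ∘ₗ homAct ρ ρ' e A = homAct ρ ρ' e A ∘ₗ ρ g := by
  have h1 := homAct_mul ρ ρ' g e A
  rw [he, homAct_grouplike ρ ρ' hg] at h1
  have h2 : ρ (S g) ∘ₗ ρ g = LinearMap.id := by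
    change ρ (S g) * ρ g = _
    rw [← map_mul, hg.antipode_mul_cancel, map_one]; rfl
  conv_rhs => rw [h1]
  rw [LinearMap.comp_assoc, LinearMap.comp_assoc, h2, LinearMap.comp_id]

variable [Module.Finite ℂ H] [Module.Finite ℂ V]

lemma sw_tr_mul_tr {ω : H ≃ₐ[ℂ] H}
    (hω : ∀ (f : H → H → H ⊗[ℂ] V), (∀ b, Lin fun a => f a b) → (∀ a, Lin fun b => f a b) →
      ∀ x, sw f (ω x) = sw (fun a b => f (ω a) (ω b)) x) {Ω : Module.End ℂ V}
    (hΩ : ∀ x, Ω * ρ x = ρ (ω x) * Ω) (e : H) :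
    sw (fun a b => tr (fun x => ω (x * a)) * tr (fun v => Ω (ρ (S b) v))) e =
      tr (fun x => ω (x * e)) * tr (fun v => Ω v) := by
  refine sum_tr_mul_tr ρ _ _ _ _ _ (by fun_prop) (by fun_prop) (by fun_prop) (by fun_prop)
    fun x v => ?_
  have hΩ' : ∀ x v, ρ (ω x) (Ω v) = Ω (ρ x v) := fun x v => (LinearMap.congr_fun (hΩ x) v).symm
  change sw (fun a' b' => sw (fun a b => a ⊗ₜ[ℂ] ρ b (Ω (ρ (S b') v))) (ω (x * a'))) e = _
  have h1 : ∀ a' b', sw (fun a b => a ⊗ₜ[ℂ] ρ b (Ω (ρ (S b') v))) (ω (x * a')) =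
      sw (fun a b => sw (fun c d => ω (a * c) ⊗ₜ[ℂ] Ω (ρ b (ρ (d * S b') v))) a') x := by
    intro a' b'
    rw [hω _ (by fun_prop) (by fun_prop), sw_mul_arg _ (by fun_prop) (by fun_prop)]
    simp only [hΩ', map_mul ρ, Module.End.mul_apply]
  simp only [h1]
  rw [sw_comm (fun a' b' a b => sw (fun c d => ω (a * c) ⊗ₜ[ℂ] Ω (ρ b (ρ (d * S b') v))) a')]
  congr 1; funext a b
  rw [sw_assoc (fun c d b' => ω (a * c) ⊗ₜ[ℂ] Ω (ρ b (ρ (d * S b') v))) (by fun_prop) (by fun_prop)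
    (by fun_prop)]
  have h2 : ∀ c b'', sw (fun d b' => ω (a * c) ⊗ₜ[ℂ] Ω (ρ b (ρ (d * S b') v))) b'' =
      counit (R := ℂ) b'' • ω (a * c) ⊗ₜ[ℂ] Ω (ρ b v) := by
    intro c b''
    have := sw_mul_S (fun u => ω (a * c) ⊗ₜ[ℂ] Ω (ρ b (ρ u v))) (by fun_prop) b''
    simpa using this
  simp only [h2]
  exact sw_counit_right (fun c => ω (a * c) ⊗ₜ[ℂ] Ω (ρ b v)) (by fun_prop) e

end Averaging

namespace SimpleList

open Coalgebra HopfAlgebra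

variable {H : Type*} [Ring H] [HopfAlgebra ℂ H] [Module.Finite ℂ H] {W : SimpleList H}

/-- The averaging argument: the twisted regular character cannot be supported on `i` alone. -/
lemma Twist.false_of_homAct {ω : H ≃ₐ[ℂ] H} (t : W.Twist ω)
    (hω : ∀ x, comul (R := ℂ) (ω x) = sw (fun a b => ω a ⊗ₜ[ℂ] ω b) x)
    {e : H} (he : ω e = e) (hee : e * e = e) (hε : counit (R := ℂ) e = 1)
    (he0 : tr (fun y => ω y * e) = 0) {i : Fin W.n} (hi : W.act ω i = i)
    (h1 : ∀ A, t.Ω i ∘ₗ homAct (W.ρ i) (W.ρ i) e A = homAct (W.ρ i) (W.ρ i) e A ∘ₗ t.Ω i)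
    (h2 : ∀ j, j ≠ i → t.c j = 0 ∨ ∀ A, homAct (W.ρ i) (W.ρ j) e A = 0) (h3 : t.c i ≠ 0) :
    False := by
  have hω' : ∀ (f : H → H → H ⊗[ℂ] (Fin (W.d i) → ℂ)), (∀ b, Lin fun a => f a b) →
      (∀ a, Lin fun b => f a b) → ∀ x, sw f (ω x) = sw (fun a b => f (ω a) (ω b)) x := by
    intro f hf1 hf2 x
    rw [sw_eq_bil f hf1 hf2, hω, (lin_linearMap _).sw]
    simp only [bil_tmul]
  have e1 := sw_tr_mul_tr (W.ρ i) hω' (t.comm i hi) e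
  have e2 : tr (fun x => ω (x * e)) = 0 := by simp only [map_mul, he, he0]
  rw [e2, zero_mul] at e1
  have e3 : ∀ a, tr (fun x => ω (x * a)) = ∑ j, t.c j * LinearMap.trace ℂ _ (t.Ω j * W.ρ j a) := by
    intro a
    rw [← t.tr_eq a]
    exact tr_comm (f := fun x => x * a) (g := fun x => ω x) (by fun_prop) (by fun_prop)
  have e4 : ∀ j a b, LinearMap.trace ℂ _ (t.Ω j * W.ρ j a) * tr (fun v => t.Ω i (W.ρ i (S b) v)) =
      tr (fun A => t.Ω j ∘ₗ (W.ρ j a ∘ₗ A ∘ₗ W.ρ i (S b)) ∘ₗ t.Ω i) := by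
    intro j a b
    have : tr (fun v => t.Ω i (W.ρ i (S b) v)) = LinearMap.trace ℂ _ (W.ρ i (S b) * t.Ω i) := by
      rw [LinearMap.trace_mul_comm, ← tr_linearMap]; rfl
    rw [this, ← tr_lcomp]; rfl
  have e5 : ∑ j, t.c j * tr (fun A => t.Ω j ∘ₗ homAct (W.ρ i) (W.ρ j) e A ∘ₗ t.Ω i) = 0 := by
    rw [← e1]
    simp only [e3, Finset.sum_mul, mul_assoc, e4]
    rw [sw_sum]
    refine Finset.sum_congr rfl fun j _ => ?_
    rw [← mul_sw, ← tr_sw _ _ (by fun_prop)]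
    congr 2; funext A
    exact (lin_lcomp lin_id (t.Ω j) (t.Ω i)).sw _ _
  rw [Finset.sum_eq_single i, mul_eq_zero, or_iff_right h3] at e5
  · have e6 : (fun A => t.Ω i ∘ₗ homAct (W.ρ i) (W.ρ i) e A ∘ₗ t.Ω i) =
        homAct (W.ρ i) (W.ρ i) e := by
      funext A
      rw [← LinearMap.comp_assoc, h1, LinearMap.comp_assoc]
      have : t.Ω i ∘ₗ t.Ω i = LinearMap.id := by
        have := t.sq i hi
        rwa [pow_two] at this
      rw [this, LinearMap.comp_id]
    rw [e6] at e5
    let E := (lin_homAct (W.ρ i) (W.ρ i) e).lm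
    have hE : IsIdempotentElem (E : Module.End ℂ _) := LinearMap.ext fun A => by
      change homAct _ _ e (homAct _ _ e A) = homAct _ _ e A
      rw [← homAct_mul, hee]
    have hE0 : E = 0 := eq_zero_of_trace_idem hE (by rw [← tr_linearMap]; exact e5)
    have h4 := LinearMap.congr_fun hE0 1
    change homAct _ _ e 1 = 0 at h4
    rw [homAct_one, hε, one_smul] at h4
    exact one_ne_zero h4
  · intro j _ hj
    rcases h2 j hj with h | h
    · rw [h, zero_mul]
    · simp only [h, LinearMap.zero_comp, LinearMap.comp_zero]
      have : tr (fun _ : (Fin (W.d i) → ℂ) →ₗ[ℂ] (Fin (W.d j) → ℂ) =>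
          (0 : (Fin (W.d i) → ℂ) →ₗ[ℂ] (Fin (W.d j) → ℂ))) = 0 := by
        have := tr_linearMap (0 : Module.End ℂ ((Fin (W.d i) → ℂ) →ₗ[ℂ] (Fin (W.d j) → ℂ)))
        rw [map_zero] at this
        exact this
      rw [this, mul_zero]
  · simp

end SimpleList

section Relations

open Coalgebra HopfAlgebra

variable {H : Type*} [Ring H] [HopfAlgebra ℂ H]

lemma commute_ltE_rtE (χ ψ : H →ₐ[ℂ] ℂ) : Commute (ltE χ) (rtE ψ) := by
  ext x
  change lt χ (rt ψ x) = rt ψ (lt χ x)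
  rw [lt, sw_rt _ (by fun_prop) (by fun_prop), lt, (lin_rt ψ).sw]
  simp only [(lin_rt ψ).map_smul]

lemma charS_charS (χ : H →ₐ[ℂ] ℂ) : charS (charS χ) = χ := by
  ext x
  rw [← counit_lt χ, ← counit_lt (charS (charS χ)), ← lt_charS χ (lt (charS (charS χ)) x),
    lt_charS (charS χ)]

lemma char_SS (χ : H →ₐ[ℂ] ℂ) (x : H) : χ (S (S x)) = χ x :=
  AlgHom.congr_fun (charS_charS χ) x

lemma commute_ssE_ltE (hS : Function.Bijective (S : H → H)) (χ : H →ₐ[ℂ] ℂ) :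
    Commute (ssE hS) (ltE χ) := by
  ext x
  change S (S (lt χ x)) = lt χ (S (S x))
  rw [lt, lt, sw_SS _ (by fun_prop) (by fun_prop), (by fun_prop : Lin fun y : H => S (S y)).sw]
  simp only [(by fun_prop : Lin fun y : H => S (S y)).map_smul, char_SS]

lemma lt_grouplike {g : H} (hg : IsGroupLikeElem ℂ g) (χ : H →ₐ[ℂ] ℂ) : lt χ g = χ g • g := by
  rw [lt, sw_eq_bil _ (by fun_prop) (by fun_prop), hg.comul_eq_tmul_self, bil_tmul]

lemma rt_grouplike {g : H} (hg : IsGroupLikeElem ℂ g) (χ : H →ₐ[ℂ] ℂ) : rt χ g = χ g • g := by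
  rw [rt, sw_eq_bil _ (by fun_prop) (by fun_prop), hg.comul_eq_tmul_self, bil_tmul]

lemma char_mul_S {g : H} (hg : IsGroupLikeElem ℂ g) (χ : H →ₐ[ℂ] ℂ) : χ g * χ (S g) = 1 := by
  rw [← map_mul, hg.mul_antipode_cancel, map_one]

lemma commute_adE_ltE {g : H} (hg : IsGroupLikeElem ℂ g) (χ : H →ₐ[ℂ] ℂ) :
    Commute (adE hg) (ltE χ) := by
  ext x
  change g * lt χ x * S g = lt χ (g * x * S g)
  rw [lt_mul, lt_mul, lt_grouplike hg, lt_grouplike hg.antipode, smul_mul_assoc, smul_mul_assoc,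
    mul_smul_comm, smul_smul, char_mul_S hg, one_smul]

lemma commute_adE_rtE {g : H} (hg : IsGroupLikeElem ℂ g) (χ : H →ₐ[ℂ] ℂ) :
    Commute (adE hg) (rtE χ) := by
  ext x
  change g * rt χ x * S g = rt χ (g * x * S g)
  rw [rt_mul, rt_mul, rt_grouplike hg, rt_grouplike hg.antipode, smul_mul_assoc, smul_mul_assoc,
    mul_smul_comm, smul_smul, char_mul_S hg, one_smul]

lemma adE_pow {g : H} (hg : IsGroupLikeElem ℂ g) (k : ℕ) (x : H) :
    (adE hg ^ k) x = g ^ k * x * S (g ^ k) := by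
  induction k with
  | zero => simp
  | succ k ih =>
    rw [pow_succ', AlgEquiv.mul_apply, ih, adE_apply, pow_succ', S_mul]
    noncomm_ring

lemma adE_pow_eq_one {g : H} (hg : IsGroupLikeElem ℂ g) {n : ℕ} (h : g ^ n = 1) :
    adE hg ^ n = 1 := by
  ext x
  rw [adE_pow, h, S_one, one_mul, mul_one]; rfl

lemma rtE_pow_eq_one {χ : H →ₐ[ℂ] ℂ} {n : ℕ} (h : ltE χ ^ n = 1) : rtE χ ^ n = 1 := by
  rw [ltE_pow, ltE_eq_one_iff] at h
  rw [rtE_pow, rtE_eq_one_iff, h]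

lemma ssE_pow_eq_one {hS : Function.Bijective (S : H → H)} {g : H} {hg : IsGroupLikeElem ℂ g}
    {α : H →ₐ[ℂ] ℂ} (h : adE hg * ssE hS ^ 2 * ltE α = rtE α) {n : ℕ} (hgn : g ^ n = 1)
    (hα : ltE α ^ n = 1) : ssE hS ^ (2 * n) = 1 := by
  have h1 : ssE hS ^ 2 = (adE hg)⁻¹ * (rtE α * (ltE α)⁻¹) := by rw [← h]; group
  have c1 : Commute (rtE α) (ltE α)⁻¹ := (commute_ltE_rtE α α).symm.inv_right
  have c2 : Commute (adE hg)⁻¹ (rtE α * (ltE α)⁻¹) :=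
    ((commute_adE_rtE hg α).mul_right (commute_adE_ltE hg α).inv_right).inv_left
  rw [pow_mul, h1, c2.mul_pow, c1.mul_pow, inv_pow, inv_pow, adE_pow_eq_one hg hgn, hα,
    rtE_pow_eq_one hα]
  simp

lemma comul_ssE_pow (hS : Function.Bijective (S : H → H)) (n : ℕ) (x : H) :
    comul (R := ℂ) ((ssE hS ^ n) x) = sw (fun a b => (ssE hS ^ n) a ⊗ₜ[ℂ] (ssE hS ^ n) b) x := by
  induction n generalizing x with
  | zero => exact comul_eq_sw x
  | succ n ih =>
    rw [pow_succ, AlgEquiv.mul_apply, ih, ssE_apply, sw_SS _ (by fun_prop) (by fun_prop)]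
    rfl

lemma counit_ssE (hS : Function.Bijective (S : H → H)) (x : H) :
    counit (R := ℂ) (ssE hS x) = counit (R := ℂ) x := by
  rw [ssE_apply, counit_S, counit_S]

lemma ssE_grouplike (hS : Function.Bijective (S : H → H)) {g : H} (hg : IsGroupLikeElem ℂ g) :
    ssE hS g = g := hg.antipode_antipode (R := ℂ)

lemma pow_apply_eq {A : Type*} [Ring A] [Algebra ℂ A] {κ : A ≃ₐ[ℂ] A} {x : A} (h : κ x = x)
    (k : ℕ) : (κ ^ k) x = x := by
  induction k with
  | zero => rfl
  | succ k ih => rw [pow_succ, AlgEquiv.mul_apply, h, ih]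

/-- A map intertwining `S ∘ S ∘ lt χ` for a nontrivial character has trace zero. -/
lemma trace_eq_zero_of_ss_lt {V : Type*} [AddCommGroup V] [Module ℂ V] [Module.Finite ℂ V]
    (ρ : H →ₐ[ℂ] Module.End ℂ V) {χ : H →ₐ[ℂ] ℂ} (hχ : χ ≠ Bialgebra.counitAlgHom ℂ H)
    {T : Module.End ℂ V} (hT : ∀ x, T * ρ x = ρ (S (S (lt χ x))) * T) :
    LinearMap.trace ℂ V T = 0 := by
  by_contra h0
  refine hχ (AlgHom.ext fun x => ?_)
  let τ : H → ℂ := fun y => LinearMap.trace ℂ V (T * ρ y)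
  have hτ : Lin τ :=
    lin_linearMap (LinearMap.trace ℂ V ∘ₗ LinearMap.mulLeft ℂ T ∘ₗ ρ.toLinearMap)
  have h1 : sw (fun a b => τ (a * S b)) x = counit (R := ℂ) x • τ 1 := sw_mul_S τ hτ x
  have h2 : ∀ a b, τ (a * S b) = τ (S b * S (S (lt χ a))) := by
    intro a b
    change LinearMap.trace ℂ V (T * ρ (a * S b)) = LinearMap.trace ℂ V (T * ρ (S b * S (S (lt χ a))))
    rw [map_mul ρ, ← mul_assoc, hT, map_mul ρ, LinearMap.trace_mul_comm, LinearMap.trace_mul_comm _ T,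
      mul_assoc]
  rw [show (fun a b => τ (a * S b)) = fun a b => τ (S b * S (S (lt χ a))) from funext₂ h2] at h1
  rw [← sw_lt (fun a b => τ (S b * S (S a))) (fun b => by fun_prop) (fun a => by fun_prop)] at h1
  have h3 := sw_S_mul (fun y => τ (S y)) (by fun_prop) (lt χ x)
  simp only [S_mul, counit_lt, S_one] at h3
  rw [h3] at h1
  refine mul_right_cancel₀ (b := τ 1) ?_ h1
  change LinearMap.trace ℂ V (T * ρ 1) ≠ 0
  rwa [map_one, mul_one]

end Relations

section Commutants

variable {V : Type*} [AddCommGroup V] [Module ℂ V] [Module.Finite ℂ V]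

lemma mul_eq_trace_smul {E X : End ℂ V} (hE : IsIdempotentElem E) (ht : LinearMap.trace ℂ V E = 1)
    (hc : Commute X E) : X * E = LinearMap.trace ℂ V (X * E) • E := by
  have h1 : finrank ℂ (LinearMap.range E) = 1 := by
    rw [trace_idem hE] at ht; exact_mod_cast ht
  obtain ⟨⟨w, w', hw'⟩, hw0, hw⟩ := finrank_eq_one_iff'.1 h1
  have hEw : E w = w := by
    rw [← hw']; exact LinearMap.congr_fun hE w'
  obtain ⟨c, hcw⟩ := hw ⟨E (X w), LinearMap.mem_range_self E _⟩
  have hXw : X w = c • w := by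
    have h2 : c • w = E (X w) := congrArg Subtype.val hcw
    have h3 := LinearMap.congr_fun hc w
    simp only [End.mul_apply, hEw] at h3
    rw [h2]; exact h3
  have h4 : X * E = c • E := by
    refine LinearMap.ext fun v => ?_
    obtain ⟨a, ha⟩ := hw ⟨E v, LinearMap.mem_range_self E _⟩
    have ha' : a • w = E v := congrArg Subtype.val ha
    rw [End.mul_apply, LinearMap.smul_apply, ← ha', map_smul, hXw, smul_comm]
  have h5 : LinearMap.trace ℂ V (X * E) = c := by rw [h4, map_smul, ht, smul_eq_mul, mul_one]
  rw [h5, h4]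

variable {φ : End ℂ V} {N : ℕ} {ζ : ℂ}

/-- An operator commuting with `φ` is scalar when the traces of `φ ^ i` and `φ ^ i * X` vanish. -/
lemma exists_eq_smul_one (hN : finrank ℂ V = N) (hN0 : 0 < N) (hφ : φ ^ N = 1)
    (h1 : ∀ i, i ≠ 0 → i < N → LinearMap.trace ℂ V (φ ^ i) = 0) {X : End ℂ V}
    (h2 : ∀ i, i ≠ 0 → i < N → LinearMap.trace ℂ V (φ ^ i * X) = 0) (hc : Commute φ X) :
    ∃ c : ℂ, X = c • (1 : End ℂ V) := by
  have hζ := Complex.isPrimitiveRoot_exp N hN0.ne'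
  set ζ := Complex.exp (2 * Real.pi * Complex.I / N)
  have hN' : (N : ℂ) ≠ 0 := by exact_mod_cast hN0.ne'
  refine ⟨LinearMap.trace ℂ V X / N, ?_⟩
  have h3 : ∀ j, X * eproj ζ N φ j = (LinearMap.trace ℂ V X / N) • eproj ζ N φ j := by
    intro j
    have h4 : LinearMap.trace ℂ V (eproj ζ N φ j) = 1 := by
      have := trace_eproj_mul (ζ := ζ) hN0 (1 : End ℂ V) (by simpa using h1) j
      rw [mul_one, LinearMap.trace_one, hN, div_self hN'] at this
      exact this
    rw [mul_eq_trace_smul (eproj_idem hN0 hζ hφ j) h4 (commute_eproj hc j).symm,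
      LinearMap.trace_mul_comm, trace_eproj_mul hN0 X h2]
  calc X = X * ∑ j ∈ Finset.range N, eproj ζ N φ j := by rw [sum_eproj hN0 hζ, mul_one]
    _ = (LinearMap.trace ℂ V X / N) • ∑ j ∈ Finset.range N, eproj ζ N φ j := by
      rw [Finset.mul_sum, Finset.smul_sum]; exact Finset.sum_congr rfl fun j _ => h3 j
    _ = _ := by rw [sum_eproj hN0 hζ]

/-- The commutant of an operator with simple spectrum is commutative. -/
lemma mul_comm_of_simple (hN0 : 0 < N) (hζ : IsPrimitiveRoot ζ N) (hφ : φ ^ N = 1)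
    (h : ∀ j, LinearMap.trace ℂ V (eproj ζ N φ j) = 0 ∨ LinearMap.trace ℂ V (eproj ζ N φ j) = 1)
    {A B : End ℂ V} (hA : Commute φ A) (hB : Commute φ B) : A * B = B * A := by
  have key : ∀ X, Commute φ X → ∀ j, ∃ c : ℂ, X * eproj ζ N φ j = c • eproj ζ N φ j := by
    intro X hX j
    rcases h j with h | h
    · exact ⟨0, by rw [eq_zero_of_trace_idem (eproj_idem hN0 hζ hφ j) h]; simp⟩
    · exact ⟨_, mul_eq_trace_smul (eproj_idem hN0 hζ hφ j) h (commute_eproj hX j).symm⟩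
  have h2 : ∀ j, A * B * eproj ζ N φ j = B * A * eproj ζ N φ j := by
    intro j
    obtain ⟨a, ha⟩ := key A hA j
    obtain ⟨b, hb⟩ := key B hB j
    rw [mul_assoc, mul_assoc, ha, hb, mul_smul_comm, mul_smul_comm, ha, hb, smul_comm]
  rw [← mul_one (A * B), ← mul_one (B * A), ← sum_eproj (φ := φ) hN0 hζ, Finset.mul_sum,
    Finset.mul_sum]
  exact Finset.sum_congr rfl fun j _ => h2 j

end Commutants

section Orbits

lemma exists_fixed_odd {ι : Type*} [Fintype ι] [DecidableEq ι] (f : ι → ℕ) (σ : ι → ι)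
    (hσ : ∀ i, σ (σ i) = i) (hf : ∀ i, f (σ i) = f i) (ho : Odd (∑ i, f i)) :
    ∃ i, σ i = i ∧ Odd (f i) := by
  by_contra! hcon
  have h1 : ∑ i, (f i : ZMod 2) = 0 := by
    refine Finset.sum_involution (fun i _ => σ i) (fun i _ => ?_) (fun i _ h0 hi => ?_)
      (fun i _ => Finset.mem_univ _) (fun i _ => hσ i)
    · rw [hf]; exact CharTwo.add_self_eq_zero _
    · have := Nat.not_odd_iff_even.1 (hcon i hi)
      exact h0 ((ZMod.natCast_eq_zero_iff_even).2 this)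
  rw [← Nat.cast_sum, ZMod.natCast_eq_zero_iff_even] at h1
  exact Nat.not_even_iff_odd.2 ho h1

variable {X : Type*} {f g : X → X} {x : X} {n : ℕ}

lemma dvd_of_iterate_eq (hn : n.Prime) (hf : f^[n] x = x) (hx : f x ≠ x) {m : ℕ}
    (hm : f^[m] x = x) : n ∣ m := by
  have h1 : Function.minimalPeriod f x ∣ n := Function.IsPeriodicPt.minimalPeriod_dvd hf
  rcases (Nat.dvd_prime hn).1 h1 with h | h
  · exact absurd (Function.minimalPeriod_eq_one_iff_isFixedPt.1 h) hx
  · rw [← h]; exact Function.IsPeriodicPt.minimalPeriod_dvd hm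

lemma injOn_iterate (hn : n.Prime) (hf : f^[n] x = x) (hx : f x ≠ x) :
    Set.InjOn (fun k => f^[k] x) (Finset.range n) := by
  have h1 : Function.minimalPeriod f x ∣ n := Function.IsPeriodicPt.minimalPeriod_dvd hf
  have h2 : Function.minimalPeriod f x = n := by
    rcases (Nat.dvd_prime hn).1 h1 with h | h
    · exact absurd (Function.minimalPeriod_eq_one_iff_isFixedPt.1 h) hx
    · exact h
  have := Function.iterate_injOn_Iio_minimalPeriod (f := f) (x := x)
  rw [h2] at this
  intro a ha b hb hab
  exact this (by simpa using ha) (by simpa using hb) hab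

/-- Two commuting maps of prime period `n` have `n ^ 2` distinct translates of a point that is not
fixed by the obvious nontrivial compositions. -/
lemma injOn_iterate_iterate (hn : n.Prime) (hfg : Function.Commute f g)
    (hgi : Function.Injective g)
    (hf : ∀ y, f^[n] y = y) (hg : g^[n] x = x) (hx : f x ≠ x) (hx' : ∀ c, f^[c] (g x) ≠ x) :
    Set.InjOn (fun k : ℕ × ℕ => f^[k.1] (g^[k.2] x)) (Finset.range n ×ˢ Finset.range n) := by
  have key : ∀ k l k' l', k < n → k' < n → l' < n → l ≤ l' →
      f^[k] (g^[l] x) = f^[k'] (g^[l'] x) → k = k' ∧ l = l' := by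
    intro k l k' l' hk hk' hl' hll h
    obtain ⟨u, rfl⟩ := Nat.exists_eq_add_of_le hll
    have h1 : f^[(n - k) + k'] (g^[u] x) = x := by
      apply (hgi.iterate l)
      rw [← (hfg.iterate_iterate _ _).eq, ← Function.iterate_add_apply, Function.iterate_add_apply,
        ← h, ← Function.iterate_add_apply, Nat.sub_add_cancel hk.le, hf]
    rcases Nat.eq_zero_or_pos u with rfl | hu
    · have h2 := dvd_of_iterate_eq hn (hf x) hx h1
      obtain ⟨c, hc⟩ := h2
      have : c = 1 := by
        have h3 : 0 < n * c := by omega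
        have h4 : n * c < n * 2 := by omega
        have := Nat.lt_of_mul_lt_mul_left h4
        have := Nat.pos_of_mul_pos_left h3
        omega
      subst this
      exact ⟨by omega, by omega⟩
    · exfalso
      have hco : Nat.Coprime u n := (Nat.coprime_or_dvd_of_prime hn u).elim
        (fun h => h.symm) (fun h => absurd (Nat.le_of_dvd hu h) (by omega))
      obtain ⟨w, _, hw⟩ := Nat.exists_mul_mod_eq_one_of_coprime hco hn.one_lt
      set m := (n - k) + k'
      have hc : Function.Commute (f^[m]) (g^[u]) := hfg.iterate_iterate m u
      have h2 : (f^[m] ∘ g^[u])^[w] x = x := Function.iterate_fixed h1 w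
      rw [hc.comp_iterate, Function.comp_apply, ← Function.iterate_mul, ← Function.iterate_mul] at h2
      have h3 : g^[u * w] x = g x := by
        rw [← Nat.mod_add_div (u * w) n, hw, Function.iterate_add_apply, Function.iterate_mul,
          Function.iterate_fixed hg]
        rfl
      rw [h3] at h2
      exact hx' _ h2
  rintro ⟨k, l⟩ hkl ⟨k', l'⟩ hkl' h
  simp only [Set.mem_prod, Finset.coe_range, Set.mem_Iio] at hkl hkl'
  rcases le_total l l' with hll | hll
  · obtain ⟨h1, h2⟩ := key k l k' l' hkl.1 hkl'.1 hkl'.2 hll h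
    rw [h1, h2]
  · obtain ⟨h1, h2⟩ := key k' l' k l hkl'.1 hkl.1 hkl.2 hll h.symm
    rw [h1, h2]

end Orbits

namespace SimpleList

section Counting

variable {H : Type*} [Ring H] [Algebra ℂ H] (W : SimpleList H)

lemma act_iterate (κ : H ≃ₐ[ℂ] H) (k : ℕ) (i : Fin W.n) : (W.act κ)^[k] i = W.act (κ ^ k) i := by
  induction k with
  | zero => exact (W.act_one i).symm
  | succ k ih => rw [Function.iterate_succ_apply', ih, pow_succ', act_mul]

lemma act_injective (κ : H ≃ₐ[ℂ] H) : Function.Injective (W.act κ) := fun i j h => by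
  have h1 : W.act κ⁻¹ (W.act κ i) = W.act κ⁻¹ (W.act κ j) := by rw [h]
  rwa [← act_mul, ← act_mul, inv_mul_cancel, act_one, act_one] at h1

/-- The multiplicity of `E`-invariants in a simple module. -/
noncomputable def wt (E : H) (i : Fin W.n) : ℕ := finrank ℂ (LinearMap.range (W.ρ i E))

lemma trace_eq_wt {E : H} (hE : IsIdempotentElem E) (i : Fin W.n) :
    LinearMap.trace ℂ _ (W.ρ i E) = W.wt E i :=
  trace_idem (hE.map (W.ρ i))

lemma wt_act {κ : H ≃ₐ[ℂ] H} {E : H} (hE : IsIdempotentElem E) (hκ : κ E = E) (i : Fin W.n) :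
    W.wt E (W.act κ i) = W.wt E i := by
  obtain ⟨T, hT⟩ := W.iso_act κ i
  have h1 : W.ρ (W.act κ i) E = T.conj (W.ρ i E) := by
    refine LinearMap.ext fun v => ?_
    rw [LinearEquiv.conj_apply_apply, hT, hκ, LinearEquiv.apply_symm_apply]
  have h2 := W.trace_eq_wt hE (W.act κ i)
  rw [h1, LinearMap.trace_conj', W.trace_eq_wt hE] at h2
  exact_mod_cast h2.symm

variable [Module.Finite ℂ H]

lemma sum_le (s : Finset (Fin W.n)) : ∑ i ∈ s, W.d i * W.p i ≤ finrank ℂ H := by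
  rw [← W.sum_d_mul_p]
  exact Finset.sum_le_sum_of_subset (Finset.subset_univ s)

/-- Translates of a simple module. -/
lemma exists_translates {ι : Type*} (s : Finset ι) (f : ι → H ≃ₐ[ℂ] H) (i : Fin W.n)
    (h : Set.InjOn (fun k => W.act (f k) i) s) : ∃ o : Finset (Fin W.n),
      (∀ j ∈ o, ∃ k ∈ s, j = W.act (f k) i) ∧
      ∑ j ∈ o, W.d j * W.p j = s.card * (W.d i * W.p i) := by
  classical
  refine ⟨s.image fun k => W.act (f k) i, fun j hj => ?_, ?_⟩
  · obtain ⟨k, hk, rfl⟩ := Finset.mem_image.1 hj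
    exact ⟨k, hk, rfl⟩
  · rw [Finset.sum_image h]
    simp only [d_act, p_act, Finset.sum_const, smul_eq_mul]

lemma exists_prime_orbit {κ : H ≃ₐ[ℂ] H} {n : ℕ} (hn : n.Prime) (hκ : κ ^ n = 1) {i : Fin W.n}
    (hi : W.act κ i ≠ i) : ∃ o : Finset (Fin W.n), (∀ j ∈ o, ∃ k, j = W.act (κ ^ k) i) ∧
      ∑ j ∈ o, W.d j * W.p j = n * (W.d i * W.p i) := by
  obtain ⟨o, h1, h2⟩ := W.exists_translates (Finset.range n) (fun k => κ ^ k) i (by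
    have := injOn_iterate (x := i) hn (by rw [act_iterate, hκ, act_one]) hi
    simpa only [act_iterate] using this)
  refine ⟨o, fun j hj => ?_, by rw [h2, Finset.card_range]⟩
  obtain ⟨k, -, hk⟩ := h1 j hj
  exact ⟨k, hk⟩

/-- A simple module either is fixed by some `L ^ c * Q` or has `n ^ 2` translates. -/
lemma fixed_or_orbit {L Q : H ≃ₐ[ℂ] H} (hLQ : Commute Q L) {n : ℕ} (hn : n.Prime)
    (hL : L ^ n = 1) {i : Fin W.n} (hQ : W.act (Q ^ n) i = i) (hi : W.act L i ≠ i) :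
    (∃ c, W.act (L ^ c * Q) i = i) ∨ ∃ o : Finset (Fin W.n),
      (∀ j ∈ o, ∃ k l, j = W.act (L ^ k * Q ^ l) i) ∧
      ∑ j ∈ o, W.d j * W.p j = n * n * (W.d i * W.p i) := by
  by_cases h : ∃ c, W.act (L ^ c * Q) i = i
  · exact Or.inl h
  · right
    obtain ⟨o, h1, h2⟩ := W.exists_translates (Finset.range n ×ˢ Finset.range n)
      (fun k => L ^ k.1 * Q ^ k.2) i (by
        have := injOn_iterate_iterate (f := W.act L) (g := W.act Q) (x := i) hn
          (fun j => by rw [← act_mul, ← act_mul, hLQ.eq]) (W.act_injective Q)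
          (fun j => by rw [act_iterate, hL, act_one]) (by rw [act_iterate, hQ]) hi
          (fun c hc => h ⟨c, by rwa [act_iterate, ← act_mul] at hc⟩)
        simpa only [act_iterate, ← act_mul, Finset.coe_product] using this)
    refine ⟨o, fun j hj => ?_, by rw [h2, Finset.card_product, Finset.card_range]⟩
    obtain ⟨k, -, hk⟩ := h1 j hj
    exact ⟨k.1, k.2, hk⟩

lemma sum_p_mul_wt {E : H} (hE : IsIdempotentElem E) :
    ((∑ i, W.p i * W.wt E i : ℕ) : ℂ) = tr (fun y => y * E) := by
  rw [W.tr_mul_eq]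
  push_cast
  exact Finset.sum_congr rfl fun i _ => by rw [W.trace_eq_wt hE]

end Counting

section Trivial

open Coalgebra HopfAlgebra

variable {H : Type*} [Ring H] [HopfAlgebra ℂ H] (W : SimpleList H)

lemma eq_counit_of_act_triv {χ : H →ₐ[ℂ] ℂ} (h : W.act (ltE χ) W.triv = W.triv) :
    χ = Bialgebra.counitAlgHom ℂ H := by
  obtain ⟨T, hT⟩ := W.act_eq_iff.1 h
  obtain ⟨v, hv⟩ := exists_ne (0 : Fin (W.d W.triv) → ℂ)
  ext x
  have h1 := hT x v
  rw [ρ_triv, ρ_triv, ltE_apply, counit_lt, map_smul] at h1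
  exact (smul_left_injective ℂ ((LinearEquiv.map_ne_zero_iff T).2 hv) h1).symm

lemma wt_triv {E : H} (hE : IsIdempotentElem E) : (W.wt E W.triv : ℂ) = counit (R := ℂ) E := by
  rw [← W.trace_eq_wt hE, trace_ρ_triv]

variable [Module.Finite ℂ H]

lemma exists_triv_orbit (χ : H →ₐ[ℂ] ℂ) : ∃ o : Finset (Fin W.n),
    (∀ j ∈ o, ∃ k, j = W.act (ltE χ ^ k) W.triv) ∧ o.card = orderOf (ltE χ) := by
  classical
  refine ⟨(Finset.range (orderOf (ltE χ))).image fun k => W.act (ltE χ ^ k) W.triv,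
    fun j hj => ?_, ?_⟩
  · obtain ⟨k, -, rfl⟩ := Finset.mem_image.1 hj
    exact ⟨k, rfl⟩
  · rw [Finset.card_image_of_injOn, Finset.card_range]
    have key : ∀ i j, i < j → j < orderOf (ltE χ) →
        W.act (ltE χ ^ i) W.triv ≠ W.act (ltE χ ^ j) W.triv := by
      intro i j hij hj h
      obtain ⟨k, rfl⟩ := Nat.exists_eq_add_of_lt hij
      rw [add_assoc, pow_add, act_mul] at h
      have h1 := W.act_injective _ h
      rw [ltE_pow] at h1
      exact cpow_ne (Nat.succ_ne_zero k) (by omega) (W.eq_counit_of_act_triv h1.symm)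
    intro i hi j hj h
    simp only [Finset.coe_range, Set.mem_Iio] at hi hj
    rcases lt_trichotomy i j with hij | hij | hij
    · exact absurd h (key i j hij hj)
    · exact hij
    · exact absurd h.symm (key j i hij hi)

lemma orderOf_mul_p_triv_le (χ : H →ₐ[ℂ] ℂ) :
    orderOf (ltE χ) * W.p W.triv ≤ finrank ℂ H := by
  obtain ⟨o, h1, h2⟩ := W.exists_triv_orbit χ
  rw [← h2]
  calc o.card * W.p W.triv = ∑ j ∈ o, W.d j * W.p j := by
        rw [Finset.sum_const_nat fun j hj => ?_]
        obtain ⟨k, rfl⟩ := h1 j hj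
        rw [d_act, p_act, d_triv, one_mul]
    _ ≤ _ := W.sum_le o

variable {g : H} {ζ : ℂ}

lemma sum_p_mul_wt_eproj (hS : Function.Bijective (S : H → H)) (hg : IsGroupLikeElem ℂ g)
    (hζ : IsPrimitiveRoot ζ (orderOf g)) (j : ℕ) :
    orderOf g * ∑ i, W.p i * W.wt (eproj ζ (orderOf g) g j) i = finrank ℂ H := by
  have hb := (isOfFinOrder_grouplike hg).orderOf_pos
  have h1 := W.sum_p_mul_wt (eproj_idem hb hζ (pow_orderOf_eq_one g) j)
  have hb' : (orderOf g : ℂ) ≠ 0 := by exact_mod_cast hb.ne'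
  rw [tr_mul_eproj hS hg, eq_div_iff hb', mul_comm] at h1
  exact_mod_cast h1

lemma wt_eproj_triv (hg : IsGroupLikeElem ℂ g) (hζ : IsPrimitiveRoot ζ (orderOf g)) :
    W.wt (eproj ζ (orderOf g) g 0) W.triv = 1 := by
  have hb := (isOfFinOrder_grouplike hg).orderOf_pos
  have hb' : (orderOf g : ℂ) ≠ 0 := by exact_mod_cast hb.ne'
  have h1 := W.wt_triv (eproj_idem hb hζ (pow_orderOf_eq_one g) 0)
  have h2 := map_eproj (ζ := ζ) (N := orderOf g) (φ := g) (Bialgebra.counitAlgHom ℂ H) 0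
  rw [Bialgebra.counitAlgHom_apply, Bialgebra.counitAlgHom_apply, hg.counit_eq_one] at h2
  rw [h2] at h1
  have h3 : eproj ζ (orderOf g) (1 : ℂ) 0 = 1 := by simp [eproj, hb']
  rw [h3] at h1
  exact_mod_cast h1

lemma orderOf_mul_p_triv_le' (hS : Function.Bijective (S : H → H)) (hg : IsGroupLikeElem ℂ g) :
    orderOf g * W.p W.triv ≤ finrank ℂ H := by
  have hb := (isOfFinOrder_grouplike hg).orderOf_pos
  have hζ := Complex.isPrimitiveRoot_exp _ hb.ne'
  set ζ := Complex.exp (2 * Real.pi * Complex.I / orderOf g)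
  rw [← W.sum_p_mul_wt_eproj hS hg hζ 0]
  refine Nat.mul_le_mul_left _ ?_
  have := Finset.single_le_sum (f := fun i => W.p i * W.wt (eproj ζ (orderOf g) g 0) i)
    (fun i _ => Nat.zero_le _) (Finset.mem_univ W.triv)
  simpa only [W.wt_eproj_triv hg hζ, mul_one] using this

/-- When the orders are coprime, the two bounds combine. -/
lemma orderOf_mul_orderOf_mul_le (hS : Function.Bijective (S : H → H)) (hg : IsGroupLikeElem ℂ g)
    (χ : H →ₐ[ℂ] ℂ) (hco : Nat.Coprime (orderOf (ltE χ)) (orderOf g)) :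
    orderOf g * (orderOf (ltE χ) * W.p W.triv) ≤ finrank ℂ H := by
  have hb := (isOfFinOrder_grouplike hg).orderOf_pos
  have hζ := Complex.isPrimitiveRoot_exp _ hb.ne'
  set ζ := Complex.exp (2 * Real.pi * Complex.I / orderOf g)
  have hχg : χ g = 1 := by
    have h1 : χ g ^ orderOf g = 1 := by rw [← map_pow, pow_orderOf_eq_one, map_one]
    have h2 : χ g ^ orderOf (ltE χ) = 1 := by
      have h3 : ∀ k, (ltE χ ^ k) g = χ g ^ k • g := by
        intro k
        induction k with
        | zero => simp
        | succ k ih =>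
          rw [pow_succ, AlgEquiv.mul_apply, ltE_apply, lt_grouplike hg, map_smul, ih, smul_smul,
            pow_succ']
      have h4 := congrArg (counit (R := ℂ)) (h3 (orderOf (ltE χ)))
      rw [pow_orderOf_eq_one, map_smul, AlgEquiv.one_apply, hg.counit_eq_one] at h4
      simpa using h4.symm
    have h5 := orderOf_dvd_of_pow_eq_one h1
    have h6 := orderOf_dvd_of_pow_eq_one h2
    exact orderOf_eq_one_iff.1 (Nat.eq_one_of_dvd_coprimes hco h6 h5)
  have hE := eproj_idem hb hζ (pow_orderOf_eq_one g) 0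
  have hLE : ltE χ (eproj ζ (orderOf g) g 0) = eproj ζ (orderOf g) g 0 := by
    rw [map_eproj, ltE_apply, lt_grouplike hg, hχg, one_smul]
  obtain ⟨o, h1, h2⟩ := W.exists_triv_orbit χ
  rw [← W.sum_p_mul_wt_eproj hS hg hζ 0, ← h2]
  refine Nat.mul_le_mul_left _ ?_
  calc o.card * W.p W.triv = ∑ j ∈ o, W.p j * W.wt (eproj ζ (orderOf g) g 0) j := by
        rw [Finset.sum_const_nat fun j hj => ?_]
        obtain ⟨k, rfl⟩ := h1 j hj
        rw [p_act, W.wt_act hE (pow_apply_eq hLE k), W.wt_eproj_triv hg hζ, mul_one]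
    _ ≤ _ := Finset.sum_le_sum_of_subset (Finset.subset_univ o)

end Trivial

section Intertwiners

variable {H : Type*} [Ring H] [Algebra ℂ H] (W : SimpleList H)

/-- `T` intertwines a simple module with its twist by `κ`. -/
def Intertwines (κ : H ≃ₐ[ℂ] H) (i : Fin W.n) (T : End ℂ (Fin (W.d i) → ℂ)) : Prop :=
  ∀ x, T * W.ρ i x = W.ρ i (κ x) * T

variable {W} {κ μ : H ≃ₐ[ℂ] H} {i : Fin W.n} {A B : End ℂ (Fin (W.d i) → ℂ)}

lemma Intertwines.mul (hA : W.Intertwines κ i A) (hB : W.Intertwines μ i B) :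
    W.Intertwines (κ * μ) i (A * B) := fun x => by
  rw [mul_assoc, hB, ← mul_assoc, hA, mul_assoc]; rfl

lemma Intertwines.pow (hA : W.Intertwines κ i A) (k : ℕ) : W.Intertwines (κ ^ k) i (A ^ k) := by
  induction k with
  | zero => intro x; simp
  | succ k ih => rw [pow_succ, pow_succ]; exact ih.mul hA

/-- Schur's lemma for twisted intertwiners. -/
lemma Intertwines.exists_smul (hA : W.Intertwines κ i A) (hB : W.Intertwines κ i B)
    (hu : IsUnit A) : ∃ c : ℂ, B = c • A := by
  obtain ⟨u, rfl⟩ := hu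
  obtain ⟨c, hc⟩ := exists_smul_of_forall_commute
    (((u⁻¹ : (End ℂ (Fin (W.d i) → ℂ))ˣ) : End ℂ (Fin (W.d i) → ℂ)) * B) (by
    intro X
    obtain ⟨x, rfl⟩ := W.surj_ρ i X
    rw [mul_assoc, hB, ← mul_assoc, ← mul_assoc]
    congr 1
    rw [Units.eq_inv_mul_iff_mul_eq, ← mul_assoc, hA, Units.mul_inv_cancel_right])
  refine ⟨c, ?_⟩
  rw [← Units.mul_inv_cancel_left u B, hc, mul_smul_comm, mul_one]

end Intertwiners

section Hopf

open Coalgebra HopfAlgebra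

variable {H : Type*} [Ring H] [HopfAlgebra ℂ H] {α : H →ₐ[ℂ] ℂ} {hS : Function.Bijective (S : H → H)}

lemma mul_ssE_pow {n : ℕ} (hα : ltE α ^ n = 1) (c : ℕ) :
    (ltE α ^ c * ssE hS) ^ n = ssE hS ^ n := by
  rw [((commute_ssE_ltE hS α).symm.pow_left c).mul_pow, ← pow_mul, mul_comm c, pow_mul, hα,
    one_pow, one_mul]

lemma mul_ssE_apply (c : ℕ) (x : H) : (ltE α ^ c * ssE hS) x = S (S (lt (cpow α c) x)) := by
  rw [((commute_ssE_ltE hS α).symm.pow_left c).eq, ltE_pow]; rfl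

variable {W : SimpleList H} {i : Fin W.n} [Module.Finite ℂ H]

/-- On a module fixed by a free action of the powers of `α`, some power of the intertwiner of `S²`
is scalar. -/
lemma pow_eq_smul_one {n : ℕ} (hn : n.Prime) (hαn : orderOf (ltE α) = n) (hd : W.d i = n)
    {φ T : End ℂ (Fin (W.d i) → ℂ)} (hφ : W.Intertwines (ltE α) i φ) (hφn : φ ^ n = 1)
    (hT : W.Intertwines (ssE hS) i T) (hTn : T ^ (2 * n) = 1)
    (htr : ∀ k, k ≠ 0 → k < n → LinearMap.trace ℂ _ (φ ^ k) = 0) :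
    ∃ c : ℂ, T ^ n = c • (1 : End ℂ (Fin (W.d i) → ℂ)) := by
  have hfin : finrank ℂ (Fin (W.d i) → ℂ) = n := by rw [finrank_fin_fun, hd]
  have hφu : IsUnit φ := IsUnit.of_pow_eq_one hφn hn.ne_zero
  have hTu : IsUnit T := IsUnit.of_pow_eq_one hTn (by have := hn.ne_zero; omega)
  obtain ⟨c, hc⟩ := (hφ.mul hT).exists_smul
    (by rw [← (commute_ssE_ltE hS α).eq]; exact hT.mul hφ) (hφu.mul hTu)
  have hpow : ∀ k, T * φ ^ k = c ^ k • (φ ^ k * T) := by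
    intro k
    induction k with
    | zero => simp
    | succ k ih =>
      rw [pow_succ, ← mul_assoc, ih, smul_mul_assoc, mul_assoc, hc, mul_smul_comm, smul_smul,
        pow_succ, mul_assoc]
  have hpow' : ∀ k, T ^ k * φ = c ^ k • (φ * T ^ k) := by
    intro k
    induction k with
    | zero => simp
    | succ k ih =>
      rw [pow_succ', mul_assoc, ih, mul_smul_comm, ← mul_assoc, hc, smul_mul_assoc, smul_smul,
        mul_assoc, pow_succ]
  have hcn : c ^ n = 1 := by
    have h1 := hpow n
    rw [hφn, mul_one, one_mul] at h1
    by_contra hne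
    have h2 : (1 - c ^ n) • T = 0 := by
      rw [sub_smul (1 : ℂ) (c ^ n) T, one_smul, ← h1, sub_self]
    exact hTu.ne_zero ((smul_eq_zero.1 h2).resolve_left (sub_ne_zero.2 (Ne.symm hne)))
  by_cases h1 : c = 1
  · obtain ⟨s, hs⟩ := exists_eq_smul_one hfin hn.pos hφn htr (X := T) (fun k hk hkn => by
      refine trace_eq_zero_of_ss_lt (W.ρ i) (cpow_ne hk (hαn ▸ hkn)) fun x => ?_
      rw [← mul_ssE_apply (hS := hS)]
      exact (hφ.pow k).mul hT x) (by rw [h1, one_smul] at hc; exact hc.symm)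
    exact ⟨s ^ n, by rw [hs, smul_pow, one_pow]⟩
  · have hζ : IsPrimitiveRoot c n := by
      have : Fact n.Prime := ⟨hn⟩
      have := orderOf_eq_prime hcn h1
      rw [← this]; exact IsPrimitiveRoot.orderOf c
    refine exists_eq_smul_one hfin hn.pos hφn htr (fun k hk hkn => ?_) ?_
    · obtain ⟨u, hu⟩ := hTu
      have h2 : (u : End ℂ (Fin (W.d i) → ℂ)) * (φ ^ k * T ^ n) *
          ((u⁻¹ : (End ℂ (Fin (W.d i) → ℂ))ˣ) : End ℂ (Fin (W.d i) → ℂ)) =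
          c ^ k • (φ ^ k * T ^ n) := by
        rw [Units.mul_inv_eq_iff_eq_mul, hu, ← mul_assoc, hpow, smul_mul_assoc, smul_mul_assoc,
          mul_assoc, mul_assoc, ← pow_succ, ← pow_succ']
      have h3 := congrArg (LinearMap.trace ℂ _) h2
      rw [LinearMap.trace_mul_comm, Units.inv_mul_cancel_left, map_smul, smul_eq_mul] at h3
      by_contra h0
      exact hζ.pow_ne_one_of_pos_of_lt hk hkn (mul_right_cancel₀ h0 (by rw [← h3, one_mul]))
    · have h2 := hpow' n
      rw [hcn, one_smul] at h2
      exact h2.symm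

lemma trace_pow_eq_zero {n : ℕ} (hαn : orderOf (ltE α) = n)
    {φ : End ℂ (Fin (W.d i) → ℂ)} (hφ : W.Intertwines (ltE α) i φ) (k : ℕ) (hk : k ≠ 0)
    (hkn : k < n) : LinearMap.trace ℂ _ (φ ^ k) = 0 := by
  by_contra h0
  refine cpow_ne hk (hαn ▸ hkn) (eq_counit_of_tr_ne_zero (W.ρ i) (φ := fun v => (φ ^ k) v)
    (by fun_prop) (fun x v => ?_) (by rwa [tr_linearMap]))
  have := LinearMap.congr_fun (hφ.pow k x) v
  rw [ltE_pow] at this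
  exact this

end Hopf

section Cases

open Coalgebra HopfAlgebra

variable {H : Type*} [Ring H] [HopfAlgebra ℂ H] [Module.Finite ℂ H] {W : SimpleList H}

lemma two_le_p (h1 : Even (W.p W.triv)) (i : Fin W.n) : 2 ≤ W.p i := by
  by_contra! h
  have h2 := W.p_pos i
  have h3 := W.d_le_p i
  have h4 := W.pos i
  have h5 := W.p_eq_of_d_eq_one (i := i) (by omega)
  rw [← h5] at h1
  obtain ⟨k, hk⟩ := h1
  omega

lemma sum_insert_le {V : Fin W.n} {s : Finset (Fin W.n)} (h : V ∉ s) :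
    W.d V * W.p V + ∑ i ∈ s, W.d i * W.p i ≤ finrank ℂ H := by
  classical
  rw [← Finset.sum_insert (f := fun i => W.d i * W.p i) h]
  exact W.sum_le _

lemma sum_insert_union_le {V : Fin W.n} {s t : Finset (Fin W.n)} (hs : V ∉ s) (ht : V ∉ t)
    (hst : ∀ i ∈ s, i ∉ t) :
    W.d V * W.p V + (∑ i ∈ s, W.d i * W.p i + ∑ i ∈ t, W.d i * W.p i) ≤ finrank ℂ H := by
  classical
  rw [← Finset.sum_union (Finset.disjoint_left.2 fun i hi => hst i hi)]
  exact sum_insert_le (by simp [hs, ht])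

lemma eq_of_eq_act {κ : H ≃ₐ[ℂ] H} {i j : Fin W.n} (h1 : W.act κ i = i) (h2 : i = W.act κ j) :
    j = i := W.act_injective κ (h2.symm.trans h1.symm)

/-- An idempotent lift of the invariants is normalised by the counit. -/
lemma counit_of_lift {e : H} {φ : Dual ℂ (Fin (W.d W.triv) → ℂ)} {w : Fin (W.d W.triv) → ℂ}
    (hφ : φ w = 1) (hw : W.ρ W.triv e = φ.smulRight w) : counit (R := ℂ) e = 1 := by
  rw [← W.trace_ρ_triv, hw, LinearMap.trace_smulRight, hφ]

theorem false_of_orderOf_char {n m : ℕ} (hn : n.Prime) (hno : Odd n) (hmo : Odd m)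
    (hnm : m ≤ 2 * n + 1) (hdim : finrank ℂ H = n * m) (heven : Even (W.p W.triv))
    {hS : Function.Bijective (S : H → H)} {α : H →ₐ[ℂ] ℂ}
    (hz : ∀ (χ : H →ₐ[ℂ] ℂ) (x : H), tr (fun y => S (S (lt χ y)) * x) = 0)
    (hQ : ssE hS ^ (2 * n) = 1) (hα : orderOf (ltE α) = n) : False := by
  classical
  set L := ltE α with hLdef
  set Q := ssE hS with hQdef
  have hn3 : 3 ≤ n := by
    have := hn.two_le
    obtain ⟨k, hk⟩ := hno
    omega
  have hLn : L ^ n = 1 := by rw [← hα, pow_orderOf_eq_one]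
  have hQL : Commute Q L := commute_ssE_ltE hS α
  have hκω : ∀ c, (L ^ c * Q) ^ n = Q ^ n := mul_ssE_pow hLn
  have hκ2 : ∀ c, (L ^ c * Q) ^ (2 * n) = 1 := fun c => by
    rw [mul_comm, pow_mul, hκω, ← pow_mul, mul_comm, hQ]
  have hκz : ∀ c x, tr (fun y => (L ^ c * Q) y * x) = 0 := fun c x => by
    simp only [hLdef, hQdef, mul_ssE_apply]
    exact hz _ x
  have hω2 : (Q ^ n) ^ 2 = 1 := by rw [← pow_mul, mul_comm, hQ]
  obtain ⟨t⟩ := W.nonempty_twist hω2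
  have hp2 := two_le_p heven
  obtain ⟨V, hVω, hVo⟩ := exists_fixed_odd (fun i => W.d i * W.p i) (W.act (Q ^ n))
    (fun i => by rw [← act_mul, ← sq, hω2, act_one]) (fun i => by rw [d_act, p_act])
    (by rw [W.sum_d_mul_p, hdim]; exact hno.mul hmo)
  obtain ⟨hdV, hpV⟩ := Nat.odd_mul.1 hVo
  have hd1 : W.d V ≠ 1 := fun h => by
    rw [W.p_eq_of_d_eq_one h] at hpV
    exact Nat.not_even_iff_odd.2 hpV heven
  have hd3 : 3 ≤ W.d V := by
    obtain ⟨k, hk⟩ := hdV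
    omega
  have hdpV := W.d_le_p V
  have hVL : W.act L V = V := by
    by_contra hne
    rcases W.fixed_or_orbit hQL hn hLn hVω hne with ⟨c, hc⟩ | ⟨o, -, ho⟩
    · have h1 := le_p_of_odd hn hno (hκ2 c) (hκz c) hc hpV
      obtain ⟨o, -, ho⟩ := W.exists_prime_orbit hn hLn hne
      have h2 := W.sum_le o
      rw [ho, hdim] at h2
      have h3 := Nat.le_of_mul_le_mul_left h2 hn.pos
      nlinarith
    · have h2 := W.sum_le o
      rw [ho, hdim, mul_assoc] at h2
      have h3 := Nat.le_of_mul_le_mul_left h2 hn.pos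
      have h4 : 3 * 3 ≤ W.d V * W.p V := Nat.mul_le_mul hd3 (hd3.trans hdpV)
      nlinarith
  have hdvd : ∀ j, W.act L j = j → n ∣ W.d j := fun j hj => by
    obtain ⟨φ, hφn, hφ⟩ := W.exists_intertwiner hn.pos hLn hj
    have := dvd_finrank hn.pos hφn (trace_pow_eq_zero hα hφ)
    rwa [finrank_fin_fun] at this
  have htL : W.act L W.triv ≠ W.triv := fun h => by
    have h1 := ltE_eq_one_iff.2 (W.eq_counit_of_act_triv h)
    rw [← hα, hLdef, h1, orderOf_one] at hn3
    omega
  obtain ⟨o₁, ho₁, hs₁⟩ := W.exists_prime_orbit hn hLn htL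
  rw [d_triv, one_mul] at hs₁
  have hd₁ : ∀ j ∈ o₁, W.d j = 1 := fun j hj => by
    obtain ⟨k, rfl⟩ := ho₁ j hj
    rw [d_act, d_triv]
  have hne₁ : ∀ j, W.d j ≠ 1 → j ∉ o₁ := fun j hj h => hj (hd₁ j h)
  have hp₁ := hp2 W.triv
  have hdn : W.d V = n := by
    obtain ⟨k, hk⟩ := hdvd V hVL
    have h1 := sum_insert_le (hne₁ V hd1)
    rw [hs₁, hdim, hk, mul_assoc, ← mul_add] at h1
    have h2 := Nat.le_of_mul_le_mul_left h1 hn.pos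
    have hk0 : k ≠ 0 := by rintro rfl; omega
    have h3 : k < 2 := by
      by_contra! h3
      have h4 : n * 2 ≤ W.p V := (Nat.mul_le_mul_left n h3).trans (hk ▸ hdpV)
      nlinarith
    rw [hk, show k = 1 by omega, mul_one]
  have hpVn : n ≤ W.p V := hdn ▸ hdpV
  have hsum : W.p V + W.p W.triv ≤ m := by
    have h1 := sum_insert_le (hne₁ V hd1)
    rw [hs₁, hdim, hdn, ← mul_add] at h1
    exact Nat.le_of_mul_le_mul_left h1 hn.pos
  have huniq : ∀ j, W.act L j = j → j = V := by
    intro j hj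
    by_contra hne
    have h1 : n ≤ W.d j := Nat.le_of_dvd (W.pos j) (hdvd j hj)
    have h2 := W.d_le_p j
    have h3 := sum_insert_union_le (V := V) (s := {j}) (t := o₁) (by simpa using Ne.symm hne)
      (hne₁ V hd1) (fun i hi => by
        rw [Finset.mem_singleton.1 hi]
        exact hne₁ j (by omega))
    rw [hs₁, hdim, hdn, Finset.sum_singleton] at h3
    have h4 : n * n ≤ W.d j * W.p j := Nat.mul_le_mul h1 (h1.trans h2)
    have h5 : n * (W.p V + n + W.p W.triv) ≤ n * m := by linarith
    have h6 := Nat.le_of_mul_le_mul_left h5 hn.pos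
    omega
  have hVQ : W.act Q V = V := huniq _ (by rw [← act_mul, ← hQL.eq, act_mul, hVL])
  obtain ⟨φ, hφn, hφ⟩ := W.exists_intertwiner hn.pos hLn hVL
  obtain ⟨T, hTn, hT⟩ := W.exists_intertwiner (by omega) hQ hVQ
  obtain ⟨c, hc⟩ := pow_eq_smul_one hn hα hdn hφ hφn hT hTn (trace_pow_eq_zero hα hφ)
  obtain ⟨c', hc'⟩ := Intertwines.exists_smul (Intertwines.pow hT n) (t.comm V hVω)
    ((IsUnit.of_pow_eq_one hTn (by omega)).pow n)
  have hκ0 : L ^ 0 * Q = Q := by rw [pow_zero, one_mul]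
  have hκz0 : ∀ x, tr (fun y => Q y * x) = 0 := by simpa only [hκ0] using hκz 0
  obtain ⟨e, he, hee, hej, ψ, w, hψ, hw⟩ := W.exists_fixed_lift (by omega) hQ
    (W.act_triv (counit_ssE hS))
  have htr := W.tr_mul_eq_p hej (by rw [hw, LinearMap.trace_smulRight, hψ])
  refine t.false_of_homAct (comul_ssE_pow hS n) (pow_apply_eq he n) hee (counit_of_lift hψ hw)
    (tr_eq_zero_of_small hn hno hQ hκz0 he hee htr (Or.inr ⟨heven, by omega⟩)) hVω (fun A => ?_)
    (fun j hj => Or.inl ?_) (t.c_ne_zero rfl hn hno hQ hκz0 hVQ hpV)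
  · rw [hc', hc, smul_smul, LinearMap.smul_comp, LinearMap.comp_smul]; rfl
  · by_cases hjω : W.act (Q ^ n) j = j
    swap
    · exact t.c_eq j hjω
    have hjL : W.act L j ≠ j := fun h => hj (huniq j h)
    have hpj := hp2 j
    rcases W.fixed_or_orbit hQL hn hLn hjω hjL with ⟨c, hc⟩ | ⟨o, ho, hos⟩
    · refine t.c_eq_zero (hκω c) hn hno (hκ2 c) (hκz c) hc ?_
      by_cases hdj : W.d j = 1
      · rw [W.p_eq_of_d_eq_one hdj]
        exact Or.inr ⟨heven, by omega⟩
      · obtain ⟨o, ho, hos⟩ := W.exists_prime_orbit hn hLn hjL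
        have h1 := sum_insert_union_le (V := V) (s := o) (t := o₁) (fun h => by
            obtain ⟨k, hk⟩ := ho V h
            exact hj (eq_of_eq_act (W.act_pow_eq hVL k) hk)) (hne₁ V hd1) (fun i hi => by
            obtain ⟨k, rfl⟩ := ho i hi
            exact hne₁ _ (by rwa [d_act]))
        rw [hs₁, hos, hdim, hdn, ← mul_add, ← mul_add] at h1
        have h2 := Nat.le_of_mul_le_mul_left h1 hn.pos
        have h3 := W.pos j
        have h4 : 2 * W.p j ≤ W.d j * W.p j := Nat.mul_le_mul_right _ (by omega)
        exact Or.inl (by omega)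
    · exfalso
      have h1 := sum_insert_le (V := V) (s := o) (fun h => by
        obtain ⟨k, l, hk⟩ := ho V h
        exact hj (eq_of_eq_act (by rw [act_mul, W.act_pow_eq hVQ, W.act_pow_eq hVL]) hk))
      rw [hos, hdim, hdn, mul_assoc, ← mul_add] at h1
      have h2 := Nat.le_of_mul_le_mul_left h1 hn.pos
      have h3 : 1 * 2 ≤ W.d j * W.p j := Nat.mul_le_mul (W.pos j) hpj
      nlinarith

end Cases

end SimpleList

section Eproj

variable {A V V' : Type*} [Ring A] [Algebra ℂ A] [AddCommGroup V] [Module ℂ V] [AddCommGroup V']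
  [Module ℂ V'] (ρ : A →ₐ[ℂ] End ℂ V) (ρ' : A →ₐ[ℂ] End ℂ V')

lemma comp_eproj_eq {g : A} {B : V →ₗ[ℂ] V'} (h : ρ' g ∘ₗ B = B ∘ₗ ρ g) (ζ : ℂ) (N j : ℕ) :
    ρ' (eproj ζ N g j) ∘ₗ B = B ∘ₗ ρ (eproj ζ N g j) := by
  have h1 : ∀ k, ρ' (g ^ k) ∘ₗ B = B ∘ₗ ρ (g ^ k) := by
    intro k
    induction k with
    | zero => rw [pow_zero, map_one, map_one]; rfl
    | succ k ih =>
      rw [pow_succ, map_mul, map_mul, End.mul_eq_comp, End.mul_eq_comp, LinearMap.comp_assoc, h,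
        ← LinearMap.comp_assoc, ih, LinearMap.comp_assoc]
  refine LinearMap.ext fun v => ?_
  have h2 : ∀ k, ρ' (g ^ k) (B v) = B (ρ (g ^ k) v) := fun k => LinearMap.congr_fun (h1 k) v
  simp only [eproj, map_smul, map_sum, LinearMap.comp_apply, LinearMap.smul_apply,
    LinearMap.sum_apply, h2]

end Eproj

namespace SimpleList

section Cases

open Coalgebra HopfAlgebra

variable {H : Type*} [Ring H] [HopfAlgebra ℂ H] {W : SimpleList H}

lemma ρ_eq_zero_of_wt {E : H} {i : Fin W.n} (h : W.wt E i = 0) : W.ρ i E = 0 := by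
  rw [wt, Submodule.finrank_eq_zero] at h
  exact LinearMap.range_eq_bot.1 h

/-- An intertwiner vanishes between modules without a common eigenvalue of `g`. -/
lemma eq_zero_of_no_common_weight {g : H} {N : ℕ} (hN : 0 < N) {ζ : ℂ} (hζ : IsPrimitiveRoot ζ N)
    {i j : Fin W.n} (h : ∀ k, W.wt (eproj ζ N g k) i = 0 ∨ W.wt (eproj ζ N g k) j = 0)
    {B : (Fin (W.d i) → ℂ) →ₗ[ℂ] (Fin (W.d j) → ℂ)} (hB : W.ρ j g ∘ₗ B = B ∘ₗ W.ρ i g) : B = 0 := by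
  have h1 : B ∘ₗ W.ρ i (∑ k ∈ Finset.range N, eproj ζ N g k) = B := by
    rw [sum_eproj hN hζ, map_one]; rfl
  rw [← h1]
  refine LinearMap.ext fun v => ?_
  rw [map_sum, LinearMap.comp_apply, LinearMap.sum_apply, map_sum, LinearMap.zero_apply]
  refine Finset.sum_eq_zero fun k _ => ?_
  rw [← LinearMap.comp_apply]
  rcases h k with h | h
  · rw [ρ_eq_zero_of_wt h, LinearMap.comp_zero, LinearMap.zero_apply]
  · rw [← comp_eproj_eq _ _ hB, ρ_eq_zero_of_wt h, LinearMap.zero_comp, LinearMap.zero_apply]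

variable [Module.Finite ℂ H]

lemma sum_p_mul_ne_one (heven : Even (W.p W.triv)) (s : Finset (Fin W.n)) (f : Fin W.n → ℕ) :
    ∑ i ∈ s, W.p i * f i ≠ 1 := by
  intro h
  obtain ⟨i, hi, h0⟩ := Finset.exists_ne_zero_of_sum_ne_zero (h.trans_ne one_ne_zero)
  have h1 := Finset.single_le_sum (f := fun i => W.p i * f i) (fun _ _ => Nat.zero_le _) hi
  have h2 := two_le_p heven i
  have h3 : 2 * 1 ≤ W.p i * f i :=
    Nat.mul_le_mul h2 (Nat.pos_of_ne_zero fun h => h0 (by rw [h, mul_zero]))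
  simp only [h] at h1
  omega

theorem false_of_orderOf_grouplike {n m : ℕ} (hn : n.Prime) (hno : Odd n) (hmo : Odd m)
    (hnm : m ≤ 2 * n + 1) (hdim : finrank ℂ H = n * m) (heven : Even (W.p W.triv))
    {hS : Function.Bijective (S : H → H)}
    (hz : ∀ x, tr (fun y => ssE hS y * x) = 0) (hQ : ssE hS ^ (2 * n) = 1) {g : H}
    {hg : IsGroupLikeElem ℂ g} (hrel : adE hg * ssE hS ^ 2 = 1) (hgn : orderOf g = n) : False := by
  classical
  set Q := ssE hS with hQdef
  have hn3 : 3 ≤ n := by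
    have := hn.two_le
    obtain ⟨k, hk⟩ := hno
    omega
  have hζ := Complex.isPrimitiveRoot_exp n hn.ne_zero
  set ζ := Complex.exp (2 * Real.pi * Complex.I / n)
  have hgn1 : g ^ n = 1 := by rw [← hgn, pow_orderOf_eq_one]
  have hQg : Q g = g := ssE_grouplike hS hg
  have hEi := eproj_idem hn.pos hζ hgn1
  have hEQ : ∀ k, Q (eproj ζ n g k) = eproj ζ n g k := fun k => by rw [map_eproj, hQg]
  have hp2 := two_le_p heven
  have hsum : ∀ k, ∑ i, W.p i * W.wt (eproj ζ n g k) i = m := fun k => by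
    have h1 := W.sum_p_mul_wt_eproj hS hg (hgn.symm ▸ hζ) k
    rw [hgn, hdim] at h1
    exact Nat.eq_of_mul_eq_mul_left hn.pos h1
  have hsum1 : ∀ k i, W.p i * W.wt (eproj ζ n g k) i +
      ∑ j ∈ Finset.univ.erase i, W.p j * W.wt (eproj ζ n g k) j = m := fun k i => by
    rw [Finset.add_sum_erase _ (fun j => W.p j * W.wt (eproj ζ n g k) j) (Finset.mem_univ i), hsum]
  have hsum2 : ∀ k i j, j ≠ i → W.p i * W.wt (eproj ζ n g k) i +
      (W.p j * W.wt (eproj ζ n g k) j +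
      ∑ l ∈ (Finset.univ.erase i).erase j, W.p l * W.wt (eproj ζ n g k) l) = m := fun k i j h => by
    rw [Finset.add_sum_erase _ (fun j => W.p j * W.wt (eproj ζ n g k) j) (by simpa using h), hsum1]
  have hQ2 : ∀ i, W.act (Q ^ 2) i = i := fun i => by
    rw [eq_inv_of_mul_eq_one_right hrel, act_inv_eq_iff, act_adE]
  have hQn : ∀ i, W.act (Q ^ n) i = W.act Q i := fun i => by
    obtain ⟨k, rfl⟩ := hno
    rw [pow_succ', pow_mul, act_mul, W.act_pow_eq (hQ2 i)]
  obtain ⟨V, hVQ, hVo⟩ := exists_fixed_odd (fun i => W.p i * W.wt (eproj ζ n g 0) i) (W.act Q)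
    (fun i => by rw [← act_mul, ← sq, hQ2]) (fun i => by rw [p_act, W.wt_act (hEi 0) (hEQ 0)])
    (by rw [hsum]; exact hmo)
  obtain ⟨hpV, hwV⟩ := Nat.odd_mul.1 hVo
  have hpVn := le_p_of_odd hn hno hQ hz hVQ hpV
  have htV : W.triv ≠ V := fun h => Nat.not_even_iff_odd.2 hpV (h ▸ heven)
  have hwt : W.wt (eproj ζ n g 0) W.triv = 1 := by
    have := W.wt_eproj_triv hg (hgn.symm ▸ hζ)
    rwa [hgn] at this
  have hpt : W.p V + W.p W.triv ≤ m := by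
    have h1 := hsum2 0 V W.triv htV
    have h2 : W.p V * 1 ≤ W.p V * W.wt (eproj ζ n g 0) V := Nat.mul_le_mul_left _ hwV.pos
    rw [hwt] at h1
    omega
  have hsimple : ∀ k, W.wt (eproj ζ n g k) V = 0 ∨ W.wt (eproj ζ n g k) V = 1 := by
    intro k
    by_contra! h
    have h1 := hsum1 k V
    have h2 := sum_p_mul_ne_one heven (Finset.univ.erase V) (W.wt (eproj ζ n g k))
    set w := W.wt (eproj ζ n g k) V
    have hw3 : w < 3 := by
      by_contra! h3
      have : n * 3 ≤ W.p V * w := Nat.mul_le_mul hpVn h3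
      omega
    have hw2 : w = 2 := by omega
    rw [hw2] at h1
    obtain ⟨r, rfl⟩ := hmo
    omega
  have hω2 : (Q ^ n) ^ 2 = 1 := by rw [← pow_mul, mul_comm, hQ]
  obtain ⟨t⟩ := W.nonempty_twist hω2
  obtain ⟨e', he', hee', hej', ψ, w, hψ, hw⟩ := W.exists_fixed_lift (by omega) hQ
    (W.act_triv (counit_ssE hS))
  have hge' : Commute g e' := by
    have h1 : adE hg e' = e' := by
      have h2 := AlgEquiv.congr_fun hrel e'
      rwa [AlgEquiv.mul_apply, pow_apply_eq he', AlgEquiv.one_apply] at h2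
    rw [adE_apply] at h1
    have h3 := congrArg (· * g) h1
    simp only [mul_assoc] at h3
    rwa [show S g * g = 1 from hg.antipode_mul_cancel, mul_one] at h3
  have hEe := commute_eproj (ζ := ζ) (N := n) hge' 0
  obtain ⟨e, he⟩ : ∃ e, e = eproj ζ n g 0 * e' := ⟨_, rfl⟩
  have hee : IsIdempotentElem e := he ▸ (hEi 0).mul_of_commute hEe hee'
  have hQe : Q e = e := by rw [he, map_mul, hEQ, he']
  have hgeq : g * e = e := by
    rw [he, ← mul_assoc, mul_eproj hn.pos hζ hgn1, pow_zero, one_smul]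
  have hεe : counit (R := ℂ) e = 1 := by
    rw [he, Bialgebra.counit_mul, counit_of_lift hψ hw, ← W.wt_triv (hEi 0), hwt, Nat.cast_one,
      one_mul]
  have htr := W.tr_mul_eq_p (e := e) (i := W.triv)
    (fun j hj => by rw [he, map_mul (W.ρ j), hej' j hj, mul_zero]) (by rw [trace_ρ_triv, hεe])
  have hVω : W.act (Q ^ n) V = V := by rw [hQn, hVQ]
  refine t.false_of_homAct (comul_ssE_pow hS n) (pow_apply_eq hQe n) hee hεe
    (tr_eq_zero_of_small hn hno hQ hz hQe hee htr (Or.inr ⟨heven, by omega⟩)) hVω (fun A => ?_)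
    (fun j hj => ?_) (t.c_ne_zero rfl hn hno hQ hz hVQ hpV)
  · refine mul_comm_of_simple (φ := W.ρ V g) hn.pos hζ (by rw [← map_pow, hgn1, map_one])
      (fun k => ?_) ?_ (comp_homAct_eq _ _ hg hgeq A)
    · rw [← map_eproj, W.trace_eq_wt (hEi k)]
      exact_mod_cast hsimple k
    · have h1 := t.comm V hVω g
      rw [pow_apply_eq hQg] at h1
      exact h1.symm
  · by_cases hjω : W.act (Q ^ n) j = j
    swap
    · exact Or.inl (t.c_eq j hjω)
    have hjQ : W.act Q j = j := by rw [← hQn, hjω]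
    by_cases hk : ∀ k, W.wt (eproj ζ n g k) V = 0 ∨ W.wt (eproj ζ n g k) j = 0
    · exact Or.inr fun A => eq_zero_of_no_common_weight hn.pos hζ hk (comp_homAct_eq _ _ hg hgeq A)
    · push Not at hk
      obtain ⟨k, hkV, hkj⟩ := hk
      refine Or.inl (t.c_eq_zero rfl hn hno hQ hz hjQ ?_)
      have h1 := hsum2 k V j hj
      have h2 := sum_p_mul_ne_one heven ((Finset.univ.erase V).erase j) (W.wt (eproj ζ n g k))
      rw [(hsimple k).resolve_left hkV, mul_one] at h1
      set u := W.wt (eproj ζ n g k) j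
      have h3 : W.p j * 1 ≤ W.p j * u := Nat.mul_le_mul_left _ (Nat.pos_of_ne_zero hkj)
      by_contra! h4
      obtain ⟨h4, h5⟩ := h4
      have h6 : Odd (W.p j) := by
        rw [← Nat.not_even_iff_odd]
        intro h6
        have := h5 h6
        omega
      obtain ⟨a, ha⟩ := h6
      obtain ⟨b, hb⟩ := hpV
      obtain ⟨c, hc⟩ := hno
      obtain ⟨r, hr⟩ := hmo
      have hu : u < 2 := by
        by_contra! hu
        have : n * 2 ≤ W.p j * u := Nat.mul_le_mul h4 hu
        omega
      have hu1 : u = 1 := by omega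
      rw [hu1] at h1
      omega

end Cases

end SimpleList

open Coalgebra HopfAlgebra

lemma eq_one_or_prime_of_dvd_mul {p q a r : ℕ} (hp : p.Prime) (hq : q.Prime) (ha : a ∣ p * q)
    (hr : 2 ≤ r) (hle : a * r ≤ p * q) : a = 1 ∨ a = p ∨ a = q := by
  obtain ⟨x, y, hx, hy, rfl⟩ := (Nat.dvd_mul).1 ha
  have hpos : 0 < p * q := Nat.mul_pos hp.pos hq.pos
  rcases (Nat.dvd_prime hp).1 hx with rfl | rfl <;> rcases (Nat.dvd_prime hq).1 hy with rfl | rfl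
  · simp
  · simp
  · simp
  · nlinarith

theorem SimpleList.odd_p_triv {H : Type*} [Ring H] [HopfAlgebra ℂ H] [Module.Finite ℂ H]
    [Nontrivial H] (W : SimpleList H) {p q : ℕ} (hp : p.Prime) (hq : q.Prime) (hpo : Odd p)
    (hqo : Odd q) (hpq : p < q) (hq2p : q ≤ 2 * p + 1) (hdim : finrank ℂ H = p * q)
    (hns : ¬ IsSemisimpleRing H) : Odd (W.p W.triv) := by
  by_contra hodd
  have heven := Nat.not_odd_iff_even.1 hodd
  have hp2 := two_le_p heven W.triv
  obtain ⟨l, t, g, α, hl, hl0, hlt, ht, hα, hg, hrad, hS⟩ := exists_radford (H := H)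
  have hz := tr_ss_lt_eq_zero hns hS hl hl0 hlt ht hα
  have hrel : adE hg * ssE hS ^ 2 * ltE α = rtE α := AlgEquiv.ext hrad
  have ha := eq_one_or_prime_of_dvd_mul hp hq (hdim ▸ orderOf_ltE_dvd α) hp2
    (hdim ▸ W.orderOf_mul_p_triv_le α)
  have hb := eq_one_or_prime_of_dvd_mul hp hq (hdim ▸ orderOf_grouplike_dvd hg) hp2
    (hdim ▸ W.orderOf_mul_p_triv_le' hS hg)
  have hco := W.orderOf_mul_orderOf_mul_le hS hg α
  have hpow : ∀ n, orderOf (ltE α) ∣ n → orderOf g ∣ n → ssE hS ^ (2 * n) = 1 := fun n h1 h2 =>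
    ssE_pow_eq_one hrel (orderOf_dvd_iff_pow_eq_one.1 h2) (orderOf_dvd_iff_pow_eq_one.1 h1)
  have hz1 : ∀ x, tr (fun y => ssE hS y * x) = 0 := fun x => by
    simpa only [lt_counit, ssE_apply] using hz (Bialgebra.counitAlgHom ℂ H) x
  have hpos : 0 < p * q := Nat.mul_pos hp.pos hq.pos
  have hmain : ∀ n m : ℕ, n.Prime → Odd n → Odd m → m ≤ 2 * n + 1 → finrank ℂ H = n * m →
      (orderOf (ltE α) = n ∧ orderOf g ∣ n → False) ∧
      (orderOf (ltE α) = 1 ∧ orderOf g = n → False) := by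
    intro n m hn hno hmo hnm hd
    refine ⟨fun ⟨h1, h2⟩ => SimpleList.false_of_orderOf_char hn hno hmo hnm hd heven hz
      (hpow n h1.dvd h2) h1, fun ⟨h1, h2⟩ => ?_⟩
    rw [orderOf_eq_one_iff] at h1
    have h3 : rtE α = 1 := by simpa using rtE_pow_eq_one (n := 1) (by rw [h1, one_pow])
    rw [h1, h3, mul_one] at hrel
    exact SimpleList.false_of_orderOf_grouplike hn hno hmo hnm hd heven hz1
      (hpow n (by simp [h1]) h2.dvd) hrel h2
  have hP := hmain p q hp hpo hqo hq2p hdim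
  have hQ := hmain q p hq hqo hpo (by omega) (hdim.trans (mul_comm p q))
  have hcop : Nat.Coprime p q := (Nat.coprime_primes hp hq).2 hpq.ne
  have hlt2 : p * q < p * q * W.p W.triv := by nlinarith
  rw [hdim] at hco
  rcases ha with ha | ha | ha <;> rcases hb with hb | hb | hb
  · have h1 := hpow 1 ha.dvd hb.dvd
    have h2 := hz1 1
    simp only [mul_one] at h1 h2
    refine trace_ne_zero_of_sq (φ := (ssE hS).toLinearMap) ?_ (hdim ▸ hpo.mul hqo)
      ((tr_linearMap _).symm.trans h2)
    rw [← toLinearMap_pow, h1]; rfl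
  · exact hP.2 ⟨ha, hb⟩
  · exact hQ.2 ⟨ha, hb⟩
  · exact hP.1 ⟨ha, by simp [hb]⟩
  · exact hP.1 ⟨ha, hb.dvd⟩
  · rw [ha, hb] at hco
    have := hco hcop
    nlinarith
  · exact hQ.1 ⟨ha, by simp [hb]⟩
  · rw [ha, hb] at hco
    have := hco hcop.symm
    nlinarith
  · exact hQ.1 ⟨ha, hb.dvd⟩

end HopfOdd

/-- For a non-semisimple Hopf algebra `H` over `ℂ` of dimension `p·q`, where
`p < q ≤ 2p + 1` are odd primes, the projective cover of the trivial `H`-module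
is odd-dimensional. -/
theorem dim_projective_cover_trivial_odd (p q : ℕ) (hp : p.Prime) (hq : q.Prime)
    (hpodd : Odd p) (hqodd : Odd q) (hpq : p < q) (hq2p : q ≤ 2 * p + 1)
    (H : Type) [Ring H] [HopfAlgebra ℂ H]
    (hdim : Module.finrank ℂ H = p * q)
    (hns : ¬ IsSemisimpleRing H)
    -- the trivial H-module: ℂ with H acting through the counit
    [Module H ℂ]
    (hTriv : ∀ (x : H) (c : ℂ), x • c = Coalgebra.counit (R := ℂ) x * c)
    -- (P, π) is a projective cover of the trivial module
    (P : Type) [AddCommGroup P] [Module ℂ P] [Module H P] [IsScalarTower ℂ H P]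
    (hP : Module.Projective H P)
    (π : P →ₗ[H] ℂ) (hπ : Function.Surjective π)
    (hsup : ∀ N : Submodule H P, N ⊔ LinearMap.ker π = ⊤ → N = ⊤) :
    Odd (Module.finrank ℂ P) := by
  have hpos : 0 < Module.finrank ℂ H := hdim ▸ Nat.mul_pos hp.pos hq.pos
  have := Module.finite_of_finrank_pos hpos
  have : Nontrivial H := Module.nontrivial_of_finrank_pos hpos
  obtain ⟨W⟩ := HopfOdd.SimpleList.nonempty H
  rw [W.finrank_projective_cover hTriv hP π hπ hsup]
  exact W.odd_p_triv hp hq hpodd hqodd hpq hq2p hdim hns
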